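/- arXiv:1201.5558 — 2 statements merged into one kernel-verified Lean document; each statement's English description precedes it below -/
import Mathlib

section
/- (Extended Hardy inequality) Let g : ℝ → ℂ be Lebesgue integrable and suppose its Hilbert transform Hg(x) = (1/π) lim_{δ→0+} ∫_{|t−x|>δ} g(t)/(t−x) dt is also Lebesgue integrable on ℝ (i.e., g belongs to the real Hardy space H^1(ℝ)). Then ∫_ℝ |ĝ(x)|/|x| dx ≤ C (‖g‖_{L^1(ℝ)} + ‖Hg‖_{L^1(ℝ)}) for an absolute constant C > 0, where ĝ(x) = ∫_ℝ g(t) e^{−ixt} dt is the Fourier transform of g. -/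
open MeasureTheory Filter Set Real Complex

/-- Partial sums of the Hilbert kernel row against the Schur weight `1/√(k+1)`, short range. -/
lemma sum_inv_sqrt_le (N : ℕ) : ∑ k ∈ Finset.range N, 1 / √((k : ℝ) + 1) ≤ 2 * √(N : ℝ) := by
  induction N with
  | zero => simp
  | succ n ih =>
    rw [Finset.sum_range_succ]
    have h1 : 0 < √((n : ℝ) + 1) := Real.sqrt_pos.2 (by positivity)
    have h2 : √((n : ℝ) + 1) ^ 2 = n + 1 := Real.sq_sqrt (by positivity)
    have h3 : √(n : ℝ) ^ 2 = n := Real.sq_sqrt (by positivity)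
    have h0 : 0 ≤ √(n : ℝ) := Real.sqrt_nonneg _
    have : 1 / √((n : ℝ) + 1) ≤ 2 * (√((n : ℝ) + 1) - √(n : ℝ)) := by
      rw [div_le_iff₀ h1]
      nlinarith [sq_nonneg (√((n : ℝ) + 1) - √(n : ℝ))]
    push_cast
    linarith

/-- Schur test for the Hilbert kernel with weight `1/√(k+1)`. -/
lemma sum_hilbert_kernel_le (j N : ℕ) :
    ∑ k ∈ Finset.range N, 1 / ((j : ℝ) + k + 1) * (1 / √((k : ℝ) + 1)) ≤ 4 / √((j : ℝ) + 1) := by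
  have hj1 : 0 < √((j : ℝ) + 1) := Real.sqrt_pos.2 (by positivity)
  have hj2 : √((j : ℝ) + 1) ^ 2 = j + 1 := Real.sq_sqrt (by positivity)
  have tail : ∀ m : ℕ, ∑ k ∈ Finset.range (j + 1 + m),
      1 / ((j : ℝ) + k + 1) * (1 / √((k : ℝ) + 1))
        ≤ 4 / √((j : ℝ) + 1) - 2 / √((j : ℝ) + 1 + m) := by
    intro m
    induction m with
    | zero =>
      have h : ∀ k ∈ Finset.range (j + 1 + 0), 1 / ((j : ℝ) + k + 1) * (1 / √((k : ℝ) + 1))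
          ≤ 1 / ((j : ℝ) + 1) * (1 / √((k : ℝ) + 1)) := by
        intro k _
        have : (0 : ℝ) ≤ k := by positivity
        gcongr
        linarith
      refine (Finset.sum_le_sum h).trans ?_
      rw [← Finset.mul_sum]
      have := sum_inv_sqrt_le (j + 1 + 0)
      calc _ ≤ 1 / ((j : ℝ) + 1) * (2 * √((j : ℝ) + 1)) := by
            gcongr
            simpa using this
        _ = _ := by
            rw [← hj2]
            field_simp
            simp
            field_simp
            norm_num
    | succ m ih =>
      rw [← add_assoc, Finset.sum_range_succ]
      push_cast
      set x : ℝ := (j : ℝ) + 1 + m with hx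
      have hx0 : 0 < x := by positivity
      have h1 : 0 < √x := Real.sqrt_pos.2 hx0
      have h2 : 0 < √(x + 1) := Real.sqrt_pos.2 (by positivity)
      have h3 : √x ^ 2 = x := Real.sq_sqrt hx0.le
      have h4 : √(x + 1) ^ 2 = x + 1 := Real.sq_sqrt (by positivity)
      have h5 : √x ≤ √(x + 1) := Real.sqrt_le_sqrt (by linarith)
      have key : 1 / ((j : ℝ) + x + 1) * (1 / √(x + 1)) ≤ 2 / √x - 2 / √(x + 1) := by
        calc 1 / ((j : ℝ) + x + 1) * (1 / √(x + 1)) ≤ 1 / (x + 1) * (1 / √(x + 1)) := by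
              have : (0 : ℝ) ≤ j := by positivity
              gcongr
              linarith
          _ ≤ 2 / √x - 2 / √(x + 1) := by
              rw [div_sub_div _ _ h1.ne' h2.ne', div_mul_div_comm,
                div_le_div_iff₀ (by positivity) (by positivity)]
              have e : (√(x + 1) - √x) * (√(x + 1) + √x) = 1 := by nlinarith
              have e0 : 0 ≤ √(x + 1) - √x := by linarith
              have e2 : 1 ≤ 2 * √(x + 1) * (√(x + 1) - √x) := by nlinarith
              have e3 : √x * √(x + 1) ≤ x + 1 := by nlinarith
              nlinarith [mul_le_mul_of_nonneg_right e2 (show 0 ≤ (x + 1) by positivity)]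
      rw [show (j : ℝ) + 1 + (m + 1) = x + 1 by rw [hx]; ring]
      linarith
  rcases le_total (j + 1) N with h | h
  · obtain ⟨m, rfl⟩ := Nat.exists_eq_add_of_le h
    have : 0 ≤ 2 / √((j : ℝ) + 1 + m) := by positivity
    linarith [tail m]
  · have h0 := tail 0
    have : 0 ≤ 2 / √((j : ℝ) + 1 + (0 : ℕ)) := by positivity
    refine (Finset.sum_le_sum_of_subset_of_nonneg (Finset.range_mono ?_) ?_).trans
      (h0.trans (by linarith))
    · simpa using h
    · intros; positivity

/-- Hilbert's inequality for finite nonnegative sequences, in arithmetic-mean form. -/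
lemma hilbert_inequality_finite (N : ℕ) (b c : ℕ → ℝ) :
    ∑ j ∈ Finset.range N, ∑ k ∈ Finset.range N, b j * c k / ((j : ℝ) + k + 1)
      ≤ 2 * (∑ j ∈ Finset.range N, b j ^ 2 + ∑ k ∈ Finset.range N, c k ^ 2) := by
  have term : ∀ j k : ℕ, b j * c k / ((j : ℝ) + k + 1) ≤
      b j ^ 2 / 2 * √((j : ℝ) + 1) * (1 / ((j : ℝ) + k + 1) * (1 / √((k : ℝ) + 1))) +
      c k ^ 2 / 2 * √((k : ℝ) + 1) * (1 / ((k : ℝ) + j + 1) * (1 / √((j : ℝ) + 1))) := by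
    intro j k
    have hp : 0 < √((j : ℝ) + 1) := Real.sqrt_pos.2 (by positivity)
    have hq : 0 < √((k : ℝ) + 1) := Real.sqrt_pos.2 (by positivity)
    have hd : 0 < (j : ℝ) + k + 1 := by positivity
    rw [add_comm (k : ℝ) j]
    set p := √((j : ℝ) + 1)
    set q := √((k : ℝ) + 1)
    have : b j ^ 2 / 2 * p * (1 / ((j : ℝ) + k + 1) * (1 / q)) +
      c k ^ 2 / 2 * q * (1 / ((j : ℝ) + k + 1) * (1 / p)) - b j * c k / ((j : ℝ) + k + 1)
      = (b j * p - c k * q) ^ 2 / (2 * p * q * ((j : ℝ) + k + 1)) := by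
      field_simp
      ring
    have h2 : 0 ≤ (b j * p - c k * q) ^ 2 / (2 * p * q * ((j : ℝ) + k + 1)) := by positivity
    linarith
  have row : ∀ (a : ℕ → ℝ), ∑ j ∈ Finset.range N, ∑ k ∈ Finset.range N,
      a j ^ 2 / 2 * √((j : ℝ) + 1) * (1 / ((j : ℝ) + k + 1) * (1 / √((k : ℝ) + 1)))
      ≤ 2 * ∑ j ∈ Finset.range N, a j ^ 2 := by
    intro a
    rw [Finset.mul_sum]
    refine Finset.sum_le_sum fun j _ => ?_
    rw [← Finset.mul_sum]
    have hp : 0 < √((j : ℝ) + 1) := Real.sqrt_pos.2 (by positivity)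
    calc _ ≤ a j ^ 2 / 2 * √((j : ℝ) + 1) * (4 / √((j : ℝ) + 1)) := by
          gcongr
          exact sum_hilbert_kernel_le j N
      _ = 2 * a j ^ 2 := by
          field_simp
          norm_num
  refine (Finset.sum_le_sum fun j _ => Finset.sum_le_sum fun k _ => term j k).trans ?_
  simp only [Finset.sum_add_distrib]
  rw [mul_add]
  refine add_le_add (row b) ?_
  rw [Finset.sum_comm]
  exact row c

/-- The `n`-th Taylor coefficient at the origin. -/
noncomputable def taylorCoeffZero (h : ℂ → ℂ) (n : ℕ) : ℂ := iteratedDeriv n h 0 / n.factorial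

/-- Bessel's inequality for Taylor coefficients of a function in the disc algebra. -/
lemma sum_sq_taylorCoeffZero_le {h : ℂ → ℂ} (hh : DiffContOnCl ℂ h (Metric.ball 0 1)) (N : ℕ) :
    ∑ n ∈ Finset.range N, ‖taylorCoeffZero h n‖ ^ 2
      ≤ (2 * π)⁻¹ * ∫ θ in (0 : ℝ)..2 * π, ‖h (circleMap 0 1 θ)‖ ^ 2 := by
  have hpi : (0 : ℝ) < 2 * π := Real.two_pi_pos
  have hcont : Continuous fun θ : ℝ => h (circleMap 0 1 θ) := by
    have : ContinuousOn h (Metric.closedBall 0 1) := by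
      have := hh.continuousOn
      rwa [closure_ball _ one_ne_zero] at this
    exact this.comp_continuous (continuous_circleMap 0 1)
      fun θ => circleMap_mem_closedBall 0 zero_le_one θ
  have hL2 : MemLp (fun θ : ℝ => h (circleMap 0 1 θ)) 2 (volume.restrict (Ioc 0 (2 * π))) := by
    obtain ⟨C, hC⟩ := isCompact_Icc.exists_bound_of_continuousOn
      (hcont.continuousOn (s := Icc 0 (2 * π)))
    refine MemLp.of_bound hcont.aestronglyMeasurable C ?_
    filter_upwards [ae_restrict_mem measurableSet_Ioc] with θ hθ
    exact hC θ (Ioc_subset_Icc_self hθ)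
  have hs := hasSum_sq_fourierCoeffOn hpi hL2
  have hcoef : ∀ n : ℕ, fourierCoeffOn hpi (fun θ : ℝ => h (circleMap 0 1 θ)) n
      = taylorCoeffZero h n := by
    intro n
    have hc := DiffContOnCl.circleIntegral_one_div_sub_center_pow_smul one_pos n hh
    rw [circleIntegral] at hc
    rw [fourierCoeffOn_eq_integral, taylorCoeffZero]
    have e : ∫ θ in (0 : ℝ)..2 * π, deriv (circleMap 0 1) θ •
        (1 / (circleMap 0 1 θ - 0) ^ (n + 1)) • h (circleMap 0 1 θ) =
        Complex.I * ∫ θ in (0 : ℝ)..2 * π,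
          (fourier (-(n : ℤ)) (θ : AddCircle (2 * π - 0)) : ℂ) • h (circleMap 0 1 θ) := by
      rw [← intervalIntegral.integral_const_mul]
      refine intervalIntegral.integral_congr fun θ _ => ?_
      simp only [deriv_circleMap, smul_eq_mul, sub_zero, circleMap, zero_add, ofReal_one, one_mul,
        fourier_coe_apply]
      have : Complex.exp (2 * π * Complex.I * ((-(n : ℤ) : ℤ) : ℂ) * (θ : ℂ) / ((2 * π : ℝ) : ℂ))
          = (Complex.exp (θ * Complex.I) ^ n)⁻¹ := by
        rw [← Complex.exp_nat_mul, ← Complex.exp_neg]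
        congr 1
        have : (π : ℂ) ≠ 0 := by exact_mod_cast Real.pi_ne_zero
        push_cast
        field_simp
      rw [this]
      have := Complex.exp_ne_zero (θ * Complex.I)
      field_simp
      ring
    rw [e] at hc
    have hI := Complex.I_ne_zero
    have hf : (n.factorial : ℂ) ≠ 0 := by exact_mod_cast n.factorial_ne_zero
    have hp : (π : ℂ) ≠ 0 := by exact_mod_cast Real.pi_ne_zero
    have hc' : (∫ θ in (0 : ℝ)..2 * π,
          (fourier (-(n : ℤ)) (θ : AddCircle (2 * π - 0)) : ℂ) • h (circleMap 0 1 θ))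
          = (2 * π / n.factorial) * iteratedDeriv n h 0 := by
      apply mul_left_cancel₀ hI
      rw [hc, smul_eq_mul]
      ring
    rw [hc', Complex.real_smul]
    push_cast
    field_simp
    simp
  have hle := sum_le_hasSum ((Finset.range N).map ⟨((↑) : ℕ → ℤ), Nat.cast_injective⟩)
    (fun i _ => by positivity) hs
  simp only [Finset.sum_map, Function.Embedding.coeFn_mk, hcoef] at hle
  simpa using hle

/-- Taylor coefficients of a product. -/
lemma taylorCoeffZero_mul {h q : ℂ → ℂ} (hh : DiffContOnCl ℂ h (Metric.ball 0 1))
    (hq : DiffContOnCl ℂ q (Metric.ball 0 1)) (n : ℕ) :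
    taylorCoeffZero (h * q) n
      = ∑ i ∈ Finset.range (n + 1), taylorCoeffZero h i * taylorCoeffZero q (n - i) := by
  have an : ∀ {f : ℂ → ℂ}, DiffContOnCl ℂ f (Metric.ball 0 1) → ContDiffAt ℂ n f 0 := fun hf =>
    (hf.differentiableOn.analyticAt (Metric.ball_mem_nhds 0 one_pos)).contDiffAt
  rw [taylorCoeffZero, iteratedDeriv_mul (an hh) (an hq), Finset.sum_div]
  refine Finset.sum_congr rfl fun i hi => ?_
  have hi' : i ≤ n := by simpa [Nat.lt_succ_iff] using hi
  have h1 : (n.factorial : ℂ) ≠ 0 := by exact_mod_cast n.factorial_ne_zero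
  have h2 : (i.factorial : ℂ) ≠ 0 := by exact_mod_cast i.factorial_ne_zero
  have h3 : ((n - i).factorial : ℂ) ≠ 0 := by exact_mod_cast (n - i).factorial_ne_zero
  have h4 : (n.choose i : ℂ) * i.factorial * (n - i).factorial = n.factorial := by
    exact_mod_cast Nat.choose_mul_factorial_mul_factorial hi'
  simp only [taylorCoeffZero]
  rw [← h4]
  have h5 : (n.choose i : ℂ) ≠ 0 := by exact_mod_cast (Nat.choose_pos hi').ne'
  field_simp

/-- The square root of `1 - a z`, `|a| ≤ 1`, belongs to the disc algebra. -/
lemma diffContOnCl_sqrt_one_sub {a : ℂ} (ha : ‖a‖ ≤ 1) :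
    DiffContOnCl ℂ (fun z => (1 - a * z) ^ (1 / 2 : ℂ)) (Metric.ball 0 1) := by
  constructor
  · intro z hz
    have hz' : ‖z‖ < 1 := by simpa using hz
    have : (1 - a * z) ∈ slitPlane := by
      left
      have : ‖a * z‖ < 1 := by
        rw [norm_mul]
        nlinarith [norm_nonneg a, norm_nonneg z]
      have := (Complex.re_le_norm (a * z)).trans_lt this
      simp only [sub_re, one_re]
      linarith
    refine DifferentiableAt.differentiableWithinAt ?_
    exact DifferentiableAt.cpow (by fun_prop) (by fun_prop) this
  · rw [closure_ball _ one_ne_zero]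
    intro z hz
    have hz' : ‖z‖ ≤ 1 := by simpa using hz
    have : 0 ≤ (1 - a * z).re := by
      have : ‖a * z‖ ≤ 1 := by
        rw [norm_mul]
        nlinarith [norm_nonneg a, norm_nonneg z]
      have := (Complex.re_le_norm (a * z)).trans this
      simp only [sub_re, one_re]
      linarith
    have hc := Complex.continuousAt_cpow_const_of_re_pos (z := 1 - a * z) (w := (1 / 2 : ℂ))
      (Or.inl this) (by norm_num)
    exact (ContinuousAt.comp (f := fun z : ℂ => 1 - a * z) hc (by fun_prop)).continuousWithinAt

/-- `p` splits as a product of two disc algebra functions, each with modulus `√|p|` on the unit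
circle. -/
def HasBalancedFactorization (p : ℂ → ℂ) : Prop :=
  ∃ h q : ℂ → ℂ, DiffContOnCl ℂ h (Metric.ball 0 1) ∧ DiffContOnCl ℂ q (Metric.ball 0 1) ∧
    (∀ z ∈ Metric.ball (0 : ℂ) 1, p z = h z * q z) ∧
    ∀ z, ‖z‖ = 1 → ‖h z‖ ^ 2 = ‖p z‖ ∧ ‖q z‖ ^ 2 = ‖p z‖

lemma HasBalancedFactorization.mul {p p' : ℂ → ℂ} (hp : HasBalancedFactorization p)
    (hp' : HasBalancedFactorization p') : HasBalancedFactorization fun z => p z * p' z := by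
  obtain ⟨h, q, h1, h2, h3, h4⟩ := hp
  obtain ⟨h', q', h1', h2', h3', h4'⟩ := hp'
  refine ⟨fun z => h z * h' z, fun z => q z * q' z, h1.smul h1', h2.smul h2', fun z hz => ?_,
    fun z hz => ?_⟩
  · simp only [h3 z hz, h3' z hz]
    ring
  · simp only [norm_mul, mul_pow]
    rw [(h4 z hz).1, (h4 z hz).2, (h4' z hz).1, (h4' z hz).2]
    exact ⟨rfl, rfl⟩

lemma norm_cpow_half_sq (w : ℂ) : ‖w ^ (1 / 2 : ℂ)‖ ^ 2 = ‖w‖ := by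
  rw [← norm_pow, ← Complex.cpow_nat_mul]
  norm_num

lemma HasBalancedFactorization.const (a : ℂ) : HasBalancedFactorization fun _ => a := by
  refine ⟨fun _ => a ^ (1 / 2 : ℂ), fun _ => a ^ (1 / 2 : ℂ), diffContOnCl_const,
    diffContOnCl_const, fun z _ => ?_, fun z _ => ⟨norm_cpow_half_sq a, norm_cpow_half_sq a⟩⟩
  rw [← sq, ← Complex.cpow_nat_mul]
  norm_num

lemma HasBalancedFactorization.one_sub {a : ℂ} (ha : ‖a‖ ≤ 1) :
    HasBalancedFactorization fun z => 1 - a * z := by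
  refine ⟨fun z => (1 - a * z) ^ (1 / 2 : ℂ), fun z => (1 - a * z) ^ (1 / 2 : ℂ),
    diffContOnCl_sqrt_one_sub ha, diffContOnCl_sqrt_one_sub ha, fun z _ => ?_,
    fun z _ => ⟨norm_cpow_half_sq _, norm_cpow_half_sq _⟩⟩
  rw [← sq, ← Complex.cpow_nat_mul]
  norm_num

/-- A linear factor with root in the open disc is a Blaschke factor times a zero-free one. -/
lemma HasBalancedFactorization.sub_of_norm_lt_one {a : ℂ} (ha : ‖a‖ < 1) :
    HasBalancedFactorization fun z => z - a := by
  set b := (starRingEnd ℂ) a with hb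
  have hbn : ‖b‖ = ‖a‖ := RCLike.norm_conj a
  have hs := diffContOnCl_sqrt_one_sub (hbn.le.trans ha.le)
  have ne : ∀ z : ℂ, ‖z‖ ≤ 1 → 1 - b * z ≠ 0 := by
    intro z hz h0
    have : ‖b * z‖ = 1 := by rw [← sub_eq_zero.1 h0, norm_one]
    rw [norm_mul, hbn] at this
    nlinarith [norm_nonneg a, norm_nonneg z]
  have ne' : ∀ z : ℂ, ‖z‖ ≤ 1 → (1 - b * z) ^ (1 / 2 : ℂ) ≠ 0 := by
    intro z hz h0
    exact ne z hz (Complex.cpow_eq_zero_iff _ _ |>.1 h0).1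
  have norm_eq : ∀ z : ℂ, ‖z‖ = 1 → ‖1 - b * z‖ = ‖z - a‖ := by
    intro z hz
    have : 1 - b * z = (starRingEnd ℂ) (z - a) * z := by
      have : (starRingEnd ℂ) z * z = 1 := by
        rw [mul_comm, Complex.mul_conj, Complex.normSq_eq_norm_sq, hz]
        norm_num
      rw [map_sub, sub_mul, this]
    rw [this, norm_mul, hz, mul_one, RCLike.norm_conj]
  refine ⟨fun z => (1 - b * z) ^ (1 / 2 : ℂ), fun z => ((1 - b * z) ^ (1 / 2 : ℂ))⁻¹ * (z - a),
    hs, (hs.inv ?_).smul (Differentiable.diffContOnCl (by fun_prop)), fun z hz => ?_,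
    fun z hz => ?_⟩
  · intro z hz
    rw [closure_ball _ one_ne_zero] at hz
    exact ne' z (by simpa using hz)
  · have hz' : ‖z‖ < 1 := by simpa using hz
    exact (mul_inv_cancel_left₀ (ne' z hz'.le) _).symm
  · have h1 := norm_cpow_half_sq (1 - b * z)
    refine ⟨by rw [h1, norm_eq z hz], ?_⟩
    rw [norm_mul, norm_inv, mul_pow, inv_pow, h1, norm_eq z hz]
    have : ‖z - a‖ ≠ 0 := by
      rw [← norm_eq z hz]
      exact norm_ne_zero_iff.2 (ne z hz.le)
    field_simp

lemma HasBalancedFactorization.sub (a : ℂ) : HasBalancedFactorization fun z => z - a := by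
  rcases lt_or_ge ‖a‖ 1 with ha | ha
  · exact .sub_of_norm_lt_one ha
  · have ha0 : a ≠ 0 := by
      rintro rfl
      norm_num at ha
    have := (HasBalancedFactorization.const (-a)).mul
      (HasBalancedFactorization.one_sub (a := a⁻¹) (by
        rw [norm_inv]
        exact inv_le_one_of_one_le₀ ha))
    convert this using 2 with z
    field_simp
    ring

lemma HasBalancedFactorization.polynomial (p : Polynomial ℂ) :
    HasBalancedFactorization fun z => p.eval z := by
  have hp := (IsAlgClosed.splits p).eq_prod_roots
  rw [hp]
  generalize p.roots = s
  induction s using Multiset.induction_on with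
  | empty => simpa using HasBalancedFactorization.const _
  | cons a s ih =>
    convert (HasBalancedFactorization.sub a).mul ih using 2 with z
    simp only [Multiset.map_cons, Multiset.prod_cons, Polynomial.eval_mul, Polynomial.eval_C,
      Polynomial.eval_sub, Polynomial.eval_X]
    ring

lemma iteratedDeriv_polynomial_eval (p : Polynomial ℂ) (n : ℕ) :
    iteratedDeriv n (fun z => p.eval z) = fun z => (Polynomial.derivative^[n] p).eval z := by
  induction n with
  | zero => simp
  | succ n ih =>
    rw [iteratedDeriv_succ, ih, Function.iterate_succ_apply']
    ext z
    simp

/-- Hardy's inequality for polynomials on the unit circle. -/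
lemma hardy_inequality_polynomial (p : Polynomial ℂ) (N : ℕ) :
    ∑ n ∈ Finset.range N, ‖p.coeff n‖ / ((n : ℝ) + 1)
      ≤ 4 * ((2 * π)⁻¹ * ∫ θ in (0 : ℝ)..2 * π, ‖p.eval (circleMap 0 1 θ)‖) := by
  obtain ⟨h, q, hh, hq, hprod, hcirc⟩ := HasBalancedFactorization.polynomial p
  have hnorm : ∀ θ : ℝ, ‖circleMap 0 1 θ‖ = 1 := fun θ => by simp
  have hb := sum_sq_taylorCoeffZero_le hh N
  have hc := sum_sq_taylorCoeffZero_le hq N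
  simp only [(hcirc _ (hnorm _)).1] at hb
  simp only [(hcirc _ (hnorm _)).2] at hc
  have hcoeff : ∀ n, p.coeff n
      = ∑ i ∈ Finset.range (n + 1), taylorCoeffZero h i * taylorCoeffZero q (n - i) := by
    intro n
    rw [← taylorCoeffZero_mul hh hq]
    have : (fun z => p.eval z) =ᶠ[nhds 0] h * q := by
      filter_upwards [Metric.ball_mem_nhds (0 : ℂ) one_pos] with z hz using hprod z hz
    rw [taylorCoeffZero, ← this.iteratedDeriv_eq, iteratedDeriv_polynomial_eval]
    beta_reduce
    rw [← Polynomial.coeff_zero_eq_eval_zero, Polynomial.coeff_iterate_derivative]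
    have hf : (n.factorial : ℂ) ≠ 0 := by exact_mod_cast n.factorial_ne_zero
    simp [Nat.descFactorial_self]
    field_simp
  set b : ℕ → ℝ := fun n => ‖taylorCoeffZero h n‖
  set c : ℕ → ℝ := fun n => ‖taylorCoeffZero q n‖
  calc ∑ n ∈ Finset.range N, ‖p.coeff n‖ / ((n : ℝ) + 1)
      ≤ ∑ n ∈ Finset.range N, ∑ i ∈ Finset.range (n + 1),
          b i * c (n - i) / ((i : ℝ) + (n - i : ℕ) + 1) := by
        refine Finset.sum_le_sum fun n _ => ?_
        rw [hcoeff n]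
        calc _ ≤ (∑ i ∈ Finset.range (n + 1), b i * c (n - i)) / ((n : ℝ) + 1) := by
              gcongr
              refine (norm_sum_le _ _).trans (Finset.sum_le_sum fun i _ => ?_)
              rw [norm_mul]
          _ = _ := by
              rw [Finset.sum_div]
              refine Finset.sum_congr rfl fun i hi => ?_
              have hi' : i ≤ n := by simpa [Nat.lt_succ_iff] using hi
              congr 2
              push_cast [Nat.cast_sub hi']
              ring
    _ ≤ ∑ j ∈ Finset.range N, ∑ k ∈ Finset.range N, b j * c k / ((j : ℝ) + k + 1) := by
        rw [Finset.sum_sigma', ← Finset.sum_product']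
        have inj : Set.InjOn (fun x : (_ : ℕ) × ℕ => (x.2, x.1 - x.2))
            ((Finset.range N).sigma fun n => Finset.range (n + 1)) := by
          rintro ⟨n, i⟩ hx ⟨m, j⟩ hy hxy
          simp only [Finset.coe_sigma, Set.mem_sigma_iff, Finset.coe_range, Set.mem_Iio,
            Prod.mk.injEq] at hx hy hxy
          obtain ⟨rfl, h2⟩ := hxy
          obtain rfl : n = m := by omega
          rfl
        rw [← Finset.sum_image (f := fun x : ℕ × ℕ => b x.1 * c x.2 / ((x.1 : ℝ) + x.2 + 1)) inj]
        refine Finset.sum_le_sum_of_subset_of_nonneg ?_ fun x _ _ => by positivity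
        intro x hx
        simp only [Finset.mem_image, Finset.mem_sigma, Finset.mem_range, Finset.mem_product] at hx ⊢
        obtain ⟨y, hy, rfl⟩ := hx
        dsimp only
        omega
    _ ≤ 2 * (∑ j ∈ Finset.range N, b j ^ 2 + ∑ k ∈ Finset.range N, c k ^ 2) :=
        hilbert_inequality_finite N b c
    _ ≤ _ := by linarith

/-- The Fourier transform with the normalisation `∫ f(t) e^{-iξt} dt`. -/
noncomputable def ft (f : ℝ → ℂ) (ξ : ℝ) : ℂ :=
  ∫ t : ℝ, f t * Complex.exp (-(Complex.I) * (ξ : ℂ) * (t : ℂ))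

lemma norm_exp_neg_I_mul (ξ t : ℝ) : ‖Complex.exp (-(Complex.I) * (ξ : ℂ) * (t : ℂ))‖ = 1 := by
  rw [show -(Complex.I) * (ξ : ℂ) * (t : ℂ) = ((-(ξ * t) : ℝ) : ℂ) * Complex.I by push_cast; ring]
  exact Complex.norm_exp_ofReal_mul_I _

lemma integrable_mul_exp {f : ℝ → ℂ} (hf : Integrable f) (ξ : ℝ) :
    Integrable fun t : ℝ => f t * Complex.exp (-(Complex.I) * (ξ : ℂ) * (t : ℂ)) := by
  refine hf.mul_bdd (c := 1) (by fun_prop) ?_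
  exact Eventually.of_forall fun t => (norm_exp_neg_I_mul ξ t).le

lemma continuous_ft {f : ℝ → ℂ} (hf : Integrable f) : Continuous (ft f) := by
  refine continuous_of_dominated (bound := fun t => ‖f t‖)
    (fun ξ => (integrable_mul_exp hf ξ).aestronglyMeasurable)
    (fun ξ => Eventually.of_forall fun t => ?_) hf.norm
    (Eventually.of_forall fun t => by fun_prop)
  rw [norm_mul, norm_exp_neg_I_mul, mul_one]

/-- The Fejér kernel. -/
noncomputable def fejerKernel (N : ℕ) (φ : ℝ) : ℝ :=
  ‖∑ j ∈ Finset.range N, Complex.exp (Complex.I * j * φ)‖ ^ 2 / N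

lemma fejerKernel_nonneg (N : ℕ) (φ : ℝ) : 0 ≤ fejerKernel N φ := by
  unfold fejerKernel; positivity

lemma continuous_fejerKernel (N : ℕ) : Continuous (fejerKernel N) := by
  unfold fejerKernel; fun_prop

lemma fejerKernel_le (N : ℕ) (φ : ℝ) : fejerKernel N φ ≤ N := by
  unfold fejerKernel
  have : ‖∑ j ∈ Finset.range N, Complex.exp (Complex.I * j * φ)‖ ≤ N := by
    refine (norm_sum_le _ _).trans ?_
    have : ∀ j ∈ Finset.range N, ‖Complex.exp (Complex.I * j * φ)‖ ≤ 1 := by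
      intro j _
      rw [show Complex.I * j * φ = ((j * φ : ℝ) : ℂ) * Complex.I by push_cast; ring,
        Complex.norm_exp_ofReal_mul_I]
    simpa using Finset.sum_le_sum this
  rcases Nat.eq_zero_or_pos N with rfl | hN
  · simp
  have hN' : (0 : ℝ) < N := by exact_mod_cast hN
  rw [div_le_iff₀ hN']
  nlinarith [norm_nonneg (∑ j ∈ Finset.range N, Complex.exp (Complex.I * j * φ))]

lemma fejerKernel_eq (N : ℕ) (φ : ℝ) : (fejerKernel N φ : ℂ) =
    (∑ j ∈ Finset.range N, ∑ k ∈ Finset.range N,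
      Complex.exp (Complex.I * ((j : ℂ) - k) * φ)) / N := by
  unfold fejerKernel
  push_cast
  congr 1
  rw [← Complex.mul_conj', map_sum, Finset.sum_mul_sum]
  refine Finset.sum_congr rfl fun j _ => Finset.sum_congr rfl fun k _ => ?_
  rw [← Complex.exp_conj, ← Complex.exp_add]
  congr 1
  simp
  ring

lemma integral_fejerKernel {N : ℕ} (hN : N ≠ 0) (c : ℝ) :
    ∫ θ in (0 : ℝ)..2 * π, fejerKernel N (θ - c) = 2 * π := by
  have hN' : (N : ℂ) ≠ 0 := by exact_mod_cast hN
  have term : ∀ j k : ℕ, ∫ θ in (0 : ℝ)..2 * π,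
      Complex.exp (Complex.I * ((j : ℂ) - k) * ((θ - c : ℝ) : ℂ))
        = if j = k then 2 * (π : ℂ) else 0 := by
    intro j k
    split_ifs with h
    · simp [h]
    · have hm : Complex.I * ((j : ℂ) - k) ≠ 0 := by
        refine mul_ne_zero Complex.I_ne_zero (sub_ne_zero.2 ?_)
        exact_mod_cast h
      have e : ∀ θ : ℝ, Complex.exp (Complex.I * ((j : ℂ) - k) * ((θ - c : ℝ) : ℂ))
          = Complex.exp (-(Complex.I * ((j : ℂ) - k) * c)) *
            Complex.exp (Complex.I * ((j : ℂ) - k) * θ) := by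
        intro θ
        rw [← Complex.exp_add]
        push_cast
        ring_nf
      simp only [e]
      rw [intervalIntegral.integral_const_mul, integral_exp_mul_complex hm]
      have : Complex.exp (Complex.I * ((j : ℂ) - k) * ((2 * π : ℝ) : ℂ)) = 1 := by
        rw [Complex.exp_eq_one_iff]
        exact ⟨(j : ℤ) - k, by push_cast; ring⟩
      rw [this]
      simp
  have : ((∫ θ in (0 : ℝ)..2 * π, fejerKernel N (θ - c) : ℝ) : ℂ) = ((2 * π : ℝ) : ℂ) := by
    rw [← intervalIntegral.integral_ofReal]
    simp only [fejerKernel_eq]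
    rw [intervalIntegral.integral_div, intervalIntegral.integral_finsetSum
      (fun j _ => Continuous.intervalIntegrable (by fun_prop) _ _)]
    have : ∀ j ∈ Finset.range N, ∫ θ in (0 : ℝ)..2 * π, ∑ k ∈ Finset.range N,
        Complex.exp (Complex.I * ((j : ℂ) - k) * ((θ - c : ℝ) : ℂ)) = 2 * (π : ℂ) := by
      intro j hj
      rw [intervalIntegral.integral_finsetSum
        (fun k _ => Continuous.intervalIntegrable (by fun_prop) _ _)]
      simp only [term, Finset.sum_ite_eq, hj, if_true]
    rw [Finset.sum_congr rfl this]
    simp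
    field_simp
  exact_mod_cast this

/-- The Fejér means of the sampled Fourier transform of a function with spectrum in `[0, ∞)`. -/
noncomputable def fejerPolynomial (f : ℝ → ℂ) (h : ℝ) (N : ℕ) : Polynomial ℂ :=
  ∑ j ∈ Finset.range N, ∑ k ∈ Finset.range N,
    if k ≤ j then Polynomial.monomial (j - k) (ft f (((j : ℝ) - k) * h) / N) else 0

lemma coeff_fejerPolynomial (f : ℝ → ℂ) (h : ℝ) {N n : ℕ} (hn : n ≤ N) :
    (fejerPolynomial f h N).coeff n = ((N : ℂ) - n) / N * ft f (n * h) := by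
  have inner : ∀ j ∈ Finset.range N, (∑ k ∈ Finset.range N,
      if k ≤ j then Polynomial.monomial (j - k) (ft f (((j : ℝ) - k) * h) / N) else 0).coeff n
      = if n ≤ j then ft f (n * h) / N else 0 := by
    intro j hj
    have hj' : j < N := by simpa using hj
    rw [Polynomial.finsetSum_coeff]
    split_ifs with hnj
    · rw [Finset.sum_eq_single (j - n)]
      · have : (j : ℝ) - (j - n : ℕ) = n := by
          push_cast [Nat.cast_sub hnj]
          ring
        rw [if_pos (Nat.sub_le _ _), Polynomial.coeff_monomial, if_pos (by omega), this]
      · intro k _ hk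
        split_ifs with hkj
        · rw [Polynomial.coeff_monomial, if_neg (by omega)]
        · simp
      · intro hmem
        exact absurd (Finset.mem_range.2 (by omega)) hmem
    · refine Finset.sum_eq_zero fun k _ => ?_
      split_ifs with hkj
      · rw [Polynomial.coeff_monomial, if_neg (by omega)]
      · simp
  rw [fejerPolynomial, Polynomial.finsetSum_coeff, Finset.sum_congr rfl inner, ← Finset.sum_filter,
    Finset.sum_const]
  have : (Finset.range N).filter (fun j => n ≤ j) = Finset.Ico n N := by
    ext j
    simp [and_comm]
  rw [this, Nat.card_Ico, nsmul_eq_mul, Nat.cast_sub hn]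
  ring

lemma eval_fejerPolynomial {f : ℝ → ℂ} (hf : Integrable f) (hneg : ∀ ξ < 0, ft f ξ = 0)
    {h : ℝ} (hh : 0 < h) (N : ℕ) (θ : ℝ) :
    (fejerPolynomial f h N).eval (circleMap 0 1 θ)
      = ∫ t, f t * (fejerKernel N (θ - h * t) : ℂ) := by
  have e1 : (fejerPolynomial f h N).eval (circleMap 0 1 θ) =
      ∑ j ∈ Finset.range N, ∑ k ∈ Finset.range N,
        ft f (((j : ℝ) - k) * h) * (Complex.exp (Complex.I * ((j : ℂ) - k) * θ) / N) := by
    rw [fejerPolynomial, Polynomial.eval_finsetSum]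
    refine Finset.sum_congr rfl fun j _ => ?_
    rw [Polynomial.eval_finsetSum]
    refine Finset.sum_congr rfl fun k _ => ?_
    split_ifs with hkj
    · rw [Polynomial.eval_monomial, circleMap]
      simp only [ofReal_one, one_mul, zero_add]
      rw [← Complex.exp_nat_mul, Nat.cast_sub hkj]
      ring_nf
    · rw [hneg, Polynomial.eval_zero, zero_mul]
      have : (j : ℝ) < k := by exact_mod_cast not_le.1 hkj
      nlinarith
  have e2 : ∀ j k : ℕ, ft f (((j : ℝ) - k) * h) * (Complex.exp (Complex.I * ((j : ℂ) - k) * θ) / N)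
      = ∫ t, f t * Complex.exp (-(Complex.I) * ((((j : ℝ) - k) * h : ℝ) : ℂ) * (t : ℂ)) *
        (Complex.exp (Complex.I * ((j : ℂ) - k) * θ) / N) := by
    intro j k
    rw [ft, integral_mul_const]
  rw [e1]
  simp only [e2]
  have int : ∀ j k : ℕ, Integrable fun t : ℝ =>
      f t * Complex.exp (-(Complex.I) * ((((j : ℝ) - k) * h : ℝ) : ℂ) * (t : ℂ)) *
        (Complex.exp (Complex.I * ((j : ℂ) - k) * θ) / N) := fun j k =>
    (integrable_mul_exp hf _).mul_const _
  have e3 : ∀ j ∈ Finset.range N, (∑ k ∈ Finset.range N,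
      ∫ t, f t * Complex.exp (-(Complex.I) * ((((j : ℝ) - k) * h : ℝ) : ℂ) * (t : ℂ)) *
        (Complex.exp (Complex.I * ((j : ℂ) - k) * θ) / N))
      = ∫ t, ∑ k ∈ Finset.range N,
        f t * Complex.exp (-(Complex.I) * ((((j : ℝ) - k) * h : ℝ) : ℂ) * (t : ℂ)) *
        (Complex.exp (Complex.I * ((j : ℂ) - k) * θ) / N) := fun j _ =>
    (integral_finsetSum _ fun k _ => int j k).symm
  rw [Finset.sum_congr rfl e3,
    ← integral_finsetSum _ fun j _ => integrable_finsetSum _ fun k _ => int j k]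
  refine integral_congr_ae (Eventually.of_forall fun t => ?_)
  simp only [fejerKernel_eq, Finset.sum_div, Finset.mul_sum]
  refine Finset.sum_congr rfl fun j _ => Finset.sum_congr rfl fun k _ => ?_
  rw [mul_assoc, mul_div_assoc', ← Complex.exp_add]
  congr 3
  push_cast
  ring

lemma integral_norm_fejerPolynomial_le {f : ℝ → ℂ} (hf : Integrable f)
    (hneg : ∀ ξ < 0, ft f ξ = 0) {h : ℝ} (hh : 0 < h) {N : ℕ} (hN : N ≠ 0) :
    ∫ θ in (0 : ℝ)..2 * π, ‖(fejerPolynomial f h N).eval (circleMap 0 1 θ)‖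
      ≤ 2 * π * ∫ t, ‖f t‖ := by
  have hmeas : Continuous fun p : ℝ × ℝ => fejerKernel N (p.1 - h * p.2) :=
    (continuous_fejerKernel N).comp (by fun_prop)
  have hF_int : Integrable (Function.uncurry fun θ t : ℝ => ‖f t‖ * fejerKernel N (θ - h * t))
      ((volume.restrict (uIoc 0 (2 * π))).prod volume) := by
    have h1 : Integrable (fun p : ℝ × ℝ => (1 : ℝ) * ‖f p.2‖)
        ((volume.restrict (uIoc 0 (2 * π))).prod volume) :=
      Integrable.mul_prod (f := fun _ => (1 : ℝ)) (g := fun t => ‖f t‖)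
        (integrableOn_const (by rw [uIoc]; exact measure_Ioc_lt_top.ne)) hf.norm
    simp only [one_mul] at h1
    refine h1.mul_bdd (c := N) hmeas.aestronglyMeasurable (Eventually.of_forall fun p => ?_)
    rw [Real.norm_of_nonneg (fejerKernel_nonneg _ _)]
    exact fejerKernel_le _ _
  have hint2 : IntervalIntegrable (fun θ => ∫ t, ‖f t‖ * fejerKernel N (θ - h * t)) volume
      0 (2 * π) := by
    rw [intervalIntegrable_iff]
    exact hF_int.integral_prod_left
  calc ∫ θ in (0 : ℝ)..2 * π, ‖(fejerPolynomial f h N).eval (circleMap 0 1 θ)‖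
      ≤ ∫ θ in (0 : ℝ)..2 * π, ∫ t, ‖f t‖ * fejerKernel N (θ - h * t) := by
        refine intervalIntegral.integral_mono_on Real.two_pi_pos.le
          (Continuous.intervalIntegrable (by fun_prop) _ _) hint2 fun θ _ => ?_
        rw [eval_fejerPolynomial hf hneg hh]
        refine (norm_integral_le_integral_norm _).trans (le_of_eq ?_)
        refine integral_congr_ae (Eventually.of_forall fun t => ?_)
        simp only [norm_mul, Complex.norm_real, Real.norm_of_nonneg (fejerKernel_nonneg _ _)]
    _ = ∫ t, ∫ θ in (0 : ℝ)..2 * π, ‖f t‖ * fejerKernel N (θ - h * t) :=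
        intervalIntegral_integral_swap hF_int
    _ = 2 * π * ∫ t, ‖f t‖ := by
        rw [← integral_const_mul]
        refine integral_congr_ae (Eventually.of_forall fun t => ?_)
        simp only [intervalIntegral.integral_const_mul, integral_fejerKernel hN]
        ring

/-- Discrete Hardy inequality for the Fourier transform sampled on an arithmetic progression. -/
lemma sum_norm_ft_le {f : ℝ → ℂ} (hf : Integrable f) (hneg : ∀ ξ < 0, ft f ξ = 0)
    {h : ℝ} (hh : 0 < h) (M : ℕ) :
    ∑ n ∈ Finset.range M, ‖ft f (n * h)‖ / ((n : ℝ) + 1) ≤ 4 * ∫ t, ‖f t‖ := by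
  have bound : ∀ᶠ N : ℕ in atTop, ∑ n ∈ Finset.range M,
      ‖((N : ℂ) - n) / N * ft f (n * h)‖ / ((n : ℝ) + 1) ≤ 4 * ∫ t, ‖f t‖ := by
    filter_upwards [eventually_ge_atTop (M + 1)] with N hN
    have h1 := hardy_inequality_polynomial (fejerPolynomial f h N) M
    have h2 := integral_norm_fejerPolynomial_le hf hneg hh (N := N) (by omega)
    have e : ∑ n ∈ Finset.range M, ‖((N : ℂ) - n) / N * ft f (n * h)‖ / ((n : ℝ) + 1)
        = ∑ n ∈ Finset.range M, ‖(fejerPolynomial f h N).coeff n‖ / ((n : ℝ) + 1) := by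
      refine Finset.sum_congr rfl fun n hn => ?_
      have : n < M := by simpa using hn
      rw [coeff_fejerPolynomial f h (by omega)]
    rw [e]
    refine h1.trans ?_
    have : (2 * π)⁻¹ * ∫ θ in (0 : ℝ)..2 * π, ‖(fejerPolynomial f h N).eval (circleMap 0 1 θ)‖
        ≤ (2 * π)⁻¹ * (2 * π * ∫ t, ‖f t‖) := by
      gcongr
    rw [inv_mul_cancel_left₀ Real.two_pi_pos.ne'] at this
    linarith
  refine le_of_tendsto ?_ bound
  refine tendsto_finsetSum _ fun n _ => ?_
  have : Tendsto (fun N : ℕ => ((N : ℂ) - n) / N) atTop (nhds 1) := by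
    have h0 : Tendsto (fun N : ℕ => 1 - (n : ℂ) / N) atTop (nhds (1 - 0)) :=
      tendsto_const_nhds.sub (tendsto_const_div_atTop_nhds_zero_nat (n : ℂ))
    rw [sub_zero] at h0
    refine h0.congr' ?_
    filter_upwards [eventually_gt_atTop 0] with N hN
    have : (N : ℂ) ≠ 0 := by exact_mod_cast hN.ne'
    field_simp
  simpa using ((this.mul_const (ft f (n * h))).norm).div_const ((n : ℝ) + 1)

/-- Hardy's inequality on the line for integrable functions with spectrum in `[0, ∞)`. -/
lemma lintegral_norm_ft_div_le {f : ℝ → ℂ} (hf : Integrable f) (hneg : ∀ ξ < 0, ft f ξ = 0) :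
    ∫⁻ x in Ioi (0 : ℝ), ENNReal.ofReal (‖ft f x‖ / x) ≤ ENNReal.ofReal (8 * ∫ t, ‖f t‖) := by
  set F : ℝ → ENNReal := fun x => ENNReal.ofReal (‖ft f x‖ / x) with hF
  set r : ℕ → ℝ → ℝ := fun m x => (⌈x * ((m : ℝ) + 1)⌉₊ : ℝ) / ((m : ℝ) + 1) with hr
  have hft := continuous_ft hf
  have step : ∀ m : ℕ, ∫⁻ x in Ioi (0 : ℝ), F (r m x) ≤ ENNReal.ofReal (8 * ∫ t, ‖f t‖) := by
    intro m
    set h : ℝ := 1 / ((m : ℝ) + 1) with hh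
    have hm : (0 : ℝ) < (m : ℝ) + 1 := by positivity
    have hpos : 0 < h := by positivity
    have cover : Ioi (0 : ℝ) ⊆ ⋃ n : ℕ, Ioc (n * h) ((n + 1) * h) := by
      intro x hx
      have hx' : 0 < x * ((m : ℝ) + 1) := mul_pos hx hm
      have hc : 0 < ⌈x * ((m : ℝ) + 1)⌉₊ := Nat.ceil_pos.2 hx'
      obtain ⟨n, hn⟩ := Nat.exists_eq_add_of_lt hc
      rw [zero_add] at hn
      refine mem_iUnion.2 ⟨n, ?_⟩
      have := (Nat.ceil_eq_iff (by omega)).1 hn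
      simp only [Nat.add_sub_cancel] at this
      push_cast at this
      rw [mem_Ioc, hh, mul_one_div, mul_one_div, div_lt_iff₀ hm, le_div_iff₀ hm]
      exact this
    have piece : ∀ n : ℕ, ∫⁻ x in Ioc (n * h) ((n + 1) * h), F (r m x)
        = ENNReal.ofReal (‖ft f ((n + 1 : ℕ) * h)‖ / ((n : ℝ) + 1)) := by
      intro n
      have hcongr : ∀ x ∈ Ioc (n * h) ((n + 1) * h), F (r m x) = F ((n + 1 : ℕ) * h) := by
        intro x hx
        rw [mem_Ioc, hh, mul_one_div, mul_one_div, div_lt_iff₀ hm, le_div_iff₀ hm] at hx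
        have : ⌈x * ((m : ℝ) + 1)⌉₊ = n + 1 := by
          rw [Nat.ceil_eq_iff (by omega)]
          simpa using hx
        simp only [hr, this, hh, mul_one_div]
      rw [setLIntegral_congr_fun measurableSet_Ioc hcongr, setLIntegral_const, Real.volume_Ioc,
        hF, ← ENNReal.ofReal_mul (by positivity)]
      congr 1
      push_cast
      field_simp
      ring
    calc ∫⁻ x in Ioi (0 : ℝ), F (r m x)
        ≤ ∫⁻ x in ⋃ n : ℕ, Ioc (n * h) ((n + 1) * h), F (r m x) :=
          lintegral_mono_set cover
      _ ≤ ∑' n : ℕ, ∫⁻ x in Ioc (n * h) ((n + 1) * h), F (r m x) := lintegral_iUnion_le _ _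
      _ = ∑' n : ℕ, ENNReal.ofReal (‖ft f ((n + 1 : ℕ) * h)‖ / ((n : ℝ) + 1)) := by
          simp only [piece]
      _ ≤ ENNReal.ofReal (8 * ∫ t, ‖f t‖) := by
          refine ENNReal.tsum_le_of_sum_range_le fun M => ?_
          rw [← ENNReal.ofReal_sum_of_nonneg fun n _ => by positivity]
          refine ENNReal.ofReal_le_ofReal ?_
          have hs := sum_norm_ft_le hf hneg hpos (M + 1)
          rw [Finset.sum_range_succ'] at hs
          have h0 : 0 ≤ ‖ft f ((0 : ℕ) * h)‖ / (((0 : ℕ) : ℝ) + 1) := by positivity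
          have : ∑ n ∈ Finset.range M, ‖ft f ((n + 1 : ℕ) * h)‖ / ((n : ℝ) + 1)
              ≤ 2 * ∑ n ∈ Finset.range M, ‖ft f ((n + 1 : ℕ) * h)‖ / (((n + 1 : ℕ) : ℝ) + 1) := by
            rw [Finset.mul_sum]
            refine Finset.sum_le_sum fun n _ => ?_
            have ha := norm_nonneg (ft f ((n + 1 : ℕ) * h))
            set a := ‖ft f ((n + 1 : ℕ) * h)‖
            have hn : (0 : ℝ) ≤ n := by positivity
            rw [← mul_div_assoc, div_le_div_iff₀ (by positivity) (by positivity)]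
            push_cast
            nlinarith [mul_nonneg hn ha]
          linarith
  have lim : ∀ x ∈ Ioi (0 : ℝ), F x ≤ liminf (fun m => F (r m x)) atTop := by
    intro x hx
    have hx0 : (0 : ℝ) < x := hx
    have hr' : Tendsto (fun m : ℕ => r m x) atTop (nhds x) :=
      (tendsto_nat_ceil_mul_div_atTop hx0.le).comp
        (tendsto_atTop_add_const_right _ 1 tendsto_natCast_atTop_atTop)
    have hFc : ContinuousAt F x :=
      ENNReal.continuous_ofReal.continuousAt.comp
        (hft.norm.continuousAt.div continuousAt_id hx0.ne')
    exact (hFc.tendsto.comp hr').liminf_eq.ge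
  have hmeas : ∀ m : ℕ, Measurable fun x => F (r m x) := by
    intro m
    refine ENNReal.measurable_ofReal.comp ?_
    have : Measurable (r m) := by
      refine Measurable.div_const ?_ _
      exact measurable_from_top.comp (Nat.measurable_ceil.comp (by fun_prop))
    exact (hft.measurable.comp this).norm.div this
  calc ∫⁻ x in Ioi (0 : ℝ), F x
      ≤ ∫⁻ x in Ioi (0 : ℝ), liminf (fun m => F (r m x)) atTop :=
        setLIntegral_mono' measurableSet_Ioi lim
    _ ≤ liminf (fun m => ∫⁻ x in Ioi (0 : ℝ), F (r m x)) atTop := lintegral_liminf_le hmeas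
    _ ≤ _ := by
        refine liminf_le_of_le (by isBoundedDefault) fun b hb => ?_
        obtain ⟨m, hm⟩ := hb.exists
        exact hm.trans (step m)

/-- The Fourier transform of the triangle function `t ↦ max (h - |t|) 0`. -/
noncomputable def triangleWeight (h ξ : ℝ) : ℝ := 2 * (1 - Real.cos (h * ξ)) / ξ ^ 2

/-- The triangle function, written as half the second difference of `|·|`. -/
noncomputable def triangle (h s : ℝ) : ℝ := (|s + h| + |s - h| - 2 * |s|) / 2

/-- The second difference of `s ↦ s * log |s|`, a multiple of the Hilbert transform of
`triangle h`. -/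
noncomputable def conjTriangle (h s : ℝ) : ℝ :=
  (s + h) * Real.log (s + h) + (s - h) * Real.log (s - h) - 2 * (s * Real.log s)

lemma triangleWeight_nonneg (h ξ : ℝ) : 0 ≤ triangleWeight h ξ := by
  have := Real.cos_le_one (h * ξ)
  unfold triangleWeight
  have : 0 ≤ 1 - Real.cos (h * ξ) := by linarith
  positivity

lemma triangleWeight_neg (h ξ : ℝ) : triangleWeight h (-ξ) = triangleWeight h ξ := by
  simp [triangleWeight]

lemma measurable_triangleWeight (h : ℝ) : Measurable (triangleWeight h) := by
  unfold triangleWeight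
  fun_prop

lemma triangleWeight_le (h ξ : ℝ) : triangleWeight h ξ ≤ (h ^ 2 + 4) * (1 + ξ ^ 2)⁻¹ := by
  rcases eq_or_ne ξ 0 with rfl | hξ
  · simp [triangleWeight]
    positivity
  have hξ2 : 0 < ξ ^ 2 := by positivity
  have h1 := Real.one_sub_sq_div_two_le_cos (x := h * ξ)
  have h2 := Real.neg_one_le_cos (h * ξ)
  rw [triangleWeight, ← div_eq_mul_inv, div_le_div_iff₀ hξ2 (by positivity)]
  nlinarith

lemma integrable_triangleWeight (h : ℝ) : Integrable (triangleWeight h) := by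
  refine (integrable_inv_one_add_sq.const_mul (h ^ 2 + 4)).mono'
    (measurable_triangleWeight h).aestronglyMeasurable (.of_forall fun ξ => ?_)
  rw [Real.norm_of_nonneg (triangleWeight_nonneg h ξ)]
  exact triangleWeight_le h ξ

lemma integrableOn_mul_exp_neg_mul_Ioi {r : ℝ} (hr : 0 < r) :
    IntegrableOn (fun y : ℝ => y * Real.exp (-(r * y))) (Ioi 0) := by
  have := integrableOn_rpow_mul_exp_neg_mul_rpow (p := 1) (s := 1) (by norm_num) one_pos hr
  simpa using this

lemma integral_mul_exp_neg_mul_Ioi {r : ℝ} (hr : 0 < r) :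
    ∫ y in Ioi (0 : ℝ), y * Real.exp (-(r * y)) = 1 / r ^ 2 := by
  have := Real.integral_rpow_mul_exp_neg_mul_Ioi (a := 2) two_pos hr
  have h1 : ((2 : ℝ) - 1) = 1 := by norm_num
  simpa [h1, Real.Gamma_two] using this

/-- An antiderivative of `y ↦ y / (y - ia) - 1`. -/
noncomputable def logPrimitive (a y : ℝ) : ℂ := I * a * Complex.log (y - I * a)

lemma sub_I_mul_mem_slitPlane {a y : ℝ} (h : 0 < y ∨ a ≠ 0) : (y - I * a : ℂ) ∈ slitPlane := by
  rw [Complex.mem_slitPlane_iff]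
  simpa using h

lemma hasDerivAt_logPrimitive (a : ℝ) {y : ℝ} (hy : 0 < y) :
    HasDerivAt (logPrimitive a) (y / (y - I * a) - 1) y := by
  have hs := sub_I_mul_mem_slitPlane (a := a) (Or.inl hy)
  have h0 := Complex.slitPlane_ne_zero hs
  have h1 : HasDerivAt (fun y : ℝ => (y - I * a : ℂ)) 1 y :=
    (Complex.ofRealCLM.hasDerivAt (x := y)).sub_const (I * a)
  have h2 : (y / (y - I * a) - 1 : ℂ) = I * a * (1 / (y - I * a)) := by
    rw [sub_eq_iff_eq_add, mul_one_div, div_add_one h0]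
    ring_nf
  rw [h2]
  exact (h1.clog_real hs).const_mul (I * (a : ℂ))

lemma continuousWithinAt_logPrimitive (a : ℝ) :
    ContinuousWithinAt (logPrimitive a) (Ici 0) 0 := by
  rcases eq_or_ne a 0 with rfl | ha
  · have : logPrimitive 0 = fun _ => 0 := by
      ext y
      simp [logPrimitive]
    rw [this]
    exact continuousWithinAt_const
  · refine ContinuousAt.continuousWithinAt ?_
    unfold logPrimitive
    have : ContinuousAt (fun y : ℝ => (y - I * a : ℂ)) 0 := by fun_prop
    exact continuousAt_const.mul (this.clog (sub_I_mul_mem_slitPlane (Or.inr ha)))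

lemma logPrimitive_zero (a : ℝ) :
    logPrimitive a 0 = I * ((a * Real.log a : ℝ) : ℂ) + (π / 2 * |a| : ℝ) := by
  rcases lt_trichotomy a 0 with ha | rfl | ha
  · have h1 : ((0 : ℝ) : ℂ) - I * a = ((-a : ℝ) : ℂ) * I := by push_cast; ring
    rw [logPrimitive, h1, Complex.log_ofReal_mul (by linarith) I_ne_zero, Complex.log_I,
      Real.log_neg_eq_log, abs_of_neg ha]
    push_cast
    linear_combination (a * π / 2 : ℂ) * I_mul_I
  · simp [logPrimitive]
  · have h1 : ((0 : ℝ) : ℂ) - I * a = (a : ℂ) * (-I) := by push_cast; ring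
    rw [logPrimitive, h1, Complex.log_ofReal_mul ha (neg_ne_zero.2 I_ne_zero), Complex.log_neg_I,
      abs_of_pos ha]
    push_cast
    linear_combination (-(a * π / 2) : ℂ) * I_mul_I

lemma logPrimitive_eq (a : ℝ) {y : ℝ} (hy : 0 < y) :
    logPrimitive a y = I * a * Real.log y + I * a * Complex.log (1 - I * a * (y⁻¹ : ℝ)) := by
  have hy' : (y : ℂ) ≠ 0 := by exact_mod_cast hy.ne'
  have h1 : (y - I * a : ℂ) = y * (1 - I * a * (y⁻¹ : ℝ)) := by
    push_cast
    field_simp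
  have h2 : (1 - I * a * (y⁻¹ : ℝ) : ℂ) ≠ 0 := by
    intro h
    rw [h, mul_zero] at h1
    exact Complex.slitPlane_ne_zero (sub_I_mul_mem_slitPlane (a := a) (Or.inl hy)) h1
  rw [logPrimitive, h1, Complex.log_ofReal_mul hy h2]
  ring

lemma tendsto_log_one_sub (a : ℝ) :
    Tendsto (fun y : ℝ => I * a * Complex.log (1 - I * a * (y⁻¹ : ℝ))) atTop (nhds 0) := by
  have h0 : Tendsto (fun y : ℝ => ((y⁻¹ : ℝ) : ℂ)) atTop (nhds ((0 : ℝ) : ℂ)) :=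
    (Complex.continuous_ofReal.tendsto 0).comp tendsto_inv_atTop_zero
  have h1 : Tendsto (fun y : ℝ => (1 - I * a * (y⁻¹ : ℝ) : ℂ)) atTop (nhds 1) := by
    simpa using (h0.const_mul (I * (a : ℂ))).const_sub 1
  have h2 := (h1.clog one_mem_slitPlane).const_mul (I * (a : ℂ))
  simpa using h2

lemma tendsto_secondDiff_logPrimitive (h s : ℝ) :
    Tendsto (fun y => 2 * logPrimitive s y - logPrimitive (s + h) y - logPrimitive (s - h) y)
      atTop (nhds 0) := by
  have := (((tendsto_log_one_sub s).const_mul 2).sub (tendsto_log_one_sub (s + h))).sub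
    (tendsto_log_one_sub (s - h))
  simp only [mul_zero, sub_zero] at this
  refine this.congr' ?_
  filter_upwards [eventually_gt_atTop 0] with y hy
  simp only [logPrimitive_eq _ hy]
  push_cast
  ring

/-- The half-line Fourier integral of `triangleWeight h`. -/
lemma integral_exp_mul_triangleWeight (h s : ℝ) :
    ∫ ξ in Ioi (0 : ℝ), Complex.exp (I * s * ξ) * triangleWeight h ξ
      = I * conjTriangle h s + (π * triangle h s : ℝ) := by
  set F : ℝ → ℝ → ℂ := fun ξ y =>
    Complex.exp (I * s * ξ) * (2 * (1 - Real.cos (h * ξ)) : ℝ) * (y * Real.exp (-(ξ * y)) : ℝ)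
    with hF
  have hnorm : ∀ ξ : ℝ, ∀ y : ℝ, 0 < y →
      ‖F ξ y‖ = 2 * (1 - Real.cos (h * ξ)) * (y * Real.exp (-(ξ * y))) := by
    intro ξ y hy
    have h1 : ‖Complex.exp (I * s * ξ)‖ = 1 := by
      rw [show I * (s : ℂ) * ξ = ((s * ξ : ℝ) : ℂ) * I by push_cast; ring]
      exact Complex.norm_exp_ofReal_mul_I _
    have h2 : 0 ≤ 2 * (1 - Real.cos (h * ξ)) := by
      have := Real.cos_le_one (h * ξ)
      linarith
    simp only [hF, norm_mul, h1, one_mul, Complex.norm_real, norm_of_nonneg h2]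
    rw [← norm_mul, norm_of_nonneg (by positivity)]
  have hF_int : Integrable (Function.uncurry F)
      ((volume.restrict (Ioi (0 : ℝ))).prod (volume.restrict (Ioi (0 : ℝ)))) := by
    have hm : AEStronglyMeasurable (Function.uncurry F)
        ((volume.restrict (Ioi (0 : ℝ))).prod (volume.restrict (Ioi (0 : ℝ)))) := by
      refine Continuous.aestronglyMeasurable ?_
      simp only [hF, Function.uncurry_def]
      fun_prop
    rw [integrable_prod_iff hm]
    constructor
    · filter_upwards [ae_restrict_mem measurableSet_Ioi] with ξ hξ
      exact ((integrableOn_mul_exp_neg_mul_Ioi hξ).ofReal (𝕜 := ℂ)).const_mul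
        (Complex.exp (I * s * ξ) * (2 * (1 - Real.cos (h * ξ)) : ℝ))
    · refine (integrable_triangleWeight h).integrableOn.congr ?_
      filter_upwards [ae_restrict_mem measurableSet_Ioi] with ξ hξ
      simp only [Function.uncurry_apply_pair]
      rw [setIntegral_congr_fun measurableSet_Ioi (fun y hy => hnorm ξ y hy),
        integral_const_mul, integral_mul_exp_neg_mul_Ioi hξ, triangleWeight]
      ring
  have inner : ∀ y ∈ Ioi (0 : ℝ), ∫ ξ in Ioi (0 : ℝ), F ξ y
      = 2 * (y / (y - I * s) - 1) - (y / (y - I * (s + h : ℝ)) - 1)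
        - (y / (y - I * (s - h : ℝ)) - 1) := by
    intro y hy
    have hre : ∀ a : ℝ, (I * a - y : ℂ).re < 0 := fun a => by simpa using hy
    have hi := fun a : ℝ => integrableOn_exp_mul_complex_Ioi (hre a) 0
    have hv := fun a : ℝ => integral_exp_mul_complex_Ioi (hre a) 0
    have hsplit : ∀ ξ : ℝ, F ξ y = y * (2 * Complex.exp ((I * s - y) * ξ)
        - Complex.exp ((I * (s + h : ℝ) - y) * ξ) - Complex.exp ((I * (s - h : ℝ) - y) * ξ)) := by
      intro ξ
      have e1 : ∀ a : ℝ, Complex.exp ((I * a - y) * ξ)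
          = Complex.exp (I * a * ξ) * Complex.exp (-(ξ * y)) := by
        intro a
        rw [← Complex.exp_add]
        ring_nf
      have e2 : Complex.exp (I * (s + h : ℝ) * ξ)
          = Complex.exp (I * s * ξ) * Complex.exp (h * ξ * I) := by
        rw [← Complex.exp_add]
        push_cast
        ring_nf
      have e3 : Complex.exp (I * (s - h : ℝ) * ξ)
          = Complex.exp (I * s * ξ) * Complex.exp (-(h * ξ) * I) := by
        rw [← Complex.exp_add]
        push_cast
        ring_nf
      rw [e1, e1, e1, e2, e3]
      simp only [hF]
      push_cast
      rw [Complex.cos]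
      ring
    have h2 : ∀ a : ℝ, -Complex.exp ((I * a - y) * (0 : ℝ)) / (I * a - y) = 1 / (y - I * a) := by
      intro a
      simp only [ofReal_zero, mul_zero, Complex.exp_zero]
      rw [← neg_sub (y : ℂ) (I * a), neg_div_neg_eq]
    simp only [hsplit]
    have i2 : IntegrableOn (fun ξ : ℝ => 2 * Complex.exp ((I * s - y) * ξ)) (Ioi 0) :=
      (hi s).const_mul 2
    have i3 : IntegrableOn (fun ξ : ℝ => 2 * Complex.exp ((I * s - y) * ξ)
        - Complex.exp ((I * (s + h : ℝ) - y) * ξ)) (Ioi 0) := i2.sub (hi (s + h))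
    rw [integral_const_mul, integral_sub i3 (hi (s - h)),
      integral_sub i2 (hi (s + h)), integral_const_mul, hv, hv, hv, h2, h2, h2]
    ring
  have hout : IntegrableOn (fun y : ℝ => 2 * (y / (y - I * s) - 1)
      - (y / (y - I * (s + h : ℝ)) - 1) - (y / (y - I * (s - h : ℝ)) - 1) : ℝ → ℂ) (Ioi 0) :=
    IntegrableOn.congr_fun (f := fun y => ∫ ξ in Ioi (0 : ℝ), F ξ y) hF_int.integral_prod_right
      inner measurableSet_Ioi
  have outer := integral_Ioi_of_hasDerivAt_of_tendsto
    (f := fun y => 2 * logPrimitive s y - logPrimitive (s + h) y - logPrimitive (s - h) y)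
    (((continuousWithinAt_const.mul (continuousWithinAt_logPrimitive s)).sub
      (continuousWithinAt_logPrimitive _)).sub (continuousWithinAt_logPrimitive _))
    (fun y hy => (((hasDerivAt_logPrimitive s hy).const_mul 2).sub
      (hasDerivAt_logPrimitive (s + h) hy)).sub (hasDerivAt_logPrimitive (s - h) hy))
    hout (tendsto_secondDiff_logPrimitive h s)
  calc ∫ ξ in Ioi (0 : ℝ), Complex.exp (I * s * ξ) * triangleWeight h ξ
      = ∫ ξ in Ioi (0 : ℝ), ∫ y in Ioi (0 : ℝ), F ξ y := by
        refine setIntegral_congr_fun measurableSet_Ioi fun ξ hξ => ?_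
        simp only [hF]
        rw [integral_const_mul, integral_complex_ofReal, integral_mul_exp_neg_mul_Ioi hξ,
          triangleWeight]
        push_cast
        ring
    _ = ∫ y in Ioi (0 : ℝ), ∫ ξ in Ioi (0 : ℝ), F ξ y := integral_integral_swap hF_int
    _ = _ := setIntegral_congr_fun measurableSet_Ioi inner
    _ = _ := outer
    _ = _ := by
        simp only [logPrimitive_zero, conjTriangle, triangle]
        push_cast
        ring

lemma triangle_eq_max {h : ℝ} (hh : 0 < h) (s : ℝ) : triangle h s = max (h - |s|) 0 := by
  unfold triangle
  rcases le_total 0 s with hs | hs <;> rcases le_total 0 (s + h) with h1 | h1 <;>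
    rcases le_total 0 (s - h) with h2 | h2 <;>
    simp only [abs_of_nonneg, abs_of_nonpos, hs, h1, h2]
  all_goals first
    | (rw [max_eq_left (by linarith)]; linarith)
    | (rw [max_eq_right (by linarith)]; linarith)

lemma continuous_triangle (h : ℝ) : Continuous (triangle h) := by
  unfold triangle
  fun_prop

lemma triangle_nonneg {h : ℝ} (hh : 0 < h) (s : ℝ) : 0 ≤ triangle h s := by
  rw [triangle_eq_max hh]
  exact le_max_right _ _

lemma triangle_le {h : ℝ} (hh : 0 < h) (s : ℝ) : triangle h s ≤ h := by
  rw [triangle_eq_max hh]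
  exact max_le (by linarith [abs_nonneg s]) hh.le

lemma triangle_eq_zero {h s : ℝ} (hh : 0 < h) (hs : h ≤ |s|) : triangle h s = 0 := by
  rw [triangle_eq_max hh, max_eq_right (by linarith)]

lemma integral_triangle {h : ℝ} (hh : 0 < h) (x : ℝ) : ∫ t, triangle h (t - x) = h ^ 2 := by
  rw [integral_sub_right_eq_self (triangle h)]
  simp only [triangle_eq_max hh]
  rw [integral_comp_abs (f := fun s => max (h - s) 0)]
  have h1 : ∫ s in Ioi (0 : ℝ), max (h - s) 0 = ∫ s in Ioc 0 h, max (h - s) 0 := by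
    refine setIntegral_eq_of_subset_of_forall_sdiff_eq_zero measurableSet_Ioi
      Ioc_subset_Ioi_self fun s hs => ?_
    have hs' : h < s := by
      by_contra hc
      exact hs.2 ⟨hs.1, not_lt.1 hc⟩
    exact max_eq_right (by linarith)
  have h2 : ∫ s in Ioc 0 h, max (h - s) 0 = ∫ s in Ioc 0 h, (h - s) :=
    setIntegral_congr_fun measurableSet_Ioc fun s hs => max_eq_left (by linarith [hs.2])
  rw [h1, h2, ← intervalIntegral.integral_of_le hh.le, intervalIntegral.integral_sub (by simp)
    (by simp)]
  simp
  ring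

lemma integrable_mul_triangle {f : ℝ → ℝ} (hf : Integrable f) {h : ℝ} (hh : 0 < h) (x : ℝ) :
    Integrable fun t => f t * triangle h (t - x) := by
  refine hf.mul_bdd (c := h)
    ((continuous_triangle h).comp (continuous_sub_right x)).aestronglyMeasurable
    (.of_forall fun t => ?_)
  rw [Real.norm_of_nonneg (triangle_nonneg hh _)]
  exact triangle_le hh _

/-- A continuous function whose symmetric second differences at each point are eventually negative
is midpoint concave. -/
lemma secondDiff_nonpos {D : ℝ → ℝ} (hD : Continuous D)
    (hneg : ∀ x, ∀ᶠ h in nhdsWithin 0 (Ioi 0), D (x + h) + D (x - h) - 2 * D x < 0)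
    (x : ℝ) {h : ℝ} (hh : 0 < h) : D (x + h) + D (x - h) - 2 * D x ≤ 0 := by
  by_contra! hpos
  set c : ℝ := (D (x + h) - D (x - h)) / (2 * h) with hc
  have hch : c * (2 * h) = D (x + h) - D (x - h) := by
    rw [hc]
    field_simp
  set E : ℝ → ℝ := fun y => D y - c * y with hE
  have hEc : Continuous E := by fun_prop
  obtain ⟨y, hy, hmin⟩ := isCompact_Icc.exists_isMinOn (s := Icc (x - h) (x + h))
    ⟨x, by constructor <;> linarith⟩ hEc.continuousOn
  have hyx : E y ≤ E x := hmin (by constructor <;> linarith)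
  have hl : y ≠ x - h := by
    rintro rfl
    simp only [hE] at hyx
    linarith
  have hr : y ≠ x + h := by
    rintro rfl
    simp only [hE] at hyx
    linarith
  have hl' : x - h < y := lt_of_le_of_ne hy.1 hl.symm
  have hr' : y < x + h := lt_of_le_of_ne hy.2 hr
  have hsmall : ∀ᶠ d in nhdsWithin (0 : ℝ) (Ioi 0), d < min (y - (x - h)) (x + h - y) :=
    nhdsWithin_le_nhds (Iio_mem_nhds (lt_min (by linarith) (by linarith)))
  obtain ⟨d, hd1, hd2, hd3⟩ := ((hneg y).and (hsmall.and self_mem_nhdsWithin)).exists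
  have hd0 : 0 < d := hd3
  rw [lt_min_iff] at hd2
  have e1 : E y ≤ E (y + d) := hmin (by constructor <;> linarith)
  have e2 : E y ≤ E (y - d) := hmin (by constructor <;> linarith)
  simp only [hE] at e1 e2
  linarith

lemma continuous_integral_mul_abs_sub {v : ℝ → ℝ} (hv : Integrable v) :
    Continuous fun x => ∫ t, v t * ((|t - x| - |t|) / 2) := by
  rw [continuous_iff_continuousAt]
  intro x
  refine continuousAt_of_dominated (bound := fun t => ‖v t‖ * (|x| + 1)) ?_ ?_
    (hv.norm.mul_const _) (.of_forall fun t => by fun_prop)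
  · exact .of_forall fun y => hv.aestronglyMeasurable.mul
      (by fun_prop : Continuous fun t : ℝ => (|t - y| - |t|) / 2).aestronglyMeasurable
  · have : ∀ᶠ y in nhds x, |y| < |x| + 1 :=
      continuous_abs.continuousAt.eventually (Iio_mem_nhds (by linarith))
    filter_upwards [this] with y hy
    refine .of_forall fun t => ?_
    rw [norm_mul]
    refine mul_le_mul_of_nonneg_left ?_ (norm_nonneg _)
    have h1 : |(|t - y| - |t|)| ≤ |y| := by simpa using abs_abs_sub_abs_le_abs_sub (t - y) t
    rw [Real.norm_eq_abs, abs_div, abs_two]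
    linarith [abs_nonneg y, abs_nonneg x]

lemma integrable_mul_abs_sub {v : ℝ → ℝ} (hv : Integrable v) (x : ℝ) :
    Integrable fun t => v t * ((|t - x| - |t|) / 2) := by
  refine hv.mul_bdd (c := |x|)
    (by fun_prop : Continuous fun t : ℝ => (|t - x| - |t|) / 2).aestronglyMeasurable
    (.of_forall fun t => ?_)
  have h1 : |(|t - x| - |t|)| ≤ |x| := by simpa using abs_abs_sub_abs_le_abs_sub (t - x) t
  rw [Real.norm_eq_abs, abs_div, abs_two]
  linarith [abs_nonneg x]

lemma secondDiff_integral_mul_abs_sub {v : ℝ → ℝ} (hv : Integrable v) (x h : ℝ) :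
    (∫ t, v t * ((|t - (x + h)| - |t|) / 2)) + (∫ t, v t * ((|t - (x - h)| - |t|) / 2))
      - 2 * (∫ t, v t * ((|t - x| - |t|) / 2)) = ∫ t, v t * triangle h (t - x) := by
  have hi : Integrable fun t => v t * ((|t - (x + h)| - |t|) / 2)
      + v t * ((|t - (x - h)| - |t|) / 2) :=
    (integrable_mul_abs_sub hv _).add (integrable_mul_abs_sub hv _)
  rw [← integral_add (integrable_mul_abs_sub hv _) (integrable_mul_abs_sub hv _),
    ← integral_const_mul, ← integral_sub hi ((integrable_mul_abs_sub hv _).const_mul 2)]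
  refine integral_congr_ae (.of_forall fun t => ?_)
  simp only [triangle]
  rw [show t - (x + h) = t - x - h by ring, show t - (x - h) = t - x + h by ring]
  ring

lemma secondDiff_le_integral_of_tendsto {K f : ℝ → ℝ} (hK : Continuous K) (hf : Integrable f)
    (hlim : ∀ x, Tendsto (fun h => (K (x + h) + K (x - h) - 2 * K x) / h ^ 2)
      (nhdsWithin 0 (Ioi 0)) (nhds (f x)))
    (x : ℝ) {h : ℝ} (hh : 0 < h) :
    K (x + h) + K (x - h) - 2 * K x ≤ ∫ t, f t * triangle h (t - x) := by
  refine le_of_forall_pos_le_add fun ε hε => ?_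
  obtain ⟨u, hfu, hlsc, hui, hutop, hulim⟩ :=
    exists_lt_lowerSemicontinuous_integral_lt f hf (div_pos hε hh)
  set v : ℝ → ℝ := fun t => (u t).toReal with hv
  have hfv : ∀ᵐ t, f t ≤ v t := by
    filter_upwards [hutop] with t ht
    have h1 : ((v t : ℝ) : EReal) = u t :=
      EReal.coe_toReal ht.ne (ne_bot_of_gt (hfu t))
    exact_mod_cast (h1 ▸ hfu t).le
  set V : ℝ → ℝ := fun x => ∫ t, v t * ((|t - x| - |t|) / 2) with hV
  have hVd : ∀ x h, V (x + h) + V (x - h) - 2 * V x = ∫ t, v t * triangle h (t - x) :=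
    fun x h => secondDiff_integral_mul_abs_sub hui x h
  have key := secondDiff_nonpos (D := fun y => K y - V y)
    (hK.sub (continuous_integral_mul_abs_sub hui)) (fun y => ?_) x hh
  · have h1 : ∫ t, (v t - f t) * triangle h (t - x) ≤ h * ∫ t, (v t - f t) := by
      rw [← integral_const_mul]
      refine integral_mono_ae (integrable_mul_triangle (hui.sub hf) hh x)
        ((hui.sub hf).const_mul h) ?_
      filter_upwards [hfv] with t ht
      have := mul_le_mul_of_nonneg_left (triangle_le hh (t - x)) (sub_nonneg.2 ht)
      linarith
    have h2 : ∫ t, (v t - f t) * triangle h (t - x)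
        = (∫ t, v t * triangle h (t - x)) - ∫ t, f t * triangle h (t - x) := by
      rw [← integral_sub (integrable_mul_triangle hui hh x) (integrable_mul_triangle hf hh x)]
      simp only [sub_mul]
    rw [integral_sub hui hf] at h1
    have h3 : h * ((∫ t, v t) - ∫ t, f t) ≤ ε := by
      rw [← le_div_iff₀' hh]
      linarith
    have := hVd x h
    linarith
  · obtain ⟨c, hfc, hcu⟩ := EReal.lt_iff_exists_real_btwn.1 (hfu y)
    have hfc' : f y < c := by exact_mod_cast hfc
    obtain ⟨r, hr, hball⟩ := Metric.eventually_nhds_iff.1 (hlsc y _ hcu)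
    have hsmall : ∀ᶠ d in nhdsWithin (0 : ℝ) (Ioi 0), d < r :=
      nhdsWithin_le_nhds (Iio_mem_nhds hr)
    filter_upwards [(hlim y).eventually_lt_const hfc', hsmall, self_mem_nhdsWithin]
      with d hd1 hd2 hd3
    have hd0 : 0 < d := hd3
    rw [div_lt_iff₀ (by positivity)] at hd1
    have h1 : c * d ^ 2 ≤ ∫ t, v t * triangle d (t - y) := by
      rw [← integral_triangle hd0 y, ← integral_const_mul]
      have hti : Integrable fun t => c * triangle d (t - y) := by
        refine (Integrable.comp_sub_right (f := triangle d) ?_ y).const_mul c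
        refine (continuous_triangle d).integrable_of_hasCompactSupport
          (HasCompactSupport.intro (isCompact_closedBall (0 : ℝ) d) fun s hs => ?_)
        exact triangle_eq_zero hd0 (by simpa using (not_le.1 (by simpa using hs)).le)
      refine integral_mono_ae hti (integrable_mul_triangle hui hd0 y) ?_
      filter_upwards [hutop] with t ht
      by_cases htd : |t - y| < d
      · have h2 : ((v t : ℝ) : EReal) = u t :=
          EReal.coe_toReal ht.ne (ne_bot_of_gt (hfu t))
        have h3 : (c : EReal) < u t := hball (by rw [Real.dist_eq]; linarith)
        have h4 : c ≤ v t := by exact_mod_cast (h2 ▸ h3).le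
        exact mul_le_mul_of_nonneg_right h4 (triangle_nonneg hd0 _)
      · simp [triangle_eq_zero hd0 (not_lt.1 htd)]
    have := hVd y d
    linarith

/-- **De la Vallée-Poussin**: a continuous function whose second symmetric derivative exists
everywhere and is integrable is a second primitive of it. -/
lemma secondDiff_eq_integral_of_tendsto {K f : ℝ → ℝ} (hK : Continuous K) (hf : Integrable f)
    (hlim : ∀ x, Tendsto (fun h => (K (x + h) + K (x - h) - 2 * K x) / h ^ 2)
      (nhdsWithin 0 (Ioi 0)) (nhds (f x)))
    (x : ℝ) {h : ℝ} (hh : 0 < h) :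
    K (x + h) + K (x - h) - 2 * K x = ∫ t, f t * triangle h (t - x) := by
  refine le_antisymm (secondDiff_le_integral_of_tendsto hK hf hlim x hh) ?_
  have := secondDiff_le_integral_of_tendsto hK.neg hf.neg (fun y => (hlim y).neg.congr fun d => by
    simp only [Pi.neg_apply]
    ring) x hh
  simp only [Pi.neg_apply, neg_mul, integral_neg] at this
  linarith

/-- The derivative of `s ↦ s * conjTriangle 1 s`. -/
noncomputable def conjTriangleDensity (s : ℝ) : ℝ :=
  (2 * s + 1) * Real.log (s + 1) + (2 * s - 1) * Real.log (s - 1) - 4 * (s * Real.log s)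

lemma continuous_conjTriangle (h : ℝ) : Continuous (conjTriangle h) := by
  have := Real.continuous_mul_log
  unfold conjTriangle
  exact ((this.comp (continuous_add_const h)).add (this.comp (continuous_sub_right h))).sub
    (this.const_mul 2)

lemma mul_mul_log_mul {h : ℝ} (hh : 0 < h) (a : ℝ) :
    (h * a) * Real.log (h * a) = h * a * Real.log h + h * (a * Real.log a) := by
  rcases eq_or_ne a 0 with rfl | ha
  · simp
  · rw [Real.log_mul hh.ne' ha]
    ring

lemma conjTriangle_mul {h : ℝ} (hh : 0 < h) (s : ℝ) :
    conjTriangle h (h * s) = h * conjTriangle 1 s := by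
  unfold conjTriangle
  rw [show h * s + h = h * (s + 1) by ring, show h * s - h = h * (s - 1) by ring,
    mul_mul_log_mul hh, mul_mul_log_mul hh, mul_mul_log_mul hh]
  ring

lemma conjTriangle_neg (h s : ℝ) : conjTriangle h (-s) = -conjTriangle h s := by
  unfold conjTriangle
  rw [show -s + h = -(s - h) by ring, show -s - h = -(s + h) by ring]
  simp only [Real.log_neg_eq_log]
  ring

lemma abs_mul_conjTriangle_abs (s : ℝ) : |s| * conjTriangle 1 |s| = s * conjTriangle 1 s := by
  rcases abs_cases s with ⟨h, -⟩ | ⟨h, -⟩ <;> rw [h]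
  rw [conjTriangle_neg]
  ring

lemma hasDerivAt_mul_conjTriangle {s : ℝ} (h0 : 0 < s) (h1 : s ≠ 1) :
    HasDerivAt (fun s => s * conjTriangle 1 s) (conjTriangleDensity s) s := by
  have hl : ∀ c : ℝ, s + c ≠ 0 → HasDerivAt (fun s => (s + c) * Real.log (s + c))
      (Real.log (s + c) + 1) s := by
    intro c hc
    exact (Real.hasDerivAt_mul_log hc).comp_add_const s c
  have e1 := hl 1 (by positivity)
  have e2 := hl (-1) (by rwa [← sub_eq_add_neg, sub_ne_zero])
  have e3 := Real.hasDerivAt_mul_log h0.ne'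
  simp only [← sub_eq_add_neg] at e2
  have := (hasDerivAt_id s).mul ((e1.add e2).sub (e3.const_mul 2))
  refine this.congr_deriv ?_
  simp only [conjTriangleDensity, id, Pi.add_apply, Pi.sub_apply]
  ring

lemma intervalIntegrable_conjTriangleDensity (a b : ℝ) :
    IntervalIntegrable conjTriangleDensity volume a b := by
  have hlog : ∀ c, IntervalIntegrable (fun s => Real.log (s + c)) volume a b := by
    intro c
    have := (intervalIntegral.intervalIntegrable_log' (a := a + c) (b := b + c)).comp_add_right c
    simpa using this
  have h1 := (hlog 1).continuousOn_mul (g := fun s => 2 * s + 1) (by fun_prop)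
  have h2 := (hlog (-1)).continuousOn_mul (g := fun s => 2 * s - 1) (by fun_prop)
  simp only [← sub_eq_add_neg] at h2
  exact (h1.add h2).sub ((Real.continuous_mul_log.intervalIntegrable a b).const_mul 4)

lemma integral_conjTriangleDensity {s : ℝ} (hs : 0 ≤ s) :
    ∫ r in (0 : ℝ)..s, conjTriangleDensity r = s * conjTriangle 1 s := by
  have := integral_eq_of_hasDerivAt_off_countable_of_le (fun s => s * conjTriangle 1 s)
    conjTriangleDensity hs (countable_singleton (1 : ℝ))
    (continuous_id.mul (continuous_conjTriangle 1)).continuousOn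
    (fun x hx => hasDerivAt_mul_conjTriangle hx.1.1 hx.2)
    (intervalIntegrable_conjTriangleDensity 0 s)
  simpa using this

/-- Second-order Taylor estimates for `log (1 + 1 / s)` and `log (1 - 1 / s)`. -/
lemma abs_log_taylor {s : ℝ} (hs : 2 ≤ s) :
    |Real.log (s + 1) - Real.log s - s⁻¹ + s⁻¹ ^ 2 / 2| ≤ 2 * s⁻¹ ^ 3 ∧
      |Real.log (s - 1) - Real.log s + s⁻¹ + s⁻¹ ^ 2 / 2| ≤ 2 * s⁻¹ ^ 3 := by
  have hs0 : 0 < s := by linarith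
  have hx0 : 0 < s⁻¹ := by positivity
  have hx : s⁻¹ ≤ 1 / 2 := by
    rw [inv_eq_one_div]
    exact one_div_le_one_div_of_le two_pos hs
  have e1 : Real.log (s + 1) = Real.log s + Real.log (1 - -s⁻¹) := by
    rw [← Real.log_mul hs0.ne' (by linarith)]
    congr 1
    field_simp
    ring
  have e2 : Real.log (s - 1) = Real.log s + Real.log (1 - s⁻¹) := by
    rw [← Real.log_mul hs0.ne' (by linarith)]
    congr 1
    field_simp
  have hb : s⁻¹ ^ 3 / (1 - s⁻¹) ≤ 2 * s⁻¹ ^ 3 := by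
    rw [div_le_iff₀ (by linarith)]
    nlinarith [pow_pos hx0 3]
  have t1 := Real.abs_log_sub_add_sum_range_le (x := -s⁻¹)
    (by rw [abs_neg, abs_of_pos hx0]; linarith) 2
  have t2 := Real.abs_log_sub_add_sum_range_le (x := s⁻¹) (by rw [abs_of_pos hx0]; linarith) 2
  simp only [Finset.sum_range_succ, Finset.sum_range_zero, abs_neg, abs_of_pos hx0] at t1 t2
  norm_num at t1 t2
  rw [e1, e2]
  norm_num at hb ⊢
  constructor
  · refine le_trans (le_of_eq ?_) (t1.trans hb)
    congr 1
    ring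
  · refine le_trans (le_of_eq ?_) (t2.trans hb)
    congr 1
    ring

lemma abs_conjTriangleDensity_le {s : ℝ} (hs : 2 ≤ s) :
    |conjTriangleDensity s| ≤ 12 * s⁻¹ ^ 2 := by
  obtain ⟨t1, t2⟩ := abs_log_taylor hs
  have hs0 : 0 < s := by linarith
  have hx0 : 0 < s⁻¹ := by positivity
  have hsx : s * s⁻¹ = 1 := mul_inv_cancel₀ hs0.ne'
  set x := s⁻¹ with hx
  set A := Real.log (s + 1) - Real.log s - x + x ^ 2 / 2
  set B := Real.log (s - 1) - Real.log s + x + x ^ 2 / 2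
  have e : conjTriangleDensity s = (2 * s + 1) * A + (2 * s - 1) * B := by
    simp only [conjTriangleDensity, A, B]
    linear_combination (-2 * x) * hsx
  have hx3 : s * x ^ 3 = x ^ 2 := by linear_combination x ^ 2 * hsx
  have h1 : |(2 * s + 1) * A| ≤ (2 * s + 1) * (2 * x ^ 3) := by
    rw [abs_mul, abs_of_pos (by linarith)]
    exact mul_le_mul_of_nonneg_left t1 (by linarith)
  have h2 : |(2 * s - 1) * B| ≤ (2 * s - 1) * (2 * x ^ 3) := by
    rw [abs_mul, abs_of_pos (by linarith)]
    exact mul_le_mul_of_nonneg_left t2 (by linarith)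
  rw [e]
  refine (abs_add_le _ _).trans ?_
  nlinarith [pow_pos hx0 2]

lemma tendsto_mul_conjTriangle : Tendsto (fun s => s * conjTriangle 1 s) atTop (nhds 1) := by
  have h0 : Tendsto (fun s : ℝ => 4 * s⁻¹ + 4 * s⁻¹) atTop (nhds 0) := by
    simpa using (tendsto_inv_atTop_zero.const_mul (4 : ℝ)).add
      (tendsto_inv_atTop_zero.const_mul (4 : ℝ))
  rw [tendsto_iff_norm_sub_tendsto_zero]
  refine squeeze_zero' (.of_forall fun _ => norm_nonneg _) ?_ h0
  filter_upwards [eventually_ge_atTop 2] with s hs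
  obtain ⟨t1, t2⟩ := abs_log_taylor hs
  have hs0 : 0 < s := by linarith
  have hx0 : 0 < s⁻¹ := by positivity
  have hsx : s * s⁻¹ = 1 := mul_inv_cancel₀ hs0.ne'
  set x := s⁻¹ with hx
  set A := Real.log (s + 1) - Real.log s - x + x ^ 2 / 2
  set B := Real.log (s - 1) - Real.log s + x + x ^ 2 / 2
  have e : s * conjTriangle 1 s - 1 = s * (s + 1) * A + s * (s - 1) * B := by
    simp only [conjTriangle, A, B]
    linear_combination (1 - s * x) * hsx
  have hx3 : s ^ 2 * x ^ 3 = x := by linear_combination (x + s * x ^ 2) * hsx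
  have h1 : |s * (s + 1) * A| ≤ s * (s + 1) * (2 * x ^ 3) := by
    rw [abs_mul, abs_of_pos (by positivity)]
    exact mul_le_mul_of_nonneg_left t1 (by positivity)
  have h2 : |s * (s - 1) * B| ≤ s * (s - 1) * (2 * x ^ 3) := by
    have : 0 < s * (s - 1) := mul_pos hs0 (by linarith)
    rw [abs_mul, abs_of_pos this]
    exact mul_le_mul_of_nonneg_left t2 this.le
  rw [e, Real.norm_eq_abs]
  refine (abs_add_le _ _).trans ?_
  nlinarith

lemma integrableOn_conjTriangleDensity : IntegrableOn conjTriangleDensity (Ioi 0) := by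
  rw [← Ioc_union_Ioi_eq_Ioi (zero_le_two (α := ℝ))]
  refine IntegrableOn.union ?_ ?_
  · exact (intervalIntegrable_iff_integrableOn_Ioc_of_le zero_le_two).1
      (intervalIntegrable_conjTriangleDensity 0 2)
  · have := (integrableOn_Ioi_rpow_of_lt (a := -2) (by norm_num) (c := 2) two_pos).const_mul 12
    refine Integrable.mono' this ?_ ?_
    · have : Measurable conjTriangleDensity := by
        unfold conjTriangleDensity
        fun_prop
      exact this.aestronglyMeasurable
    · filter_upwards [ae_restrict_mem measurableSet_Ioi] with s hs
      have hs' : 2 < s := hs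
      refine (abs_conjTriangleDensity_le hs'.le).trans (le_of_eq ?_)
      rw [Real.rpow_neg (by linarith), inv_pow]
      norm_num

lemma integral_Ioi_conjTriangleDensity : ∫ r in Ioi (0 : ℝ), conjTriangleDensity r = 1 := by
  refine tendsto_nhds_unique
    (intervalIntegral_tendsto_integral_Ioi 0 integrableOn_conjTriangleDensity tendsto_id)
    (tendsto_mul_conjTriangle.congr' ?_)
  filter_upwards [eventually_ge_atTop 0] with s hs
  exact (integral_conjTriangleDensity hs).symm

lemma exists_integral_abs_conjTriangleDensity_le :
    ∃ C, 0 ≤ C ∧ ∀ s, 0 ≤ s → ∫ r in Ioo 0 s, |conjTriangleDensity r| ≤ C * s := by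
  have hc : ContinuousOn conjTriangleDensity (Icc 0 (1 / 2)) := by
    refine ContinuousOn.sub (ContinuousOn.add ?_ ?_)
      (Real.continuous_mul_log.continuousOn.const_mul 4)
    · refine ContinuousOn.mul (by fun_prop) (ContinuousOn.log (by fun_prop) fun s hs => ?_)
      linarith [hs.1]
    · refine ContinuousOn.mul (by fun_prop) (ContinuousOn.log (by fun_prop) fun s hs => ?_)
      linarith [hs.2]
  obtain ⟨M, hM⟩ := isCompact_Icc.exists_bound_of_continuousOn hc
  have hM0 : 0 ≤ M := (norm_nonneg _).trans (hM 0 (by norm_num))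
  set N : ℝ := ∫ r in Ioi (0 : ℝ), |conjTriangleDensity r|
  have hN0 : 0 ≤ N := integral_nonneg fun _ => abs_nonneg _
  refine ⟨M + 2 * N, by positivity, fun s hs => ?_⟩
  have hi : IntegrableOn (fun r => |conjTriangleDensity r|) (Ioi 0) :=
    integrableOn_conjTriangleDensity.abs
  rcases le_total s (1 / 2) with h | h
  · have : ∫ r in Ioo 0 s, |conjTriangleDensity r| ≤ ∫ r in Ioo 0 s, M :=
      setIntegral_mono_on (hi.mono_set Ioo_subset_Ioi_self) (by simp) measurableSet_Ioo
        fun r hr => hM r ⟨hr.1.le, hr.2.le.trans h⟩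
    rw [setIntegral_const, Real.volume_real_Ioo_of_le hs, smul_eq_mul, sub_zero] at this
    nlinarith
  · have : ∫ r in Ioo 0 s, |conjTriangleDensity r| ≤ N :=
      setIntegral_mono_set hi (.of_forall fun _ => abs_nonneg _)
        Ioo_subset_Ioi_self.eventuallyLE
    nlinarith

/-- The kernel expressing the averages of truncated singular integrals as `conjTriangle`. -/
noncomputable def truncationKernel (h x t r : ℝ) : ℝ :=
  if h * r < |t - x| then (t - x)⁻¹ * conjTriangleDensity r else 0

lemma measurable_truncationKernel (h x : ℝ) :
    Measurable fun p : ℝ × ℝ => truncationKernel h x p.1 p.2 := by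
  have : Measurable conjTriangleDensity := by
    unfold conjTriangleDensity
    fun_prop
  unfold truncationKernel
  refine Measurable.ite (measurableSet_lt (by fun_prop) (by fun_prop)) ?_ measurable_const
  fun_prop

lemma integral_truncationKernel_comp {h : ℝ} (hh : 0 < h) (x t : ℝ) (φ : ℝ → ℝ) (hφ : φ 0 = 0) :
    ∫ r in Ioi (0 : ℝ), φ (truncationKernel h x t r)
      = ∫ r in Ioo 0 (|t - x| / h), φ ((t - x)⁻¹ * conjTriangleDensity r) := by
  rw [setIntegral_eq_of_subset_of_forall_sdiff_eq_zero (s := Ioo 0 (|t - x| / h))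
    measurableSet_Ioi Ioo_subset_Ioi_self]
  · refine setIntegral_congr_fun measurableSet_Ioo fun r hr => ?_
    have : h * r < |t - x| := by
      have := hr.2
      rwa [lt_div_iff₀' hh] at this
    simp [truncationKernel, this]
  · intro r hr
    have : ¬ h * r < |t - x| := by
      intro hc
      exact hr.2 ⟨hr.1, by rwa [lt_div_iff₀' hh]⟩
    simp [truncationKernel, this, hφ]

lemma integral_truncationKernel {h : ℝ} (hh : 0 < h) (x t : ℝ) :
    ∫ r in Ioi (0 : ℝ), truncationKernel h x t r = conjTriangle h (t - x) / h ^ 2 := by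
  have h0 : 0 ≤ |t - x| / h := by positivity
  have e := integral_truncationKernel_comp hh x t id rfl
  simp only [id] at e
  rw [e, integral_const_mul, ← integral_Ioc_eq_integral_Ioo,
    ← intervalIntegral.integral_of_le h0, integral_conjTriangleDensity h0]
  have h1 : |t - x| / h = |(t - x) / h| := by rw [abs_div, abs_of_pos hh]
  have h2 := conjTriangle_mul hh ((t - x) / h)
  rw [mul_div_cancel₀ _ hh.ne'] at h2
  rw [h1, abs_mul_conjTriangle_abs, h2]
  rcases eq_or_ne (t - x) 0 with h3 | h3
  · have : conjTriangle 1 0 = 0 := by simp [conjTriangle]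
    simp [h3, this]
  · field_simp

lemma integrable_mul_truncationKernel {g : ℝ → ℂ} (hg : Integrable g) (x : ℝ) {h : ℝ}
    (hh : 0 < h) :
    Integrable (Function.uncurry fun t r : ℝ => g t * (truncationKernel h x t r : ℂ))
      (volume.prod (volume.restrict (Ioi 0))) := by
  obtain ⟨C, hC0, hC⟩ := exists_integral_abs_conjTriangleDensity_le
  have hm : AEStronglyMeasurable
      (Function.uncurry fun t r : ℝ => g t * (truncationKernel h x t r : ℂ))
      (volume.prod (volume.restrict (Ioi 0))) :=
    hg.aestronglyMeasurable.comp_fst.mul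
      (Complex.measurable_ofReal.comp (measurable_truncationKernel h x)).aestronglyMeasurable
  rw [integrable_prod_iff hm]
  constructor
  · refine .of_forall fun t => ?_
    refine Integrable.const_mul (Integrable.ofReal (𝕜 := ℂ) ?_) (g t)
    refine Integrable.mono' (integrableOn_conjTriangleDensity.abs.const_mul |(t - x)⁻¹|)
      ((measurable_truncationKernel h x).comp measurable_prodMk_left).aestronglyMeasurable
      (.of_forall fun r => ?_)
    change ‖truncationKernel h x t r‖ ≤ _
    unfold truncationKernel
    split_ifs
    · rw [norm_mul, Real.norm_eq_abs, Real.norm_eq_abs]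
    · simp only [norm_zero]
      positivity
  · refine Integrable.mono' (hg.norm.mul_const (C / h)) hm.norm.integral_prod_right'
      (.of_forall fun t => ?_)
    rw [Real.norm_of_nonneg (integral_nonneg fun _ => norm_nonneg _)]
    simp only [Function.uncurry_apply_pair, norm_mul, Complex.norm_real]
    rw [integral_const_mul]
    refine mul_le_mul_of_nonneg_left ?_ (norm_nonneg _)
    rw [integral_truncationKernel_comp hh x t norm norm_zero]
    simp only [norm_mul, Real.norm_eq_abs]
    rw [integral_const_mul]
    have h0 : 0 ≤ |t - x| / h := by positivity
    calc |(t - x)⁻¹| * ∫ r in Ioo 0 (|t - x| / h), |conjTriangleDensity r|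
        ≤ |(t - x)⁻¹| * (C * (|t - x| / h)) :=
          mul_le_mul_of_nonneg_left (hC _ h0) (abs_nonneg _)
      _ = (C / h) * (|t - x|⁻¹ * |t - x|) := by rw [abs_inv]; ring
      _ ≤ C / h := mul_le_of_le_one_right (by positivity) inv_mul_le_one

lemma integral_mul_truncationKernel (g : ℝ → ℂ) (h x r : ℝ) :
    ∫ t, g t * (truncationKernel h x t r : ℂ)
      = (∫ t in {t : ℝ | h * r < |t - x|}, g t / ((t - x : ℝ) : ℂ)) * conjTriangleDensity r := by
  have hs : MeasurableSet {t : ℝ | h * r < |t - x|} :=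
    measurableSet_lt (by fun_prop) (by fun_prop)
  rw [← integral_indicator hs, ← integral_mul_const]
  refine integral_congr_ae (.of_forall fun t => ?_)
  by_cases ht : h * r < |t - x|
  · simp only [truncationKernel, ht, if_true, indicator, mem_ofPred_eq]
    push_cast
    ring
  · simp [truncationKernel, ht]

lemma exists_norm_truncated_le {g : ℝ → ℂ} (hg : Integrable g) (x : ℝ) {L : ℂ}
    (hJ : Tendsto (fun δ : ℝ => ∫ t in {t : ℝ | δ < |t - x|}, g t / ((t - x : ℝ) : ℂ))
      (nhdsWithin 0 (Ioi 0)) (nhds L)) :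
    ∃ B, ∀ δ : ℝ, 0 < δ → ‖∫ t in {t : ℝ | δ < |t - x|}, g t / ((t - x : ℝ) : ℂ)‖ ≤ B := by
  have h1 := hJ.norm.eventually_le_const (lt_add_one ‖L‖)
  obtain ⟨d, hd0, hd⟩ := mem_nhdsGT_iff_exists_Ioo_subset.1 h1
  have hd0' : 0 < d := hd0
  refine ⟨max (‖L‖ + 1) ((∫ t, ‖g t‖) / d), fun δ hδ => ?_⟩
  rcases lt_or_ge δ d with hlt | hge
  · exact le_max_of_le_left (hd ⟨hδ, hlt⟩)
  · refine le_max_of_le_right ?_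
    have hs : MeasurableSet {t : ℝ | δ < |t - x|} := measurableSet_lt (by fun_prop) (by fun_prop)
    rw [← integral_div, ← integral_indicator hs]
    refine norm_integral_le_of_norm_le (hg.norm.div_const d) (.of_forall fun t => ?_)
    by_cases ht : δ < |t - x|
    · simp only [indicator, mem_ofPred_eq, ht, if_true, norm_div, Complex.norm_real,
        Real.norm_eq_abs]
      exact div_le_div_of_nonneg_left (norm_nonneg _) hd0' (by linarith)
    · simp only [indicator, mem_ofPred_eq, ht, if_false, norm_zero]
      positivity

/-- Convergence of the truncated singular integrals implies convergence of their
`conjTriangle` averages. -/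
lemma tendsto_integral_mul_conjTriangle {g : ℝ → ℂ} (hg : Integrable g) (x : ℝ) {L : ℂ}
    (hJ : Tendsto (fun δ : ℝ => ∫ t in {t : ℝ | δ < |t - x|}, g t / ((t - x : ℝ) : ℂ))
      (nhdsWithin 0 (Ioi 0)) (nhds L)) :
    Tendsto (fun h : ℝ => (∫ t, g t * (conjTriangle h (t - x) : ℂ)) / (h : ℂ) ^ 2)
      (nhdsWithin 0 (Ioi 0)) (nhds L) := by
  set J : ℝ → ℂ := fun δ => ∫ t in {t : ℝ | δ < |t - x|}, g t / ((t - x : ℝ) : ℂ) with hJdef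
  have hrep : ∀ h : ℝ, 0 < h → (∫ t, g t * (conjTriangle h (t - x) : ℂ)) / (h : ℂ) ^ 2
      = ∫ r in Ioi (0 : ℝ), J (h * r) * conjTriangleDensity r := by
    intro h hh
    have hswap := integral_integral_swap (integrable_mul_truncationKernel hg x hh)
    simp only [integral_mul_truncationKernel, integral_const_mul, integral_complex_ofReal,
      integral_truncationKernel hh] at hswap
    rw [← hswap, ← integral_div]
    refine integral_congr_ae (.of_forall fun t => ?_)
    push_cast
    ring
  obtain ⟨B, hB⟩ := exists_norm_truncated_le hg x hJ
  have hlim : Tendsto (fun h : ℝ => ∫ r in Ioi (0 : ℝ), J (h * r) * conjTriangleDensity r)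
      (nhdsWithin 0 (Ioi 0)) (nhds (∫ r in Ioi (0 : ℝ), L * conjTriangleDensity r)) := by
    refine tendsto_integral_filter_of_dominated_convergence
      (fun r => B * |conjTriangleDensity r|) ?_ ?_
      (integrableOn_conjTriangleDensity.abs.const_mul B) ?_
    · filter_upwards [self_mem_nhdsWithin] with h hh
      have := (integrable_mul_truncationKernel hg x hh).integral_prod_right.aestronglyMeasurable
      simpa only [Function.uncurry_apply_pair, integral_mul_truncationKernel] using this
    · filter_upwards [self_mem_nhdsWithin] with h hh
      filter_upwards [ae_restrict_mem measurableSet_Ioi] with r hr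
      rw [norm_mul, Complex.norm_real, Real.norm_eq_abs]
      exact mul_le_mul_of_nonneg_right (hB (h * r) (mul_pos hh hr)) (abs_nonneg _)
    · filter_upwards [ae_restrict_mem measurableSet_Ioi] with r hr
      refine Tendsto.mul_const _ (hJ.comp ?_)
      refine tendsto_nhdsWithin_iff.2 ⟨?_, ?_⟩
      · have : Tendsto (fun h : ℝ => h * r) (nhds 0) (nhds (0 * r)) :=
          tendsto_id.mul_const r
        rw [zero_mul] at this
        exact this.mono_left nhdsWithin_le_nhds
      · filter_upwards [self_mem_nhdsWithin] with h hh
        exact mem_Ioi.2 (mul_pos (mem_Ioi.1 hh) (mem_Ioi.1 hr))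
  rw [integral_const_mul, integral_complex_ofReal, integral_Ioi_conjTriangleDensity, ofReal_one,
    mul_one] at hlim
  refine hlim.congr' ?_
  filter_upwards [self_mem_nhdsWithin] with h hh
  exact (hrep h hh).symm

/-- The regularised kernel of the second primitive of a Fourier integral. -/
noncomputable def secondPrimitiveKernel (x ξ : ℝ) : ℂ :=
  (Complex.exp (I * x * ξ) - 1 - if |ξ| < 1 then I * x * ξ else 0) / (ξ : ℂ) ^ 2

lemma norm_exp_I_mul (x ξ : ℝ) : ‖Complex.exp (I * x * ξ)‖ = 1 := by
  rw [show I * (x : ℂ) * ξ = ((x * ξ : ℝ) : ℂ) * I by push_cast; ring]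
  exact Complex.norm_exp_ofReal_mul_I _

lemma norm_secondPrimitiveKernel_le (x ξ : ℝ) :
    ‖secondPrimitiveKernel x ξ‖ ≤ (6 * x ^ 2 + 4) * (1 + ξ ^ 2)⁻¹ := by
  rcases eq_or_ne ξ 0 with rfl | hξ
  · simp [secondPrimitiveKernel]
    positivity
  have hξ2 : 0 < ξ ^ 2 := by positivity
  have hn : ‖I * (x : ℂ) * ξ‖ = |x * ξ| := by simp [abs_mul]
  have h2 : ‖Complex.exp (I * x * ξ) - 1‖ ≤ 2 := by
    refine (norm_sub_le _ _).trans ?_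
    rw [norm_exp_I_mul, norm_one]
    norm_num
  rw [secondPrimitiveKernel, norm_div, norm_pow, Complex.norm_real, Real.norm_eq_abs, sq_abs,
    ← div_eq_mul_inv, div_le_div_iff₀ hξ2 (by positivity)]
  split_ifs with h1
  · have hξ1 : ξ ^ 2 < 1 := by rwa [sq_lt_one_iff_abs_lt_one]
    have key : ‖Complex.exp (I * x * ξ) - 1 - I * x * ξ‖ ≤ 3 * (x * ξ) ^ 2 := by
      rcases le_total |x * ξ| 1 with hu | hu
      · refine (Complex.norm_exp_sub_one_sub_id_le (by rwa [hn])).trans ?_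
        rw [hn, sq_abs]
        nlinarith [sq_nonneg (x * ξ)]
      · refine (norm_sub_le _ _).trans ?_
        rw [hn]
        have := sq_abs (x * ξ)
        nlinarith
    nlinarith [mul_nonneg (norm_nonneg (Complex.exp (I * x * ξ) - 1 - I * x * ξ)) hξ2.le,
      norm_nonneg (Complex.exp (I * x * ξ) - 1 - I * x * ξ)]
  · have hξ1 : 1 ≤ ξ ^ 2 := by
      rw [one_le_sq_iff_one_le_abs]
      exact not_lt.1 h1
    rw [sub_zero]
    nlinarith [sq_nonneg (x * ξ)]

lemma measurable_secondPrimitiveKernel (x : ℝ) : Measurable (secondPrimitiveKernel x) := by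
  unfold secondPrimitiveKernel
  refine Measurable.div (Measurable.sub (by fun_prop) ?_) (by fun_prop)
  exact Measurable.ite (measurableSet_lt (by fun_prop) (by fun_prop)) (by fun_prop) (by fun_prop)

lemma continuous_secondPrimitiveKernel (ξ : ℝ) : Continuous fun x => secondPrimitiveKernel x ξ := by
  unfold secondPrimitiveKernel
  split_ifs <;> fun_prop

lemma secondDiff_secondPrimitiveKernel (x h ξ : ℝ) :
    secondPrimitiveKernel (x + h) ξ + secondPrimitiveKernel (x - h) ξ
      - 2 * secondPrimitiveKernel x ξ = -(Complex.exp (I * x * ξ) * triangleWeight h ξ) := by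
  have e1 : Complex.exp (I * (x + h : ℝ) * ξ)
      = Complex.exp (I * x * ξ) * Complex.exp (h * ξ * I) := by
    rw [← Complex.exp_add]
    push_cast
    ring_nf
  have e2 : Complex.exp (I * (x - h : ℝ) * ξ)
      = Complex.exp (I * x * ξ) * Complex.exp (-(h * ξ) * I) := by
    rw [← Complex.exp_add]
    push_cast
    ring_nf
  unfold secondPrimitiveKernel triangleWeight
  rw [e1, e2]
  push_cast
  rw [Complex.cos]
  split_ifs <;> ring

/-- A formal second primitive of `∫ a ξ * exp (i x ξ) dξ` for a bounded symbol `a`. -/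
noncomputable def secondPrimitive (a : ℝ → ℂ) (x : ℝ) : ℂ :=
  -∫ ξ, a ξ * secondPrimitiveKernel x ξ

section BoundedSymbol

variable {a : ℝ → ℂ} {M : ℝ}

lemma norm_mul_secondPrimitiveKernel_le (hM : ∀ ξ, ‖a ξ‖ ≤ M) (x ξ : ℝ) :
    ‖a ξ * secondPrimitiveKernel x ξ‖ ≤ M * ((6 * x ^ 2 + 4) * (1 + ξ ^ 2)⁻¹) := by
  rw [norm_mul]
  exact mul_le_mul (hM ξ) (norm_secondPrimitiveKernel_le x ξ) (norm_nonneg _)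
    ((norm_nonneg _).trans (hM ξ))

lemma integrable_mul_secondPrimitiveKernel (ha : Measurable a) (hM : ∀ ξ, ‖a ξ‖ ≤ M) (x : ℝ) :
    Integrable fun ξ => a ξ * secondPrimitiveKernel x ξ :=
  ((integrable_inv_one_add_sq.const_mul (6 * x ^ 2 + 4)).const_mul M).mono'
    (ha.mul (measurable_secondPrimitiveKernel x)).aestronglyMeasurable
    (.of_forall (norm_mul_secondPrimitiveKernel_le hM x))

lemma continuous_secondPrimitive (ha : Measurable a) (hM : ∀ ξ, ‖a ξ‖ ≤ M) :
    Continuous (secondPrimitive a) := by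
  have hM0 : 0 ≤ M := (norm_nonneg _).trans (hM 0)
  refine Continuous.neg ?_
  rw [continuous_iff_continuousAt]
  intro x
  refine continuousAt_of_dominated
    (bound := fun ξ => M * ((6 * (|x| + 1) ^ 2 + 4) * (1 + ξ ^ 2)⁻¹))
    (.of_forall fun y => (integrable_mul_secondPrimitiveKernel ha hM y).aestronglyMeasurable)
    ?_ ((integrable_inv_one_add_sq.const_mul _).const_mul M)
    (.of_forall fun ξ => ((continuous_secondPrimitiveKernel ξ).const_mul (a ξ)).continuousAt)
  have : ∀ᶠ y in nhds x, |y| < |x| + 1 :=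
    continuous_abs.continuousAt.eventually (Iio_mem_nhds (by linarith))
  filter_upwards [this] with y hy
  refine .of_forall fun ξ => (norm_mul_secondPrimitiveKernel_le hM y ξ).trans ?_
  have hy2 : y ^ 2 ≤ (|x| + 1) ^ 2 := by
    rw [← sq_abs y]
    exact pow_le_pow_left₀ (abs_nonneg y) hy.le 2
  gcongr

lemma secondDiff_secondPrimitive (ha : Measurable a) (hM : ∀ ξ, ‖a ξ‖ ≤ M) (x h : ℝ) :
    secondPrimitive a (x + h) + secondPrimitive a (x - h) - 2 * secondPrimitive a x
      = ∫ ξ, a ξ * (Complex.exp (I * x * ξ) * triangleWeight h ξ) := by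
  have hi := integrable_mul_secondPrimitiveKernel ha hM
  have hi2 : Integrable fun ξ => a ξ * secondPrimitiveKernel (x + h) ξ
      + a ξ * secondPrimitiveKernel (x - h) ξ := (hi (x + h)).add (hi (x - h))
  have : ∫ ξ, a ξ * (Complex.exp (I * x * ξ) * triangleWeight h ξ)
      = -∫ ξ, (a ξ * secondPrimitiveKernel (x + h) ξ + a ξ * secondPrimitiveKernel (x - h) ξ
        - 2 * (a ξ * secondPrimitiveKernel x ξ)) := by
    rw [← integral_neg]
    refine integral_congr_ae (.of_forall fun ξ => ?_)
    linear_combination (a ξ) * secondDiff_secondPrimitiveKernel x h ξ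
  rw [this, integral_sub hi2 ((hi x).const_mul 2), integral_add (hi _) (hi _), integral_const_mul]
  simp only [secondPrimitive]
  ring

end BoundedSymbol

/-- The Fourier multiplier of the Hilbert transform, up to the factor `2`. -/
noncomputable def halfSign (ξ : ℝ) : ℂ := if 0 < ξ then I / 2 else -(I / 2)

lemma measurable_halfSign : Measurable halfSign :=
  Measurable.ite measurableSet_Ioi measurable_const measurable_const

lemma norm_halfSign_le (ξ : ℝ) : ‖halfSign ξ‖ ≤ 1 := by
  unfold halfSign
  split_ifs <;> simp <;> norm_num

lemma triangle_neg (h s : ℝ) : triangle h (-s) = triangle h s := by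
  unfold triangle
  rw [show -s + h = -(s - h) by ring, show -s - h = -(s + h) by ring]
  simp only [abs_neg]
  ring

section Multiplier

variable {σ : ℝ → ℂ}

lemma integrable_multiplier (hσ : Measurable σ) (hσ1 : ∀ ξ, ‖σ ξ‖ ≤ 1) (h : ℝ) :
    Integrable fun ξ => σ ξ * (triangleWeight h ξ : ℂ) :=
  (integrable_triangleWeight h).ofReal.bdd_mul hσ.aestronglyMeasurable (.of_forall hσ1)

lemma integrable_multiplier_mul_exp (hσ : Measurable σ) (hσ1 : ∀ ξ, ‖σ ξ‖ ≤ 1) (h s : ℝ) :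
    Integrable fun ξ : ℝ => σ ξ * triangleWeight h ξ * Complex.exp (-I * s * ξ) :=
  (integrable_multiplier hσ hσ1 h).mul_bdd (c := 1)
    (by fun_prop : Continuous fun ξ : ℝ => Complex.exp (-I * s * ξ)).aestronglyMeasurable
    (.of_forall fun ξ => (norm_exp_neg_I_mul s ξ).le)

/-- A Fourier integral over the line, folded onto the half-line. -/
lemma integral_multiplier_mul_exp (hσ : Measurable σ) (hσ1 : ∀ ξ, ‖σ ξ‖ ≤ 1) {p q : ℂ}
    (hp : ∀ ξ, 0 < ξ → σ ξ = p) (hq : ∀ ξ, ξ < 0 → σ ξ = q) (h s : ℝ) :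
    ∫ ξ : ℝ, σ ξ * triangleWeight h ξ * Complex.exp (-I * s * ξ)
      = (q - p) * (I * conjTriangle h s) + (q + p) * (π * triangle h s : ℝ) := by
  have hi := integrable_multiplier_mul_exp hσ hσ1 h s
  rw [← intervalIntegral.integral_Iic_add_Ioi (b := 0) hi.integrableOn hi.integrableOn]
  have h1 : ∫ ξ in Ioi (0 : ℝ), σ ξ * triangleWeight h ξ * Complex.exp (-I * s * ξ)
      = p * ∫ ξ in Ioi (0 : ℝ), Complex.exp (I * (-s : ℝ) * ξ) * triangleWeight h ξ := by
    rw [← integral_const_mul]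
    refine setIntegral_congr_fun measurableSet_Ioi fun ξ hξ => ?_
    simp only [hp ξ hξ]
    push_cast
    ring_nf
  have h2 : ∫ ξ in Iic (0 : ℝ), σ ξ * triangleWeight h ξ * Complex.exp (-I * s * ξ)
      = q * ∫ ξ in Ioi (0 : ℝ), Complex.exp (I * s * ξ) * triangleWeight h ξ := by
    have := integral_comp_neg_Ioi 0
      (fun ξ : ℝ => σ ξ * triangleWeight h ξ * Complex.exp (-I * s * ξ))
    rw [neg_zero] at this
    rw [← this, ← integral_const_mul]
    refine setIntegral_congr_fun measurableSet_Ioi fun ξ hξ => ?_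
    simp only [hq (-ξ) (neg_neg_of_pos hξ), triangleWeight_neg]
    push_cast
    ring_nf
  rw [h1, h2, integral_exp_mul_triangleWeight, integral_exp_mul_triangleWeight, conjTriangle_neg,
    triangle_neg]
  push_cast
  ring

lemma integral_halfSign_mul_exp (h s : ℝ) :
    ∫ ξ : ℝ, halfSign ξ * triangleWeight h ξ * Complex.exp (-I * s * ξ) = conjTriangle h s := by
  rw [integral_multiplier_mul_exp measurable_halfSign norm_halfSign_le (p := I / 2)
    (q := -(I / 2)) (fun ξ hξ => if_pos hξ) (fun ξ hξ => if_neg (not_lt.2 hξ.le))]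
  linear_combination (-(conjTriangle h s : ℂ)) * I_mul_I

lemma integral_half_mul_exp (h s : ℝ) :
    ∫ ξ : ℝ, (1 / 2 : ℂ) * triangleWeight h ξ * Complex.exp (-I * s * ξ)
      = (π * triangle h s : ℝ) := by
  rw [integral_multiplier_mul_exp (σ := fun _ => 1 / 2) measurable_const (fun _ => by norm_num)
    (p := 1 / 2) (q := 1 / 2) (fun _ _ => rfl) (fun _ _ => rfl)]
  ring

/-- The multiplication formula for the kernel with symbol `σ ξ * triangleWeight h ξ`. -/
lemma integral_mul_multiplier {f : ℝ → ℂ} (hf : Integrable f) (hσ : Measurable σ)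
    (hσ1 : ∀ ξ, ‖σ ξ‖ ≤ 1) (h x : ℝ) :
    ∫ t, f t * ∫ ξ : ℝ, σ ξ * triangleWeight h ξ * Complex.exp (-I * (t - x : ℝ) * ξ)
      = ∫ ξ : ℝ, σ ξ * ft f ξ * (Complex.exp (I * x * ξ) * triangleWeight h ξ) := by
  have hF_int : Integrable (Function.uncurry fun t ξ : ℝ =>
      f t * (σ ξ * triangleWeight h ξ * Complex.exp (-I * (t - x : ℝ) * ξ)))
      (volume.prod volume) := by
    have h1 := hf.mul_prod (integrable_multiplier hσ hσ1 h)
    have h2 := h1.mul_bdd (c := 1) (g := fun z : ℝ × ℝ =>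
      Complex.exp (-I * (z.1 - x : ℝ) * z.2)) (by fun_prop : Continuous fun z : ℝ × ℝ =>
        Complex.exp (-I * (z.1 - x : ℝ) * z.2)).aestronglyMeasurable
      (.of_forall fun z => (norm_exp_neg_I_mul _ _).le)
    refine h2.congr (.of_forall fun z => ?_)
    simp only [Function.uncurry_def]
    ring
  simp only [← integral_const_mul]
  rw [integral_integral_swap hF_int]
  refine integral_congr_ae (.of_forall fun ξ => ?_)
  simp only [ft]
  rw [← integral_const_mul, ← integral_mul_const]
  refine integral_congr_ae (.of_forall fun t => ?_)
  have e : Complex.exp (-I * (t - x : ℝ) * ξ)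
      = Complex.exp (-I * ξ * t) * Complex.exp (I * x * ξ) := by
    rw [← Complex.exp_add]
    push_cast
    ring_nf
  simp only [e]
  ring

end Multiplier

lemma norm_ft_le (f : ℝ → ℂ) (ξ : ℝ) : ‖ft f ξ‖ ≤ ∫ t, ‖f t‖ := by
  refine (norm_integral_le_integral_norm _).trans (le_of_eq ?_)
  simp only [norm_mul, norm_exp_neg_I_mul, mul_one]

/-- If the principal value Hilbert transform of `g` exists everywhere and is integrable, it agrees
with the distributional Hilbert transform, tested against translates of `triangle h`. -/
lemma integral_mul_conjTriangle_eq {g f : ℝ → ℂ} (hg : Integrable g) (hf : Integrable f)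
    (hJ : ∀ x : ℝ, Tendsto
      (fun δ : ℝ => ∫ t in {t : ℝ | δ < |t - x|}, g t / ((t - x : ℝ) : ℂ))
      (nhdsWithin 0 (Ioi 0)) (nhds (f x))) (x : ℝ) {h : ℝ} (hh : 0 < h) :
    ∫ t, g t * (conjTriangle h (t - x) : ℂ) = ∫ t, f t * (triangle h (t - x) : ℂ) := by
  set a : ℝ → ℂ := fun ξ => halfSign ξ * ft g ξ with ha
  have ham : Measurable a := measurable_halfSign.mul (continuous_ft hg).measurable
  have haM : ∀ ξ, ‖a ξ‖ ≤ 1 * ∫ t, ‖g t‖ := fun ξ => by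
    rw [ha, norm_mul]
    exact mul_le_mul (norm_halfSign_le ξ) (norm_ft_le g ξ) (norm_nonneg _) zero_le_one
  set K := secondPrimitive a with hK
  have hKc : Continuous K := continuous_secondPrimitive ham haM
  have hKd : ∀ x h : ℝ, K (x + h) + K (x - h) - 2 * K x
      = ∫ t, g t * (conjTriangle h (t - x) : ℂ) := by
    intro x h
    rw [hK, secondDiff_secondPrimitive ham haM,
      ← integral_mul_multiplier hg measurable_halfSign norm_halfSign_le]
    simp only [integral_halfSign_mul_exp]
  have hlim : ∀ x, Tendsto (fun h : ℝ => (K (x + h) + K (x - h) - 2 * K x) / (h : ℂ) ^ 2)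
      (nhdsWithin 0 (Ioi 0)) (nhds (f x)) := by
    intro x
    simp only [hKd]
    exact tendsto_integral_mul_conjTriangle hg x (hJ x)
  have hi : Integrable fun t => f t * (triangle h (t - x) : ℂ) := by
    refine hf.mul_bdd (c := h) (Complex.continuous_ofReal.comp
      ((continuous_triangle h).comp (continuous_sub_right x))).aestronglyMeasurable
      (.of_forall fun t => ?_)
    rw [Complex.norm_real, Real.norm_of_nonneg (triangle_nonneg hh _)]
    exact triangle_le hh _
  have hre := secondDiff_eq_integral_of_tendsto (Complex.continuous_re.comp hKc) hf.re
    (fun y => by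
      refine ((Complex.continuous_re.tendsto _).comp (hlim y)).congr fun d => ?_
      simp only [Function.comp_apply, ← ofReal_pow, Complex.div_ofReal_re]
      simp) x hh
  have him := secondDiff_eq_integral_of_tendsto (Complex.continuous_im.comp hKc) hf.im
    (fun y => by
      refine ((Complex.continuous_im.tendsto _).comp (hlim y)).congr fun d => ?_
      simp only [Function.comp_apply, ← ofReal_pow, Complex.div_ofReal_im]
      simp) x hh
  rw [← hKd]
  apply Complex.ext
  · have := integral_re hi
    simp only [RCLike.re_to_complex, Complex.re_mul_ofReal] at this hre
    rw [← this, ← hre]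
    simp
  · have := integral_im hi
    simp only [RCLike.im_to_complex, Complex.im_mul_ofReal] at this him
    rw [← this, ← him]
    simp

lemma triangleWeight_pi_div {ξ : ℝ} (hξ : ξ ≠ 0) : triangleWeight (π / |ξ|) ξ ≠ 0 := by
  have : Real.cos (π / |ξ| * ξ) = -1 := by
    rcases abs_cases ξ with ⟨h, -⟩ | ⟨h, -⟩ <;> rw [h]
    · rw [div_mul_cancel₀ _ hξ, Real.cos_pi]
    · rw [div_neg, neg_mul, div_mul_cancel₀ _ hξ, Real.cos_neg, Real.cos_pi]
  rw [triangleWeight, this]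
  positivity

lemma continuousAt_halfSign {ξ : ℝ} (hξ : ξ ≠ 0) : ContinuousAt halfSign ξ := by
  rcases lt_or_gt_of_ne hξ with h | h
  · refine (continuousAt_const (y := -(I / 2))).congr ?_
    filter_upwards [Iio_mem_nhds h] with η hη
    exact (if_neg (not_lt.2 (le_of_lt hη))).symm
  · refine (continuousAt_const (y := I / 2)).congr ?_
    filter_upwards [Ioi_mem_nhds h] with η hη
    exact (if_pos hη).symm

/-- The Hilbert transform as a Fourier multiplier. -/
lemma ft_hilbert_eq {g Hg : ℝ → ℂ} (hg : Integrable g) (hH : Integrable Hg)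
    (hJ : ∀ x : ℝ, Tendsto
      (fun δ : ℝ => ∫ t in {t : ℝ | δ < |t - x|}, g t / ((t - x : ℝ) : ℂ))
      (nhdsWithin 0 (Ioi 0)) (nhds (π * Hg x))) {ξ : ℝ} (hξ : ξ ≠ 0) :
    ft Hg ξ = 2 * halfSign ξ * ft g ξ := by
  set h : ℝ := π / |ξ| with hdef
  have hh : 0 < h := div_pos Real.pi_pos (abs_pos.2 hξ)
  set b : ℝ → ℂ := fun η => halfSign η * ft g η - 1 / 2 * ft Hg η with hb
  set G : ℝ → ℂ := fun η => b η * triangleWeight h η with hG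
  have hbm : Measurable b := (measurable_halfSign.mul (continuous_ft hg).measurable).sub
    ((continuous_ft hH).measurable.const_mul _)
  have hF_int : ∀ σ : ℝ → ℂ, Measurable σ → (∀ η, ‖σ η‖ ≤ 1) → ∀ f : ℝ → ℂ, Integrable f →
      ∀ x : ℝ, Integrable fun η : ℝ =>
        σ η * ft f η * (Complex.exp (I * x * η) * triangleWeight h η) := by
    intro σ hσ hσ1 f hf x
    have h1 := (integrable_multiplier hσ hσ1 h).mul_bdd (c := ∫ t, ‖f t‖)
      (continuous_ft hf).aestronglyMeasurable (.of_forall (norm_ft_le f))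
    have h2 := h1.mul_bdd (c := 1)
      (by fun_prop : Continuous fun η : ℝ => Complex.exp (I * x * η)).aestronglyMeasurable
      (.of_forall fun η => (norm_exp_I_mul x η).le)
    refine h2.congr (.of_forall fun η => ?_)
    ring
  have hhalf : ∀ η : ℝ, ‖(1 / 2 : ℂ)‖ ≤ 1 := fun _ => by norm_num
  have hzero : ∀ x : ℝ, ∫ η : ℝ, Complex.exp (I * x * η) * G η = 0 := by
    intro x
    have e1 := integral_mul_multiplier hg measurable_halfSign norm_halfSign_le h x
    have e2 := integral_mul_multiplier hH (σ := fun _ => 1 / 2) measurable_const hhalf h x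
    simp only [integral_halfSign_mul_exp] at e1
    simp only [integral_half_mul_exp] at e2
    have e3 := integral_mul_conjTriangle_eq hg (hH.const_mul (π : ℂ)) hJ x hh
    have e4 : ∫ t, (π : ℂ) * Hg t * (triangle h (t - x) : ℂ)
        = ∫ t, Hg t * ((π * triangle h (t - x) : ℝ) : ℂ) := by
      refine integral_congr_ae (.of_forall fun t => ?_)
      push_cast
      ring
    rw [e4, e1, e2] at e3
    rw [← sub_eq_zero, ← integral_sub (hF_int _ measurable_halfSign norm_halfSign_le g hg x)
      (hF_int _ measurable_const hhalf Hg hH x)] at e3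
    rw [← e3]
    refine integral_congr_ae (.of_forall fun η => ?_)
    simp only [hG, hb]
    ring
  have hGi : Integrable G := by
    have := (hF_int _ measurable_halfSign norm_halfSign_le g hg 0).sub
      (hF_int _ measurable_const hhalf Hg hH 0)
    refine this.congr (.of_forall fun η => ?_)
    simp only [hG, hb, Pi.sub_apply, ofReal_zero, mul_zero, zero_mul, Complex.exp_zero]
    ring
  have hinv : FourierTransformInv.fourierInv G = 0 := by
    ext y
    rw [Real.fourierInv_eq', Pi.zero_apply, ← hzero (2 * π * y)]
    refine integral_congr_ae (.of_forall fun η => ?_)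
    simp only [smul_eq_mul]
    congr 2
    simp
    ring
  have hfou : FourierTransform.fourier G = 0 := by
    ext y
    rw [show y = -(-y) by ring, ← Real.fourierInv_eq_fourier_neg, hinv]
    rfl
  have hbc : ContinuousAt b ξ := ((continuousAt_halfSign hξ).mul
    (continuous_ft hg).continuousAt).sub ((continuous_ft hH).continuousAt.const_mul _)
  have hGc : ContinuousAt G ξ := by
    refine hbc.mul (Complex.continuous_ofReal.continuousAt.comp ?_)
    unfold triangleWeight
    exact ContinuousAt.div (by fun_prop) (by fun_prop) (pow_ne_zero 2 hξ)
  have hval := hGi.fourierInv_fourier_eq (by rw [hfou]; exact integrable_zero _ _ _) hGc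
  rw [hfou] at hval
  have hG0 : G ξ = 0 := by
    rw [← hval, Real.fourierInv_eq']
    simp
  have hb0 : b ξ = 0 := by
    rcases mul_eq_zero.1 hG0 with h0 | h0
    · exact h0
    · exact absurd (by exact_mod_cast h0) (triangleWeight_pi_div hξ)
  simp only [hb] at hb0
  linear_combination (-2) * hb0

lemma ft_add_const_mul {f₁ f₂ : ℝ → ℂ} (h₁ : Integrable f₁) (h₂ : Integrable f₂) (c : ℂ) (ξ : ℝ) :
    ft (fun t => f₁ t + c * f₂ t) ξ = ft f₁ ξ + c * ft f₂ ξ := by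
  unfold ft
  rw [← integral_const_mul, ← integral_add (integrable_mul_exp h₁ ξ)
    ((integrable_mul_exp h₂ ξ).const_mul c)]
  refine integral_congr_ae (.of_forall fun t => ?_)
  ring

lemma ft_comp_neg (f : ℝ → ℂ) (ξ : ℝ) : ft (fun t => f (-t)) ξ = ft f (-ξ) := by
  unfold ft
  rw [← integral_neg_eq_self]
  refine integral_congr_ae (.of_forall fun t => ?_)
  simp

lemma integral_norm_add_const_mul_le {f₁ f₂ : ℝ → ℂ} (h₁ : Integrable f₁) (h₂ : Integrable f₂)
    {c : ℂ} (hc : ‖c‖ = 1) : ∫ t, ‖f₁ t + c * f₂ t‖ ≤ (∫ t, ‖f₁ t‖) + ∫ t, ‖f₂ t‖ := by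
  rw [← integral_add h₁.norm h₂.norm]
  refine integral_mono (h₁.add (h₂.const_mul c)).norm (h₁.norm.add h₂.norm) fun t => ?_
  refine (norm_add_le _ _).trans (le_of_eq ?_)
  rw [norm_mul, hc, one_mul]

/-- **Extended Hardy inequality.** If `g ∈ L¹(ℝ)` and its Hilbert transform
`Hg(x) = (1/π) p.v. ∫ g(t)/(t−x) dt` is also in `L¹(ℝ)` (i.e. `g ∈ H¹(ℝ)`), then
`∫_ℝ |ĝ(x)|/|x| dx ≤ C (‖g‖_{L¹} + ‖Hg‖_{L¹})` for an absolute constant `C > 0`,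
where `ĝ(x) = ∫_ℝ g(t) e^{−ixt} dt`. -/
theorem extended_hardy_inequality :
    ∃ C : ℝ, 0 < C ∧
      ∀ (g Hg : ℝ → ℂ),
        -- g is Lebesgue integrable on ℝ
        MeasureTheory.Integrable g →
        -- Hg is the Hilbert transform (principal value) of g
        (∀ x : ℝ,
          Filter.Tendsto (fun δ : ℝ =>
              ((1 / Real.pi : ℝ) : ℂ) *
                ∫ t in {t : ℝ | δ < |t - x|}, g t / ((t - x : ℝ) : ℂ))
            (nhdsWithin 0 (Set.Ioi 0)) (nhds (Hg x))) →
        -- g ∈ H¹(ℝ) : Hg is Lebesgue integrable on ℝ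
        MeasureTheory.Integrable Hg →
        (∫⁻ x : ℝ,
            ENNReal.ofReal
              (‖∫ t : ℝ, g t * Complex.exp (-(Complex.I) * (x : ℂ) * (t : ℂ))‖ / |x|)) ≤
          ENNReal.ofReal (C * ((∫ t : ℝ, ‖g t‖) + ∫ x : ℝ, ‖Hg x‖)) := by
  refine ⟨16, by norm_num, fun g Hg hg hlim hH => ?_⟩
  change ∫⁻ x : ℝ, ENNReal.ofReal (‖ft g x‖ / |x|) ≤ _
  set N : ℝ := (∫ t : ℝ, ‖g t‖) + ∫ x : ℝ, ‖Hg x‖ with hN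
  have hπ : (π : ℂ) ≠ 0 := ofReal_ne_zero.2 Real.pi_ne_zero
  have hmult : ∀ {ξ : ℝ}, ξ ≠ 0 → ft Hg ξ = 2 * halfSign ξ * ft g ξ := by
    refine fun hξ =>
      ft_hilbert_eq hg hH (fun x => ((hlim x).const_mul (π : ℂ)).congr fun δ => ?_) hξ
    push_cast
    field_simp
  have hpos : ∀ c : ℂ, ∀ ξ : ℝ, 0 < ξ →
      ft (fun t => g t + c * Hg t) ξ = (1 + c * I) * ft g ξ := by
    intro c ξ hξ
    rw [ft_add_const_mul hg hH, hmult hξ.ne', halfSign, if_pos hξ]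
    ring
  have hneg : ∀ c : ℂ, ∀ ξ : ℝ, ξ < 0 →
      ft (fun t => g t + c * Hg t) ξ = (1 - c * I) * ft g ξ := by
    intro c ξ hξ
    rw [ft_add_const_mul hg hH, hmult hξ.ne, halfSign, if_neg (not_lt.2 hξ.le)]
    ring
  have hright : ∫⁻ x in Ioi (0 : ℝ), ENNReal.ofReal (‖ft g x‖ / |x|)
      ≤ ENNReal.ofReal (8 * N) := by
    have hi : Integrable fun t => g t + -I * Hg t := hg.add (hH.const_mul (-I))
    have key := lintegral_norm_ft_div_le hi fun ξ hξ => by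
      rw [hneg _ ξ hξ]
      simp
    refine (setLIntegral_mono' measurableSet_Ioi fun x hx => ?_).trans
      (key.trans (ENNReal.ofReal_le_ofReal (mul_le_mul_of_nonneg_left
        (integral_norm_add_const_mul_le hg hH (by simp)) (by norm_num))))
    have hx0 : 0 < x := hx
    refine ENNReal.ofReal_le_ofReal ?_
    rw [hpos _ x hx0, abs_of_pos hx0, norm_mul]
    have : ‖(1 : ℂ) + -I * I‖ = 2 := by norm_num
    rw [this]
    gcongr
    linarith [norm_nonneg (ft g x)]
  have hleft : ∫⁻ x in Iio (0 : ℝ), ENNReal.ofReal (‖ft g x‖ / |x|)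
      ≤ ENNReal.ofReal (8 * N) := by
    have hi : Integrable fun t => g t + I * Hg t := hg.add (hH.const_mul I)
    have key := lintegral_norm_ft_div_le hi.comp_neg fun ξ hξ => by
      rw [ft_comp_neg (fun t => g t + I * Hg t), hpos _ _ (neg_pos.2 hξ)]
      simp
    have hm : Measurable fun x : ℝ => ENNReal.ofReal (‖ft g x‖ / |x|) :=
      ENNReal.measurable_ofReal.comp ((continuous_ft hg).measurable.norm.div (by fun_prop))
    rw [integral_neg_eq_self (fun t => ‖g t + I * Hg t‖)] at key
    rw [← (Measure.measurePreserving_neg (volume : Measure ℝ)).setLIntegral_comp_preimage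
      measurableSet_Iio hm]
    have hset : (Neg.neg ⁻¹' Iio (0 : ℝ)) = Ioi 0 := by simp
    rw [hset]
    refine (setLIntegral_mono' measurableSet_Ioi fun x hx => ?_).trans
      (key.trans (ENNReal.ofReal_le_ofReal (mul_le_mul_of_nonneg_left
        (integral_norm_add_const_mul_le hg hH (by simp)) (by norm_num))))
    have hx0 : 0 < x := hx
    refine ENNReal.ofReal_le_ofReal ?_
    rw [ft_comp_neg (fun t => g t + I * Hg t), hneg _ _ (neg_neg_of_pos hx0), abs_neg,
      abs_of_pos hx0, norm_mul]
    have : ‖(1 : ℂ) - I * I‖ = 2 := by norm_num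
    rw [this]
    gcongr
    linarith [norm_nonneg (ft g (-x))]
  have hsplit : (univ : Set ℝ) =ᵐ[volume] (Iio (0 : ℝ) ∪ Ioi 0 : Set ℝ) := by
    rw [Iio_union_Ioi]
    exact (ae_eq_univ.2 (by simp)).symm
  calc ∫⁻ x : ℝ, ENNReal.ofReal (‖ft g x‖ / |x|)
      = ∫⁻ x in Iio (0 : ℝ) ∪ Ioi 0, ENNReal.ofReal (‖ft g x‖ / |x|) := by
        rw [← setLIntegral_univ, setLIntegral_congr hsplit]
    _ ≤ _ := lintegral_union_le _ _ _
    _ ≤ ENNReal.ofReal (8 * N) + ENNReal.ofReal (8 * N) := add_le_add hleft hright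
    _ = ENNReal.ofReal (16 * N) := by
        rw [← ENNReal.ofReal_add (by positivity) (by positivity)]
        ring_nf
end

section
/- (Kober) Let g : ℝ → ℂ be Lebesgue integrable and suppose its Hilbert transform Hg(x) = (1/π) lim_{δ→0+} ∫_{|t−x|>δ} g(t)/(t−x) dt is also Lebesgue integrable on ℝ (i.e., g belongs to the real Hardy space H^1(ℝ)). Then ∫_ℝ g(t) dt = 0. -/
open MeasureTheory Filter Set Real
open scoped Topology ENNReal

/-- **Cauchy's theorem for a half-plane.** -/
theorem integral_eq_zero_of_differentiableOn_halfPlane {G : ℂ → ℂ} {C r : ℝ}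
    (hG : DifferentiableOn ℂ G {z | 0 ≤ z.im})
    (hb : ∀ z : ℂ, 0 ≤ z.im → r ≤ ‖z‖ → ‖G z‖ ≤ C / ‖z‖ ^ 2)
    (hi : Integrable fun x : ℝ => G x) : ∫ x : ℝ, G x = 0 := by
  have hlim := intervalIntegral_tendsto_integral hi tendsto_neg_atTop_atBot tendsto_id
  refine tendsto_nhds_unique hlim (squeeze_zero_norm' (a := fun T : ℝ => 4 * C / T) ?_
    (tendsto_const_nhds.div_atTop tendsto_id))
  filter_upwards [eventually_ge_atTop r, eventually_gt_atTop 0] with T hT hT0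
  have hC : ∀ z : ℂ, 0 ≤ z.im → T ≤ ‖z‖ → ‖G z‖ ≤ C / T ^ 2 := by
    intro z hz hTz
    have h := hb z hz (hT.trans hTz)
    have hC0 : 0 ≤ C := by
      have := (norm_nonneg _).trans h
      have hz0 : 0 < ‖z‖ ^ 2 := pow_pos (hT0.trans_le hTz) 2
      by_contra! hneg
      exact absurd (div_neg_of_neg_of_pos hneg hz0) (not_lt.2 this)
    exact h.trans (by gcongr)
  have hrect := Complex.integral_boundary_rect_eq_zero_of_differentiableOn G (-T : ℝ)
    (T + T * Complex.I) (hG.mono fun z hz => by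
      have := hz.2
      simp [uIcc_of_le hT0.le] at this
      exact this.1)
  simp only [Complex.ofReal_re, Complex.ofReal_im, Complex.add_re, Complex.mul_re, Complex.I_re,
    Complex.I_im, Complex.add_im, Complex.mul_im, mul_zero, mul_one, zero_mul, sub_zero, add_zero,
    zero_add, Complex.ofReal_zero] at hrect
  have htop : ‖∫ x : ℝ in -T..T, G (x + T * Complex.I)‖ ≤ C / T ^ 2 * |T - -T| := by
    refine intervalIntegral.norm_integral_le_of_norm_le_const fun x _ => hC _ (by simp [hT0.le]) ?_
    simpa [abs_of_pos hT0] using Complex.abs_im_le_norm (x + T * Complex.I)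
  have hside : ∀ a : ℝ, |a| = T →
      ‖∫ y : ℝ in 0..T, G (a + y * Complex.I)‖ ≤ C / T ^ 2 * |T - 0| := by
    intro a ha
    refine intervalIntegral.norm_integral_le_of_norm_le_const fun y hy => hC _ ?_ ?_
    · rw [uIoc_of_le hT0.le] at hy
      simpa using hy.1.le
    · simpa [ha] using Complex.abs_re_le_norm (a + y * Complex.I)
  have h1 := hside T (abs_of_pos hT0)
  have h2 := hside (-T) (by rw [abs_neg, abs_of_pos hT0])
  have key : ∫ x : ℝ in -T..T, G x = (∫ x : ℝ in -T..T, G (x + T * Complex.I))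
      - Complex.I • (∫ y : ℝ in 0..T, G (T + y * Complex.I))
      + Complex.I • (∫ y : ℝ in 0..T, G ((-T : ℝ) + y * Complex.I)) := by
    linear_combination hrect
  rw [id, key]
  refine (norm_add_le _ _).trans ((add_le_add_left (norm_sub_le _ _) _).trans ?_)
  simp only [norm_smul, Complex.norm_I, one_mul]
  refine (add_le_add (add_le_add htop h1) h2).trans (le_of_eq ?_)
  rw [sub_zero, abs_of_pos hT0, abs_of_pos (by linarith)]
  field_simp
  ring

theorem ofReal_one_add_sq (x : ℝ) : 1 + (x : ℂ) ^ 2 = ((1 + x ^ 2 : ℝ) : ℂ) := by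
  push_cast
  rfl

/-- The **Poisson formula** at `i` for a bounded holomorphic function on the upper half-plane. -/
theorem integral_sub_div_one_add_sq_eq_zero {M : ℂ → ℂ} {C : ℝ}
    (hM : DifferentiableOn ℂ M {z | 0 ≤ z.im}) (hb : ∀ z : ℂ, 0 ≤ z.im → ‖M z‖ ≤ C) :
    ∫ x : ℝ, (M x - M Complex.I) / (1 + x ^ 2) = 0 := by
  set S : Set ℂ := {z | 0 ≤ z.im}
  have hne : ∀ z ∈ S, z + Complex.I ≠ 0 := by
    intro z hz h
    have := congrArg Complex.im h
    simp at this
    have hz' : 0 ≤ z.im := hz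
    linarith
  have hS : S ∈ 𝓝 Complex.I := by
    refine mem_of_superset (Complex.continuous_im.isOpen_preimage (Ioi 0) isOpen_Ioi |>.mem_nhds
      (by simp)) fun z (hz : 0 < z.im) => hz.le
  have hG : DifferentiableOn ℂ (fun z => dslope M Complex.I z / (z + Complex.I)) S :=
    ((Complex.differentiableOn_dslope hS).2 hM).div (by fun_prop) hne
  have heq : ∀ z : ℂ, z ≠ Complex.I → dslope M Complex.I z / (z + Complex.I)
      = (M z - M Complex.I) / (z ^ 2 + 1) := by
    intro z hz
    rw [dslope_of_ne _ hz, slope_def_field, div_div]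
    congr 1
    linear_combination -Complex.I_sq
  have hreal : ∀ x : ℝ, dslope M Complex.I x / (x + Complex.I)
      = (M x - M Complex.I) / (1 + x ^ 2) := by
    intro x
    rw [heq _ (fun h => by simpa using congrArg Complex.im h), add_comm]
  have hd : ∀ z ∈ S, ‖M z - M Complex.I‖ ≤ 2 * C := fun z hz => by
    refine (norm_sub_le _ _).trans ?_
    linarith [hb z hz, hb Complex.I (by simp)]
  have hC0 : 0 ≤ 2 * C := (norm_nonneg _).trans (hd Complex.I (by simp [S]))
  have hcont : ContinuousOn (fun z => dslope M Complex.I z / (z + Complex.I)) S := hG.continuousOn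
  simp_rw [← hreal]
  refine integral_eq_zero_of_differentiableOn_halfPlane (C := 4 * C) (r := 2) hG ?_ ?_
  · intro z hz hz2
    rw [heq z (fun h => by rw [h] at hz2; norm_num at hz2), norm_div]
    have h1 : ‖z‖ ^ 2 / 2 ≤ ‖z ^ 2 + 1‖ := by
      have := norm_sub_norm_le (z ^ 2) (-1)
      rw [sub_neg_eq_add, norm_neg, norm_one, norm_pow] at this
      nlinarith
    have h0 : 0 < ‖z‖ ^ 2 := by positivity
    calc _ ≤ 2 * C / (‖z‖ ^ 2 / 2) := by gcongr; exact hd z hz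
      _ = _ := by field_simp; ring
  · refine (integrable_inv_one_add_sq.const_mul (2 * C)).mono'
      (Continuous.aestronglyMeasurable ?_) (ae_of_all _ fun x => ?_)
    · exact hcont.comp_continuous Complex.continuous_ofReal (fun x => by simp [S])
    · rw [hreal, ofReal_one_add_sq, norm_div, Complex.norm_of_nonneg (by positivity), div_eq_mul_inv]
      gcongr
      exact hd _ (by simp [S])

/-- A holomorphic function into the closed unit disc which is close to `1` at `i` is close to `1`
in mean square on the real line. -/
theorem integral_norm_sq_one_sub_le {M : ℂ → ℂ}
    (hM : DifferentiableOn ℂ M {z | 0 ≤ z.im}) (hb : ∀ z : ℂ, 0 ≤ z.im → ‖M z‖ ≤ 1) :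
    Integrable (fun x : ℝ => ‖1 - M x‖ ^ 2 * (1 + x ^ 2)⁻¹) ∧
    ∫ x : ℝ, ‖1 - M x‖ ^ 2 * (1 + x ^ 2)⁻¹ ≤ 2 * π * ‖1 - M Complex.I‖ := by
  have hcont : Continuous fun x : ℝ => M x :=
    hM.continuousOn.comp_continuous Complex.continuous_ofReal (fun x => by simp)
  have hbx : ∀ x : ℝ, ‖M x‖ ≤ 1 := fun x => hb x (by simp)
  have hint1 : Integrable (fun x : ℝ => ‖1 - M x‖ ^ 2 * (1 + x ^ 2)⁻¹) := by
    refine (integrable_inv_one_add_sq.const_mul 4).mono'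
      (Continuous.aestronglyMeasurable (((continuous_const.sub hcont).norm.pow 2).mul
        (Continuous.inv₀ (by fun_prop) fun x => by positivity)))
      (ae_of_all _ fun x => ?_)
    rw [norm_of_nonneg (by positivity)]
    have : ‖1 - M x‖ ≤ 2 := (norm_sub_le _ _).trans (by rw [norm_one]; linarith [hbx x])
    gcongr
    nlinarith [norm_nonneg (1 - M x)]
  refine ⟨hint1, ?_⟩
  have hP := integral_sub_div_one_add_sq_eq_zero hM hb
  have hintM : Integrable fun x : ℝ => (M x - M Complex.I) / (1 + x ^ 2) := by
    refine (integrable_inv_one_add_sq.const_mul 2).mono'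
      (Continuous.aestronglyMeasurable ?_) (ae_of_all _ fun x => ?_)
    · refine (hcont.sub continuous_const).div (by fun_prop) fun x => ?_
      rw [ofReal_one_add_sq]
      exact Complex.ofReal_ne_zero.2 (by positivity)
    · rw [ofReal_one_add_sq, norm_div, Complex.norm_of_nonneg (by positivity), div_eq_mul_inv]
      gcongr
      refine (norm_sub_le _ _).trans ?_
      linarith [hbx x, hb Complex.I (by simp)]
  have hre : ∫ x : ℝ, (M x - M Complex.I).re * (1 + x ^ 2)⁻¹ = 0 := by
    have := integral_re hintM
    rw [hP] at this
    simp only [RCLike.re_to_complex, Complex.zero_re] at this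
    rw [← this]
    congr 1 with x
    rw [ofReal_one_add_sq, Complex.div_ofReal_re, div_eq_mul_inv]
  have hintR : Integrable fun x : ℝ => (M x - M Complex.I).re * (1 + x ^ 2)⁻¹ := by
    refine hintM.re.congr (ae_of_all _ fun x => ?_)
    simp only [RCLike.re_to_complex]
    rw [ofReal_one_add_sq, Complex.div_ofReal_re, div_eq_mul_inv]
  calc ∫ x : ℝ, ‖1 - M x‖ ^ 2 * (1 + x ^ 2)⁻¹
      ≤ ∫ x : ℝ, (2 * (1 - M Complex.I).re * (1 + x ^ 2)⁻¹
          - 2 * ((M x - M Complex.I).re * (1 + x ^ 2)⁻¹)) := by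
        refine integral_mono hint1 ((integrable_inv_one_add_sq.const_mul _).sub
          (hintR.const_mul 2)) fun x => ?_
        have h : ‖1 - M x‖ ^ 2 ≤ 2 * (1 - M Complex.I).re - 2 * (M x - M Complex.I).re := by
          have h1 : ‖M x‖ ^ 2 ≤ 1 := pow_le_one₀ (norm_nonneg _) (hbx x)
          rw [← Complex.normSq_eq_norm_sq, Complex.normSq_apply] at h1 ⊢
          simp only [Complex.sub_re, Complex.one_re, Complex.sub_im, Complex.one_im]
          nlinarith
        have hpos : 0 ≤ (1 + x ^ 2)⁻¹ := by positivity
        simp only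
        nlinarith [mul_le_mul_of_nonneg_right h hpos]
    _ = 2 * (1 - M Complex.I).re * π := by
        rw [integral_sub (integrable_inv_one_add_sq.const_mul _) (hintR.const_mul 2),
          integral_const_mul, integral_const_mul, hre, integral_univ_inv_one_add_sq]
        ring
    _ ≤ 2 * π * ‖1 - M Complex.I‖ := by
        nlinarith [Complex.re_le_norm (1 - M Complex.I), pi_pos]

/-- Translation is continuous in `L¹`. -/
theorem tendsto_lintegral_enorm_translate_sub {f : ℝ → ℂ} (hf : Integrable f) :
    Tendsto (fun a : ℝ => ∫⁻ x, ‖f (x + a) - f x‖ₑ) (𝓝 0) (𝓝 0) := by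
  have hmp : ∀ a : ℝ, MeasurePreserving (ContinuousMap.mk (fun x : ℝ => x + a) (by fun_prop)) :=
    fun a => measurePreserving_add_right volume a
  have hcurry : Continuous fun a : ℝ =>
      (ContinuousMap.mk (fun x : ℝ => x + a) (by fun_prop) : C(ℝ, ℝ)) :=
    (ContinuousMap.curry (⟨fun p : ℝ × ℝ => p.2 + p.1, by fun_prop⟩ : C(ℝ × ℝ, ℝ))).continuous
  have hfL : MemLp f 1 := memLp_one_iff_integrable.2 hf
  have hcont := Continuous.compMeasurePreservingLp (f := fun _ : ℝ => hfL.toLp f) (μ := volume)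
    continuous_const hcurry hmp ENNReal.one_ne_top
  have ht := tendsto_iff_edist_tendsto_0.1 (hcont.tendsto 0)
  refine ht.congr fun a => ?_
  rw [Lp.edist_def, eLpNorm_one_eq_lintegral_enorm]
  refine lintegral_congr_ae ?_
  have hcoe := hfL.coeFn_toLp
  filter_upwards [Lp.coeFn_compMeasurePreserving (hfL.toLp f) (hmp a),
    Lp.coeFn_compMeasurePreserving (hfL.toLp f) (hmp 0),
    (hmp a).quasiMeasurePreserving.ae hcoe, hcoe] with x h1 h2 h3 h4
  simp only [Pi.sub_apply, h1, h2, Function.comp]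
  simp only [ContinuousMap.coe_mk, add_zero] at h3 ⊢
  rw [h3, h4]

/-- The difference between the Cauchy kernel at height one and the Hilbert kernel truncated
at distance one. -/
noncomputable def cauchySubHilbertKernel (s : ℝ) : ℂ :=
  ((s : ℂ) - Complex.I)⁻¹ - {s : ℝ | 1 < |s|}.indicator (fun s => (s : ℂ)⁻¹) s

theorem measurable_cauchySubHilbertKernel : Measurable cauchySubHilbertKernel := by
  unfold cauchySubHilbertKernel
  refine Measurable.sub (by fun_prop) (Measurable.indicator (by fun_prop) ?_)
  exact measurableSet_lt measurable_const (by fun_prop)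

theorem normSq_ofReal_sub_I (s : ℝ) : ‖(s : ℂ) - Complex.I‖ ^ 2 = 1 + s ^ 2 := by
  rw [← Complex.normSq_eq_norm_sq, Complex.normSq_apply]
  simp
  ring

theorem norm_cauchySubHilbertKernel_le (s : ℝ) :
    ‖cauchySubHilbertKernel s‖ ≤ 2 * (1 + s ^ 2)⁻¹ := by
  have hn := normSq_ofReal_sub_I s
  set n := ‖(s : ℂ) - Complex.I‖ with hndef
  have hn0 : 0 < n := by
    have : 0 < n ^ 2 := by rw [hn]; positivity
    exact (norm_nonneg _).lt_of_ne' (sq_pos_iff.1 this)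
  unfold cauchySubHilbertKernel
  rw [← hn, ← div_eq_mul_inv]
  by_cases hs : 1 < |s|
  · rw [indicator_of_mem (show s ∈ {s : ℝ | 1 < |s|} from hs)]
    have hs0 : (s : ℂ) ≠ 0 := by
      rintro h
      simp [Complex.ofReal_eq_zero.1 h] at hs
      linarith
    have hI : (s : ℂ) - Complex.I ≠ 0 := norm_pos_iff.1 hn0
    rw [inv_sub_inv hI hs0, norm_div, norm_mul, sub_sub_cancel, Complex.norm_I, Complex.norm_real,
      norm_eq_abs, ← hndef, div_le_div_iff₀ (by positivity) (by positivity)]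
    have : n ≤ 2 * |s| := by
      refine abs_le_of_sq_le_sq' ?_ (by positivity) |>.2
      rw [hn, mul_pow, sq_abs]
      nlinarith [sq_abs s]
    nlinarith
  · rw [indicator_of_notMem (show s ∉ {s : ℝ | 1 < |s|} from hs), sub_zero, norm_inv, ← hndef,
      inv_eq_one_div, div_le_div_iff₀ hn0 (by positivity)]
    have : n ≤ 2 := by
      refine abs_le_of_sq_le_sq' ?_ (by positivity) |>.2
      rw [hn]
      nlinarith [sq_abs s, abs_nonneg s]
    nlinarith

theorem integrable_cauchySubHilbertKernel : Integrable cauchySubHilbertKernel :=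
  (integrable_inv_one_add_sq.const_mul 2).mono' measurable_cauchySubHilbertKernel.aestronglyMeasurable
    (ae_of_all _ norm_cauchySubHilbertKernel_le)

theorem integral_cauchySubHilbertKernel : ∫ s, cauchySubHilbertKernel s = π * Complex.I := by
  have h1 : ∫ s, cauchySubHilbertKernel (-s) = ∫ s, cauchySubHilbertKernel s :=
    integral_neg_eq_self _ _
  have h2 : ∫ s, (cauchySubHilbertKernel s + cauchySubHilbertKernel (-s)) =
      ∫ s : ℝ, ((1 + s ^ 2)⁻¹ : ℝ) * (2 * Complex.I) := by
    congr 1 with s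
    have hI : ∀ s : ℝ, (s : ℂ) - Complex.I ≠ 0 := fun s h => by
      simpa using congrArg Complex.im h
    have hmem : (-s ∈ {s : ℝ | 1 < |s|}) = (s ∈ {s : ℝ | 1 < |s|}) := by simp
    have hind : {s : ℝ | 1 < |s|}.indicator (fun s => (s : ℂ)⁻¹) (-s)
        = - {s : ℝ | 1 < |s|}.indicator (fun s => (s : ℂ)⁻¹) s := by
      simp only [indicator_apply, hmem]
      split_ifs <;> simp [inv_neg]
    have hpos : (1 + (s : ℂ) ^ 2) ≠ 0 := by
      have h : (1 + s ^ 2 : ℝ) ≠ 0 := by positivity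
      exact_mod_cast h
    unfold cauchySubHilbertKernel
    rw [hind]
    have h3 := hI s
    have h4 := hI (-s)
    push_cast at h4 ⊢
    field_simp
    linear_combination -(2 * Complex.I) * Complex.I_sq
  rw [integral_add integrable_cauchySubHilbertKernel integrable_cauchySubHilbertKernel.comp_neg, h1,
    integral_mul_const, integral_complex_ofReal, integral_univ_inv_one_add_sq] at h2
  linear_combination h2 / 2

/-- The Cauchy transform of a function on the real line. -/
noncomputable def cauchyTransform (f : ℝ → ℂ) (z : ℂ) : ℂ := ∫ t : ℝ, f t / (t - z)

theorem im_le_norm_ofReal_sub (z : ℂ) (t : ℝ) : z.im ≤ ‖(t : ℂ) - z‖ := by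
  have := Complex.abs_im_le_norm ((t : ℂ) - z)
  simp at this
  exact (le_abs_self _).trans this

theorem norm_div_ofReal_sub_le (f : ℝ → ℂ) {z : ℂ} (hz : 0 < z.im) (t : ℝ) :
    ‖f t / (t - z)‖ ≤ ‖f t‖ / z.im := by
  rw [norm_div]
  gcongr
  exact im_le_norm_ofReal_sub z t

theorem integrable_div_ofReal_sub {f : ℝ → ℂ} (hf : Integrable f) {z : ℂ} (hz : 0 < z.im) :
    Integrable fun t : ℝ => f t / (t - z) :=
  (hf.norm.div_const z.im).mono'
    (hf.aestronglyMeasurable.mul (by fun_prop : Measurable fun t : ℝ =>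
      ((t : ℂ) - z)⁻¹).aestronglyMeasurable)
    (ae_of_all _ (norm_div_ofReal_sub_le f hz))

theorem norm_cauchyTransform_le {f : ℝ → ℂ} (hf : Integrable f) {z : ℂ} (hz : 0 < z.im) :
    ‖cauchyTransform f z‖ ≤ (∫ t, ‖f t‖) / z.im := by
  rw [← integral_div]
  exact norm_integral_le_of_norm_le (hf.norm.div_const z.im)
    (ae_of_all _ (norm_div_ofReal_sub_le f hz))

theorem differentiableAt_cauchyTransform {f : ℝ → ℂ} (hf : Integrable f) {z : ℂ}
    (hz : 0 < z.im) : DifferentiableAt ℂ (cauchyTransform f) z := by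
  have hs : {w : ℂ | z.im / 2 < w.im} ∈ 𝓝 z :=
    (Complex.continuous_im.isOpen_preimage (Ioi (z.im / 2)) isOpen_Ioi).mem_nhds
      (by simpa using hz)
  have hmeas : ∀ (w : ℂ) (k : ℕ), AEStronglyMeasurable (fun t : ℝ => f t / ((t : ℂ) - w) ^ k) :=
    fun w k => hf.aestronglyMeasurable.mul (by fun_prop : Measurable fun t : ℝ =>
      (((t : ℂ) - w) ^ k)⁻¹).aestronglyMeasurable
  refine (hasDerivAt_integral_of_dominated_loc_of_deriv_le (μ := volume)
    (F := fun w (t : ℝ) => f t / (t - w)) (F' := fun w (t : ℝ) => f t / ((t : ℂ) - w) ^ 2)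
    (bound := fun t => ‖f t‖ / (z.im / 2) ^ 2) hs
    (Eventually.of_forall fun w => by simpa using hmeas w 1)
    (integrable_div_ofReal_sub hf hz) (hmeas z 2) (ae_of_all _ fun t w hw => ?_)
    (hf.norm.div_const _) (ae_of_all _ fun t w hw => ?_)).2.differentiableAt
  · have hw' : z.im / 2 ≤ ‖(t : ℂ) - w‖ := (le_of_lt hw).trans (im_le_norm_ofReal_sub w t)
    rw [norm_div, norm_pow]
    gcongr
  · have hne : (t : ℂ) - w ≠ 0 := norm_pos_iff.1
      ((half_pos hz).trans_le ((le_of_lt hw).trans (im_le_norm_ofReal_sub w t)))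
    have h := (((hasDerivAt_id w).const_sub (t : ℂ)).inv hne).const_mul (f t)
    simp only [id, neg_neg] at h
    exact h.congr_deriv (by ring)

theorem integrableOn_div_ofReal_sub {f : ℝ → ℂ} (hf : Integrable f) (x : ℝ) {y : ℝ} (hy : 0 < y) :
    IntegrableOn (fun t : ℝ => f t / ((t - x : ℝ) : ℂ)) {t : ℝ | y < |t - x|} := by
  have hset : MeasurableSet {t : ℝ | y < |t - x|} :=
    measurableSet_lt measurable_const (by fun_prop)
  refine (hf.norm.div_const y).integrableOn.mono'
    (hf.aestronglyMeasurable.mul (by fun_prop : Measurable fun t : ℝ =>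
      ((t - x : ℝ) : ℂ)⁻¹).aestronglyMeasurable).restrict
    ((ae_restrict_iff' hset).2 (ae_of_all _ fun t ht => ?_))
  rw [norm_div, Complex.norm_real, norm_eq_abs]
  gcongr
  exact le_of_lt ht

theorem cauchyTransform_sub_truncated_hilbert {f : ℝ → ℂ} (hf : Integrable f) (x : ℝ) {y : ℝ}
    (hy : 0 < y) :
    cauchyTransform f (x + y * Complex.I) - ∫ t in {t : ℝ | y < |t - x|}, f t / ((t - x : ℝ) : ℂ) =
      ∫ s, f (x + y * s) * cauchySubHilbertKernel s := by
  have hset : MeasurableSet {t : ℝ | y < |t - x|} :=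
    measurableSet_lt measurable_const (by fun_prop)
  have hz : 0 < ((x : ℂ) + y * Complex.I).im := by simpa using hy
  rw [cauchyTransform, ← integral_indicator hset, ← integral_sub (integrable_div_ofReal_sub hf hz)
    ((integrable_indicator_iff hset).2 (integrableOn_div_ofReal_sub hf x hy))]
  set h : ℝ → ℂ := fun t => f t / (t - (x + y * Complex.I)) -
    {t : ℝ | y < |t - x|}.indicator (fun t : ℝ => f t / ((t - x : ℝ) : ℂ)) t with hh
  have hsub : ∫ s, h (x + y * s) = y⁻¹ • ∫ t, h t := by
    rw [Measure.integral_comp_mul_left (fun s => h (x + s)), integral_add_left_eq_self,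
      abs_of_pos (inv_pos.2 hy)]
  have hk : ∀ s, f (x + y * s) * cauchySubHilbertKernel s = y • h (x + y * s) := by
    intro s
    have hy' : (y : ℂ) ≠ 0 := Complex.ofReal_ne_zero.2 hy.ne'
    have hmem : (x + y * s ∈ {t : ℝ | y < |t - x|}) = (s ∈ {s : ℝ | 1 < |s|}) := by
      simp [abs_mul, abs_of_pos hy, hy]
    have hind : {t : ℝ | y < |t - x|}.indicator (fun t : ℝ => f t / ((t - x : ℝ) : ℂ)) (x + y * s)
        = f (x + y * s) / y * {s : ℝ | 1 < |s|}.indicator (fun s => (s : ℂ)⁻¹) s := by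
      simp only [indicator_apply, hmem]
      split_ifs
      · push_cast
        rw [add_sub_cancel_left, div_mul_eq_div_div, div_eq_mul_inv _ (s : ℂ)]
      · simp
    have hden : ((x + y * s : ℝ) : ℂ) - (x + y * Complex.I) = y * (s - Complex.I) := by
      push_cast
      ring
    simp only [hh, hind, hden, cauchySubHilbertKernel, Complex.real_smul]
    rw [mul_sub, mul_sub, ← mul_assoc, mul_div_cancel₀ _ hy', div_mul_eq_div_div,
      div_eq_mul_inv _ ((s : ℂ) - Complex.I), ← mul_assoc, mul_div_cancel₀ _ hy']
  simp_rw [hk]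
  rw [integral_smul, hsub, smul_inv_smul₀ hy.ne']

theorem tendsto_lintegral_cauchyTransform_sub {f : ℝ → ℂ} (hf : Integrable f) (hm : Measurable f) :
    Tendsto (fun y : ℝ => ∫⁻ x, ‖∫ s, (f (x + y * s) - f x) * cauchySubHilbertKernel s‖ₑ)
      (𝓝 0) (𝓝 0) := by
  have hK := measurable_cauchySubHilbertKernel
  have hjoint : ∀ y : ℝ, Measurable fun p : ℝ × ℝ => ‖f (p.1 + y * p.2) - f p.1‖ₑ := by
    intro y
    fun_prop
  have hω : ∀ a : ℝ, ∫⁻ x, ‖f (x + a) - f x‖ₑ ≤ 2 * ∫⁻ x, ‖f x‖ₑ := by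
    intro a
    calc ∫⁻ x, ‖f (x + a) - f x‖ₑ ≤ ∫⁻ x, (‖f (x + a)‖ₑ + ‖f x‖ₑ) :=
          lintegral_mono fun x => enorm_sub_le
      _ = 2 * ∫⁻ x, ‖f x‖ₑ := by
          rw [lintegral_add_right _ hm.enorm, lintegral_add_right_eq_self (fun x => ‖f x‖ₑ), two_mul]
  have hle : ∀ y : ℝ, ∫⁻ x, ‖∫ s, (f (x + y * s) - f x) * cauchySubHilbertKernel s‖ₑ ≤
      ∫⁻ s, (∫⁻ x, ‖f (x + y * s) - f x‖ₑ) * ‖cauchySubHilbertKernel s‖ₑ := by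
    intro y
    calc _ ≤ ∫⁻ x, ∫⁻ s, ‖f (x + y * s) - f x‖ₑ * ‖cauchySubHilbertKernel s‖ₑ := by
          refine lintegral_mono fun x => (enorm_integral_le_lintegral_enorm _).trans_eq ?_
          simp_rw [enorm_mul]
      _ = ∫⁻ s, ∫⁻ x, ‖f (x + y * s) - f x‖ₑ * ‖cauchySubHilbertKernel s‖ₑ :=
          lintegral_lintegral_swap
            ((hjoint y).mul (hK.comp measurable_snd).enorm).aemeasurable
      _ = _ := by
          refine lintegral_congr fun s => lintegral_mul_const _ ?_
          exact (hjoint y).comp measurable_prodMk_right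
  refine tendsto_of_tendsto_of_tendsto_of_le_of_le tendsto_const_nhds ?_ (fun _ => zero_le) hle
  have hlim : Tendsto (fun y : ℝ =>
      ∫⁻ s, (∫⁻ x, ‖f (x + y * s) - f x‖ₑ) * ‖cauchySubHilbertKernel s‖ₑ) (𝓝 0)
      (𝓝 (∫⁻ _ : ℝ, 0)) := by
    refine tendsto_lintegral_filter_of_dominated_convergence
      (fun s => (2 * ∫⁻ x, ‖f x‖ₑ) * ‖cauchySubHilbertKernel s‖ₑ)
      (Eventually.of_forall fun y => (hjoint y).lintegral_prod_left'.mul hK.enorm)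
      (Eventually.of_forall fun y => ae_of_all _ fun s => mul_le_mul_left (hω _) _) ?_
      (ae_of_all _ fun s => ?_)
    · rw [lintegral_const_mul _ hK.enorm]
      exact ENNReal.mul_ne_top (ENNReal.mul_ne_top (by simp) hf.2.ne)
        integrable_cauchySubHilbertKernel.2.ne
    · have h0 : Tendsto (fun y : ℝ => y * s) (𝓝 0) (𝓝 0) := by
        simpa using (tendsto_id (x := 𝓝 (0 : ℝ))).mul_const s
      simpa using ENNReal.Tendsto.mul_const
        ((tendsto_lintegral_enorm_translate_sub hf).comp h0) (Or.inr enorm_ne_top)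
  simpa using hlim

/-- Along a suitable sequence of heights the Cauchy transform differs from the truncated Hilbert
transform by a quantity which tends to `π i f` almost everywhere. -/
theorem exists_seq_tendsto_cauchyTransform_sub {f : ℝ → ℂ} (hf : Integrable f) :
    ∃ y : ℕ → ℝ, (∀ n, 0 < y n) ∧ Tendsto y atTop (𝓝 0) ∧
      ∀ᵐ x : ℝ, Tendsto (fun n => cauchyTransform f (x + y n * Complex.I) -
        ∫ t in {t : ℝ | y n < |t - x|}, f t / ((t - x : ℝ) : ℂ)) atTop
        (𝓝 (π * Complex.I * f x)) := by
  wlog hm : Measurable f generalizing f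
  · obtain ⟨f', hf'm, hff'⟩ := hf.aestronglyMeasurable
    obtain ⟨y, hy0, hy, hlim⟩ := this (hf.congr hff') hf'm.measurable
    refine ⟨y, hy0, hy, ?_⟩
    filter_upwards [hlim, hff'] with x hx hxe
    rw [hxe]
    refine hx.congr fun n => ?_
    have h1 : cauchyTransform f' (x + y n * Complex.I) = cauchyTransform f (x + y n * Complex.I) :=
      integral_congr_ae (hff'.mono fun t ht => by simp only [ht])
    have h2 : ∫ t in {t : ℝ | y n < |t - x|}, f' t / ((t - x : ℝ) : ℂ) =
        ∫ t in {t : ℝ | y n < |t - x|}, f t / ((t - x : ℝ) : ℂ) :=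
      integral_congr_ae (ae_restrict_of_ae (hff'.mono fun t ht => by simp only [ht]))
    rw [h1, h2]
  have hK := measurable_cauchySubHilbertKernel
  have hy0 : ∀ n : ℕ, (0 : ℝ) < 1 / ((n : ℝ) + 1) := fun n => Nat.one_div_pos_of_nat
  have hmeas : ∀ n : ℕ, AEStronglyMeasurable (fun x : ℝ =>
      ∫ s, (f (x + 1 / ((n : ℝ) + 1) * s) - f x) * cauchySubHilbertKernel s) := by
    intro n
    have : Measurable fun p : ℝ × ℝ =>
        (f (p.1 + 1 / ((n : ℝ) + 1) * p.2) - f p.1) * cauchySubHilbertKernel p.2 := by fun_prop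
    exact this.stronglyMeasurable.integral_prod_right.aestronglyMeasurable
  have hL1 := (tendsto_lintegral_cauchyTransform_sub hf hm).comp
    (tendsto_one_div_add_atTop_nhds_zero_nat (𝕜 := ℝ))
  have hmeasure : TendstoInMeasure volume (fun (n : ℕ) (x : ℝ) =>
      ∫ s, (f (x + 1 / ((n : ℝ) + 1) * s) - f x) * cauchySubHilbertKernel s) atTop 0 := by
    refine tendstoInMeasure_of_tendsto_eLpNorm one_ne_zero hmeas aestronglyMeasurable_zero ?_
    refine hL1.congr fun n => ?_
    simp [eLpNorm_one_eq_lintegral_enorm]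
  obtain ⟨ns, hns, hae⟩ := hmeasure.exists_seq_tendsto_ae
  refine ⟨fun n => 1 / ((ns n : ℝ) + 1), fun n => hy0 _,
    tendsto_one_div_add_atTop_nhds_zero_nat.comp hns.tendsto_atTop, ?_⟩
  filter_upwards [hae] with x hx
  have hx' := hx.add_const (π * Complex.I * f x)
  simp only [Pi.zero_apply, zero_add] at hx'
  refine hx'.congr fun n => ?_
  rw [cauchyTransform_sub_truncated_hilbert hf x (hy0 (ns n))]
  have hi : Integrable fun s => f x * cauchySubHilbertKernel s :=
    integrable_cauchySubHilbertKernel.const_mul _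
  have hbdd : ∀ s, ‖cauchySubHilbertKernel s‖ ≤ 2 := fun s =>
    (norm_cauchySubHilbertKernel_le s).trans (by
      have : (1 + s ^ 2)⁻¹ ≤ 1 := inv_le_one_of_one_le₀ (by nlinarith [sq_nonneg s])
      linarith)
  have hi' : Integrable fun s => f (x + 1 / ((ns n : ℝ) + 1) * s) * cauchySubHilbertKernel s :=
    Integrable.mul_bdd (c := 2) ((hf.comp_add_left x).comp_mul_left' (hy0 (ns n)).ne')
      hK.aestronglyMeasurable (ae_of_all _ hbdd)
  simp_rw [sub_mul]
  rw [integral_sub hi' hi, integral_const_mul, integral_cauchySubHilbertKernel]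
  ring

theorem norm_sq_add_sq_le_norm_add_mul_I_sq {z : ℂ} (hz : 0 ≤ z.im) {r : ℝ} (hr : 0 ≤ r) :
    ‖z‖ ^ 2 + r ^ 2 ≤ ‖z + r * Complex.I‖ ^ 2 := by
  rw [← Complex.normSq_eq_norm_sq, ← Complex.normSq_eq_norm_sq, Complex.normSq_apply,
    Complex.normSq_apply]
  simp
  nlinarith [mul_nonneg hz hr]

/-- A holomorphic weight on the upper half-plane, of modulus at most one and decaying
quadratically, which tends to `1` as `r → ∞`. -/
noncomputable def halfPlaneWeight (r : ℝ) (z : ℂ) : ℂ := (r * Complex.I / (z + r * Complex.I)) ^ 2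

theorem norm_halfPlaneWeight_le {z : ℂ} (hz : 0 ≤ z.im) {r : ℝ} (hr : 0 < r) :
    ‖halfPlaneWeight r z‖ ≤ r ^ 2 / (‖z‖ ^ 2 + r ^ 2) := by
  rw [halfPlaneWeight, norm_pow, norm_div, div_pow, norm_mul, Complex.norm_I, mul_one,
    Complex.norm_of_nonneg hr.le]
  gcongr
  exact norm_sq_add_sq_le_norm_add_mul_I_sq hz hr.le

theorem norm_halfPlaneWeight_le_one {z : ℂ} (hz : 0 ≤ z.im) {r : ℝ} (hr : 0 < r) :
    ‖halfPlaneWeight r z‖ ≤ 1 :=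
  (norm_halfPlaneWeight_le hz hr).trans
    (div_le_one_of_le₀ (by nlinarith [sq_nonneg ‖z‖]) (by positivity))

theorem differentiableOn_halfPlaneWeight {r : ℝ} (hr : 0 < r) :
    DifferentiableOn ℂ (halfPlaneWeight r) {z | 0 ≤ z.im} := by
  unfold halfPlaneWeight
  refine DifferentiableOn.pow (DifferentiableOn.div (by fun_prop) (by fun_prop) ?_) 2
  intro z hz h
  have h' := congrArg Complex.im h
  simp at h'
  have hz' : 0 ≤ z.im := hz
  linarith

theorem tendsto_halfPlaneWeight (z : ℂ) :
    Tendsto (fun n : ℕ => halfPlaneWeight ((n : ℝ) + 1) z) atTop (𝓝 1) := by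
  have h0 : Tendsto (fun n : ℕ => z / Complex.I * ((1 / ((n : ℝ) + 1) : ℝ) : ℂ) + 1) atTop (𝓝 1) := by
    have h := (Complex.continuous_ofReal.tendsto 0).comp
      (tendsto_one_div_add_atTop_nhds_zero_nat (𝕜 := ℝ))
    simpa using (h.const_mul (z / Complex.I)).add_const 1
  have h1 := (h0.inv₀ one_ne_zero).pow 2
  simp only [inv_one, one_pow] at h1
  refine h1.congr fun n => ?_
  have hn : (((n : ℝ) + 1 : ℝ) : ℂ) ≠ 0 := Complex.ofReal_ne_zero.2 (by positivity)
  have heq : z / Complex.I * ((1 / ((n : ℝ) + 1) : ℝ) : ℂ) + 1 =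
      (z + ((n : ℝ) + 1 : ℝ) * Complex.I) / (((n : ℝ) + 1 : ℝ) * Complex.I) := by
    rw [Complex.ofReal_div, add_div, div_self (mul_ne_zero hn Complex.I_ne_zero)]
    simp only [Complex.ofReal_one]
    field_simp
  rw [halfPlaneWeight, heq, inv_div]

theorem differentiableOn_comp_add_mul_I {F : ℂ → ℂ} (hF : DifferentiableOn ℂ F {z | 0 < z.im})
    {y : ℝ} (hy : 0 < y) :
    DifferentiableOn ℂ (fun z => F (z + y * Complex.I)) {z | 0 ≤ z.im} :=
  hF.comp (by fun_prop) fun z (hz : 0 ≤ z.im) => by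
    simp
    linarith

theorem continuous_comp_add_mul_I {F : ℂ → ℂ} (hF : DifferentiableOn ℂ F {z | 0 < z.im})
    {y : ℝ} (hy : 0 < y) : Continuous fun x : ℝ => F (x + y * Complex.I) :=
  (differentiableOn_comp_add_mul_I hF hy).continuousOn.comp_continuous Complex.continuous_ofReal
    fun x => by simp

theorem exists_seq_tendsto_ae_of_integral_tendsto {u : ℕ → ℝ → ℝ} (hu : ∀ k, Integrable (u k))
    (hu0 : ∀ k x, 0 ≤ u k x) (hlim : Tendsto (fun k => ∫ x, u k x) atTop (𝓝 0)) :
    ∃ ks : ℕ → ℕ, StrictMono ks ∧ ∀ᵐ x, Tendsto (fun k => u (ks k) x) atTop (𝓝 0) := by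
  have hmeasure : TendstoInMeasure volume u atTop 0 := by
    refine tendstoInMeasure_of_tendsto_eLpNorm one_ne_zero
      (fun k => (hu k).aestronglyMeasurable) aestronglyMeasurable_zero ?_
    have h := ENNReal.tendsto_ofReal hlim
    rw [ENNReal.ofReal_zero] at h
    refine h.congr fun k => ?_
    rw [sub_zero, eLpNorm_one_eq_lintegral_enorm,
      ← ofReal_integral_norm_eq_lintegral_enorm (hu k)]
    simp_rw [norm_of_nonneg (hu0 k _)]
  exact hmeasure.exists_seq_tendsto_ae

/-- If a holomorphic function `F` on the upper half-plane can be damped by holomorphic multipliers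
`M k` with values in the unit disc and tending to `1`, in such a way that each `F * M k` is
bounded, then an integrable boundary function of `F` has integral zero. -/
theorem integral_boundary_eq_zero {F : ℂ → ℂ} {M : ℕ → ℂ → ℂ} {A b : ℕ → ℝ} {y : ℕ → ℝ}
    {Fb : ℝ → ℂ} (hF : DifferentiableOn ℂ F {z | 0 < z.im})
    (hM : ∀ k, DifferentiableOn ℂ (M k) {z | 0 < z.im})
    (hM1 : ∀ k z, 0 < z.im → ‖M k z‖ ≤ 1) (hFM : ∀ k z, 0 < z.im → ‖F z * M k z‖ ≤ A k)
    (hb : Tendsto b atTop (𝓝 0)) (hMb : ∀ k z, 1 ≤ z.im → ‖1 - M k z‖ ≤ b k)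
    (hy : ∀ n, 0 < y n) (hFb : Integrable Fb)
    (hlim : ∀ᵐ x : ℝ, Tendsto (fun n => F (x + y n * Complex.I)) atTop (𝓝 (Fb x))) :
    ∫ x, Fb x = 0 := by
  have him : ∀ (z : ℂ) (n : ℕ), 0 ≤ z.im → 0 < (z + y n * Complex.I).im := fun z n hz => by
    simp
    linarith [hy n]
  have him' : ∀ (x : ℝ) (n : ℕ), 0 < ((x : ℂ) + y n * Complex.I).im := fun x n =>
    him x n (by simp)
  have hr : ∀ k : ℕ, (0 : ℝ) < (k : ℝ) + 1 := fun k => by positivity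
  have hWc : ∀ k : ℕ, Continuous fun x : ℝ => halfPlaneWeight ((k : ℝ) + 1) x := fun k =>
    (differentiableOn_halfPlaneWeight (hr k)).continuousOn.comp_continuous
      Complex.continuous_ofReal fun x => by simp
  have hW1 : ∀ (k : ℕ) (x : ℝ), ‖halfPlaneWeight ((k : ℝ) + 1) x‖ ≤ 1 := fun k x =>
    norm_halfPlaneWeight_le_one (by simp) (hr k)
  have hA : ∀ k, 0 ≤ A k := fun k => (norm_nonneg _).trans (hFM k Complex.I (by simp))
  have hFMW : ∀ (k n : ℕ) (x : ℝ), ‖F (x + y n * Complex.I) * M k (x + y n * Complex.I) *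
      halfPlaneWeight ((k : ℝ) + 1) x‖ ≤ A k * ((k : ℝ) + 1) ^ 2 * (1 + x ^ 2)⁻¹ := by
    intro k n x
    rw [norm_mul, mul_assoc (A k)]
    refine mul_le_mul (hFM k _ (him' x n)) ?_ (norm_nonneg _) (hA k)
    refine (norm_halfPlaneWeight_le (by simp) (hr k)).trans ?_
    rw [div_eq_mul_inv, Complex.norm_real, norm_eq_abs, sq_abs]
    gcongr ?_ * (?_)⁻¹
    nlinarith [(Nat.cast_nonneg k : (0 : ℝ) ≤ k)]
  have hFMWi : ∀ k n : ℕ, Integrable fun x : ℝ => F (x + y n * Complex.I) *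
      M k (x + y n * Complex.I) * halfPlaneWeight ((k : ℝ) + 1) x := fun k n =>
    (integrable_inv_one_add_sq.const_mul _).mono'
      (((continuous_comp_add_mul_I hF (hy n)).mul (continuous_comp_add_mul_I (hM k) (hy n))).mul
        (hWc k)).aestronglyMeasurable (ae_of_all _ (hFMW k n))
  have hcauchy : ∀ k n : ℕ, ∫ x : ℝ, F (x + y n * Complex.I) * M k (x + y n * Complex.I) *
      halfPlaneWeight ((k : ℝ) + 1) x = 0 := by
    intro k n
    refine integral_eq_zero_of_differentiableOn_halfPlane
      (G := fun z => F (z + y n * Complex.I) * M k (z + y n * Complex.I) *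
        halfPlaneWeight ((k : ℝ) + 1) z) (C := A k * ((k : ℝ) + 1) ^ 2) (r := 1)
      (((differentiableOn_comp_add_mul_I hF (hy n)).mul
        (differentiableOn_comp_add_mul_I (hM k) (hy n))).mul
        (differentiableOn_halfPlaneWeight (hr k))) (fun z hz hz1 => ?_) (hFMWi k n)
    rw [norm_mul, mul_div_assoc]
    refine mul_le_mul (hFM k _ (him z n hz)) ?_ (norm_nonneg _) (hA k)
    refine (norm_halfPlaneWeight_le hz (hr k)).trans ?_
    gcongr
    nlinarith [sq_nonneg ((k : ℝ) + 1)]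
  have hFbi : ∀ k n : ℕ, Integrable fun x : ℝ => Fb x *
      (M k (x + y n * Complex.I) * halfPlaneWeight ((k : ℝ) + 1) x) := fun k n =>
    hFb.mul_bdd (c := 1)
      ((continuous_comp_add_mul_I (hM k) (hy n)).mul (hWc k)).aestronglyMeasurable
      (ae_of_all _ fun x => by
        rw [norm_mul]
        exact mul_le_one₀ (hM1 k _ (him' x n)) (norm_nonneg _) (hW1 k x))
  have hstep : ∀ k : ℕ, Tendsto (fun n => ∫ x : ℝ, Fb x *
      (M k (x + y n * Complex.I) * halfPlaneWeight ((k : ℝ) + 1) x)) atTop (𝓝 0) := by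
    intro k
    have hdct : Tendsto (fun n => ∫ x : ℝ, (Fb x *
        (M k (x + y n * Complex.I) * halfPlaneWeight ((k : ℝ) + 1) x) -
        F (x + y n * Complex.I) * M k (x + y n * Complex.I) * halfPlaneWeight ((k : ℝ) + 1) x))
        atTop (𝓝 (∫ _ : ℝ, (0 : ℂ))) := by
      refine tendsto_integral_of_dominated_convergence
        (fun x => ‖Fb x‖ + A k * ((k : ℝ) + 1) ^ 2 * (1 + x ^ 2)⁻¹)
        (fun n => ((hFbi k n).sub (hFMWi k n)).aestronglyMeasurable)
        (hFb.norm.add (integrable_inv_one_add_sq.const_mul _)) (fun n => ae_of_all _ fun x => ?_) ?_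
      · refine (norm_sub_le _ _).trans (add_le_add ?_ (hFMW k n x))
        rw [norm_mul, norm_mul]
        exact mul_le_of_le_one_right (norm_nonneg _)
          (mul_le_one₀ (hM1 k _ (him' x n)) (norm_nonneg _) (hW1 k x))
      · filter_upwards [hlim] with x hx
        have hx' := (tendsto_const_nhds (x := Fb x)).sub hx
        rw [sub_self] at hx'
        refine squeeze_zero_norm (fun n => ?_) (by simpa using hx'.norm)
        rw [mul_assoc, ← sub_mul, norm_mul, norm_mul]
        exact mul_le_of_le_one_right (norm_nonneg _)
          (mul_le_one₀ (hM1 k _ (him' x n)) (norm_nonneg _) (hW1 k x))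
    rw [integral_zero] at hdct
    refine hdct.congr fun n => ?_
    rw [integral_sub (hFbi k n) (hFMWi k n), hcauchy, sub_zero]
  have hchoose : ∀ k : ℕ, ∃ n, ‖∫ x : ℝ, Fb x *
      (M k (x + y n * Complex.I) * halfPlaneWeight ((k : ℝ) + 1) x)‖ < 1 / ((k : ℝ) + 1) := fun k =>
    (((hstep k).norm.eventually_lt_const (by rw [norm_zero]; positivity))).exists
  choose N hN using hchoose
  have hmean := fun k : ℕ => integral_norm_sq_one_sub_le
    (M := fun z => M k (z + y (N k) * Complex.I))
    (differentiableOn_comp_add_mul_I (hM k) (hy _)) (fun z hz => hM1 k _ (him z _ hz))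
  obtain ⟨ks, hks, hae⟩ := exists_seq_tendsto_ae_of_integral_tendsto (fun k => (hmean k).1)
    (fun k x => by positivity) (squeeze_zero (fun k => integral_nonneg fun x => by positivity)
      (fun k => (hmean k).2.trans (mul_le_mul_of_nonneg_left
        (hMb k _ (by simpa using (hy (N k)).le)) (by positivity)))
      (by simpa using hb.const_mul (2 * π)))
  have hzero : Tendsto (fun k => ∫ x : ℝ, Fb x * (M (ks k) (x + y (N (ks k)) * Complex.I) *
      halfPlaneWeight (((ks k : ℕ) : ℝ) + 1) x)) atTop (𝓝 0) :=
    squeeze_zero_norm (fun k => (hN (ks k)).le)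
      (tendsto_one_div_add_atTop_nhds_zero_nat.comp hks.tendsto_atTop)
  refine tendsto_nhds_unique ?_ hzero
  refine tendsto_integral_of_dominated_convergence (fun x => ‖Fb x‖)
    (fun k => (hFbi (ks k) (N (ks k))).aestronglyMeasurable) hFb.norm
    (fun k => ae_of_all _ fun x => ?_) ?_
  · rw [norm_mul, norm_mul]
    exact mul_le_of_le_one_right (norm_nonneg _)
      (mul_le_one₀ (hM1 _ _ (him' x _)) (norm_nonneg _) (hW1 _ x))
  · filter_upwards [hae] with x hx
    have h1 : Tendsto (fun k => ‖1 - M (ks k) (x + y (N (ks k)) * Complex.I)‖ ^ 2) atTop (𝓝 0) := by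
      have := hx.mul_const (1 + x ^ 2)
      rw [zero_mul] at this
      refine this.congr fun k => ?_
      have hx0 : 1 + x ^ 2 ≠ 0 := by positivity
      rw [mul_assoc, inv_mul_cancel₀ hx0, mul_one]
    have h2 : Tendsto (fun k => 1 - M (ks k) (x + y (N (ks k)) * Complex.I)) atTop (𝓝 0) := by
      rw [tendsto_zero_iff_norm_tendsto_zero]
      have := h1.sqrt
      simpa [sqrt_sq (norm_nonneg _)] using this
    have h3 : Tendsto (fun k => M (ks k) (x + y (N (ks k)) * Complex.I)) atTop (𝓝 1) := by
      simpa using h2.const_sub 1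
    have h4 := (h3.mul ((tendsto_halfPlaneWeight x).comp hks.tendsto_atTop)).const_mul (Fb x)
    simpa using h4

theorem re_neg_I_mul_cauchyTransform_nonneg {p : ℝ → ℝ} (hp : Integrable p) (hp0 : ∀ t, 0 ≤ p t)
    {z : ℂ} (hz : 0 < z.im) : 0 ≤ (-Complex.I * cauchyTransform (fun t => p t) z).re := by
  have hi := (integrable_div_ofReal_sub hp.ofReal hz).const_mul (-Complex.I)
  rw [cauchyTransform, ← integral_const_mul]
  have h := integral_re hi
  simp only [RCLike.re_to_complex] at h
  refine le_of_le_of_eq (integral_nonneg fun t => ?_) h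
  have ht : (-Complex.I * (p t / ((t : ℂ) - z))).re = p t * z.im / Complex.normSq (t - z) := by
    rw [mul_div_assoc', Complex.div_re]
    simp
  exact le_of_le_of_eq (div_nonneg (mul_nonneg (hp0 t) hz.le) (Complex.normSq_nonneg _)) ht.symm

/-- A holomorphic multiplier which damps the Cauchy transform of a nonnegative function. -/
noncomputable def cauchyDamping (p : ℝ → ℝ) (ε : ℝ) (z : ℂ) : ℂ :=
  (1 + ε * (-Complex.I * cauchyTransform (fun t => p t) z))⁻¹

section Damping

variable {p : ℝ → ℝ} {ε : ℝ} {z : ℂ}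

theorem one_le_norm_one_add_mul {w : ℂ} (hw : 0 ≤ w.re) (hε : 0 < ε) : 1 ≤ ‖1 + ε * w‖ := by
  refine le_trans ?_ (Complex.re_le_norm _)
  simp
  positivity

theorem mul_norm_le_norm_one_add_mul {w : ℂ} (hw : 0 ≤ w.re) (hε : 0 < ε) :
    ε * ‖w‖ ≤ ‖1 + ε * w‖ := by
  refine abs_le_of_sq_le_sq' ?_ (norm_nonneg _) |>.2
  rw [mul_pow, ← Complex.normSq_eq_norm_sq, ← Complex.normSq_eq_norm_sq, Complex.normSq_apply,
    Complex.normSq_apply]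
  simp
  nlinarith [mul_nonneg hε.le hw]

theorem norm_cauchyDamping_le_one (hp : Integrable p) (hp0 : ∀ t, 0 ≤ p t) (hε : 0 < ε)
    (hz : 0 < z.im) : ‖cauchyDamping p ε z‖ ≤ 1 := by
  rw [cauchyDamping, norm_inv]
  exact inv_le_one_of_one_le₀
    (one_le_norm_one_add_mul (re_neg_I_mul_cauchyTransform_nonneg hp hp0 hz) hε)

theorem norm_cauchyTransform_mul_cauchyDamping_le (hp : Integrable p) (hp0 : ∀ t, 0 ≤ p t)
    (hε : 0 < ε) (hz : 0 < z.im) :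
    ‖cauchyTransform (fun t => p t) z * cauchyDamping p ε z‖ ≤ 1 / ε := by
  have hre := re_neg_I_mul_cauchyTransform_nonneg hp hp0 hz
  have h := mul_norm_le_norm_one_add_mul hre hε
  rw [norm_mul (-Complex.I), norm_neg, Complex.norm_I, one_mul] at h
  rw [cauchyDamping, norm_mul, norm_inv, ← div_eq_mul_inv,
    div_le_div_iff₀ (one_pos.trans_le (one_le_norm_one_add_mul hre hε)) hε]
  linarith

theorem norm_one_sub_cauchyDamping_le (hp : Integrable p) (hp0 : ∀ t, 0 ≤ p t) (hε : 0 < ε)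
    (hz : 1 ≤ z.im) : ‖1 - cauchyDamping p ε z‖ ≤ ε * ∫ t, p t := by
  have hz0 : 0 < z.im := one_pos.trans_le hz
  have h1 := one_le_norm_one_add_mul (re_neg_I_mul_cauchyTransform_nonneg hp hp0 hz0) hε
  have hne : 1 + ε * (-Complex.I * cauchyTransform (fun t => p t) z) ≠ 0 :=
    norm_pos_iff.1 (one_pos.trans_le h1)
  have heq : 1 - cauchyDamping p ε z =
      ε * (-Complex.I * cauchyTransform (fun t => p t) z) * cauchyDamping p ε z := by
    rw [cauchyDamping, eq_mul_inv_iff_mul_eq₀ hne, sub_mul, inv_mul_cancel₀ hne]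
    ring
  have hC : ‖cauchyTransform (fun t => p t) z‖ ≤ ∫ t, p t := by
    refine (norm_cauchyTransform_le hp.ofReal hz0).trans ?_
    simp only [RCLike.norm_ofReal, abs_of_nonneg (hp0 _)]
    exact div_le_self (integral_nonneg hp0) hz
  rw [heq, norm_mul, norm_mul, norm_mul, norm_neg, Complex.norm_I, one_mul,
    Complex.norm_of_nonneg hε.le]
  exact (mul_le_of_le_one_right (by positivity) (norm_cauchyDamping_le_one hp hp0 hε hz0)).trans
    (by gcongr)

theorem differentiableOn_cauchyDamping (hp : Integrable p) (hp0 : ∀ t, 0 ≤ p t) (hε : 0 < ε) :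
    DifferentiableOn ℂ (cauchyDamping p ε) {z | 0 < z.im} := by
  intro z hz
  have hd : DifferentiableAt ℂ (cauchyTransform (fun t => p t)) z :=
    differentiableAt_cauchyTransform hp.ofReal hz
  refine (DifferentiableAt.fun_inv (𝕜 := ℂ) ((hd.const_mul _).const_mul _ |>.const_add 1) (norm_pos_iff.1 (one_pos.trans_le
    (one_le_norm_one_add_mul (re_neg_I_mul_cauchyTransform_nonneg hp hp0 hz) hε)))
    ).differentiableWithinAt

end Damping

/-- Integrable boundary values of the Cauchy transform of a real integrable function have
integral zero. -/
theorem integral_boundary_cauchyTransform_eq_zero {f : ℝ → ℝ} (hf : Integrable f) {y : ℕ → ℝ}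
    (hy : ∀ n, 0 < y n) {Fb : ℝ → ℂ} (hFb : Integrable Fb)
    (hlim : ∀ᵐ x : ℝ, Tendsto (fun n => cauchyTransform (fun t => f t) (x + y n * Complex.I)) atTop
      (𝓝 (Fb x))) : ∫ x, Fb x = 0 := by
  set p : ℝ → ℝ := fun t => max (f t) 0 with hpdef
  set q : ℝ → ℝ := fun t => max (-f t) 0 with hqdef
  have hp : Integrable p := hf.pos_part
  have hq : Integrable q := hf.neg_part
  have hp0 : ∀ t, 0 ≤ p t := fun t => le_max_right _ _
  have hq0 : ∀ t, 0 ≤ q t := fun t => le_max_right _ _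
  have hsub : ∀ z : ℂ, 0 < z.im → cauchyTransform (fun t => f t) z =
      cauchyTransform (fun t => p t) z - cauchyTransform (fun t => q t) z := by
    intro z hz
    have hpi : Integrable fun t : ℝ => (p t : ℂ) / (t - z) :=
      integrable_div_ofReal_sub hp.ofReal hz
    have hqi : Integrable fun t : ℝ => (q t : ℂ) / (t - z) :=
      integrable_div_ofReal_sub hq.ofReal hz
    rw [cauchyTransform, cauchyTransform, cauchyTransform, ← integral_sub hpi hqi]
    refine integral_congr_ae (ae_of_all _ fun t => ?_)
    have hfpq : f t = p t - q t := by
      simp only [hpdef, hqdef]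
      rcases le_total 0 (f t) with h | h
      · rw [max_eq_left h, max_eq_right (by linarith), sub_zero]
      · rw [max_eq_right h, max_eq_left (by linarith), zero_sub, neg_neg]
    simp only [← sub_div, hfpq, Complex.ofReal_sub]
  have hε : ∀ k : ℕ, (0 : ℝ) < 1 / ((k : ℝ) + 1) := fun k => Nat.one_div_pos_of_nat
  refine integral_boundary_eq_zero (F := cauchyTransform fun t => f t)
    (M := fun k z => cauchyDamping p (1 / ((k : ℝ) + 1)) z * cauchyDamping q (1 / ((k : ℝ) + 1)) z)
    (A := fun k => 1 / (1 / ((k : ℝ) + 1)) + 1 / (1 / ((k : ℝ) + 1)))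
    (b := fun k => (1 / ((k : ℝ) + 1) * ∫ t, p t) + 1 / ((k : ℝ) + 1) * ∫ t, q t)
    (fun z hz => (differentiableAt_cauchyTransform hf.ofReal hz).differentiableWithinAt)
    (fun k => (differentiableOn_cauchyDamping hp hp0 (hε k)).mul
      (differentiableOn_cauchyDamping hq hq0 (hε k)))
    (fun k z hz => ?_) (fun k z hz => ?_) ?_ (fun k z hz => ?_) hy hFb hlim
  · rw [norm_mul]
    exact mul_le_one₀ (norm_cauchyDamping_le_one hp hp0 (hε k) hz) (norm_nonneg _)
      (norm_cauchyDamping_le_one hq hq0 (hε k) hz)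
  · have h1 := norm_cauchyTransform_mul_cauchyDamping_le hp hp0 (hε k) hz
    have h2 := norm_cauchyTransform_mul_cauchyDamping_le hq hq0 (hε k) hz
    have h3 := norm_cauchyDamping_le_one hp hp0 (hε k) hz
    have h4 := norm_cauchyDamping_le_one hq hq0 (hε k) hz
    set dp := cauchyDamping p (1 / ((k : ℝ) + 1)) z
    set dq := cauchyDamping q (1 / ((k : ℝ) + 1)) z
    rw [show cauchyTransform (fun t => f t) z * (dp * dq) =
        cauchyTransform (fun t => p t) z * dp * dq - cauchyTransform (fun t => q t) z * dq * dp by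
      rw [hsub z hz]; ring]
    refine (norm_sub_le _ _).trans (add_le_add ?_ ?_)
    · rw [norm_mul]
      exact (mul_le_of_le_one_right (norm_nonneg _) h4).trans h1
    · rw [norm_mul]
      exact (mul_le_of_le_one_right (norm_nonneg _) h3).trans h2
  · have h := tendsto_one_div_add_atTop_nhds_zero_nat (𝕜 := ℝ)
    simpa using (h.mul_const (∫ t, p t)).add (h.mul_const (∫ t, q t))
  · have h1 := norm_one_sub_cauchyDamping_le hp hp0 (hε k) hz
    have h2 := norm_one_sub_cauchyDamping_le hq hq0 (hε k) hz
    have h4 := norm_cauchyDamping_le_one hq hq0 (hε k) (one_pos.trans_le hz)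
    set dp := cauchyDamping p (1 / ((k : ℝ) + 1)) z
    set dq := cauchyDamping q (1 / ((k : ℝ) + 1)) z
    rw [show 1 - dp * dq = (1 - dp) * dq + (1 - dq) by ring]
    refine (norm_add_le _ _).trans (add_le_add ?_ h2)
    rw [norm_mul]
    exact (mul_le_of_le_one_right (norm_nonneg _) h4).trans h1

/-- A real integrable function whose principal value Hilbert transform is integrable has
integral zero. -/
theorem integral_eq_zero_of_integrable_hilbertTransform {f h : ℝ → ℝ} (hf : Integrable f)
    (hlim : ∀ x : ℝ, Tendsto (fun δ : ℝ => ∫ t in {t : ℝ | δ < |t - x|}, f t / (t - x))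
      (𝓝[>] 0) (𝓝 (h x))) (hh : Integrable h) : ∫ t, f t = 0 := by
  obtain ⟨y, hy0, hy, hae⟩ := exists_seq_tendsto_cauchyTransform_sub (f := fun t => f t) hf.ofReal
  have hFb : Integrable fun x => (h x : ℂ) + π * Complex.I * f x :=
    hh.ofReal.add (hf.ofReal.const_mul _)
  have hzero := integral_boundary_cauchyTransform_eq_zero hf hy0 hFb (by
    filter_upwards [hae] with x hx
    have h1 := (Complex.continuous_ofReal.tendsto _).comp ((hlim x).comp
      (tendsto_nhdsWithin_iff.2 ⟨hy, Eventually.of_forall hy0⟩))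
    refine (h1.add hx).congr fun n => ?_
    have h2 : ∫ t in {t : ℝ | y n < |t - x|}, (f t : ℂ) / ((t - x : ℝ) : ℂ) =
        ((∫ t in {t : ℝ | y n < |t - x|}, f t / (t - x) : ℝ) : ℂ) := by
      rw [← integral_complex_ofReal]
      simp only [Complex.ofReal_div]
    simp only [Function.comp, h2]
    ring)
  have hsplit : ∫ x, ((h x : ℂ) + π * Complex.I * f x) =
      ((∫ x, h x : ℝ) : ℂ) + π * Complex.I * ((∫ x, f x : ℝ) : ℂ) := by
    rw [integral_add hh.ofReal (hf.ofReal.const_mul _), integral_const_mul]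
    simp only [integral_complex_ofReal]
  rw [hsplit] at hzero
  have him := congrArg Complex.im hzero
  simpa [pi_ne_zero] using him

/-- **Kober's theorem.** If `g ∈ L¹(ℝ)` and its Hilbert transform
`Hg(x) = (1/π) p.v. ∫ g(t)/(t−x) dt` is also Lebesgue integrable on `ℝ`
(i.e. `g` belongs to the real Hardy space `H¹(ℝ)`), then `∫_ℝ g(t) dt = 0`. -/
theorem integral_eq_zero_of_mem_H1 (g Hg : ℝ → ℂ)
    -- g is Lebesgue integrable on ℝ
    (hg : MeasureTheory.Integrable g)
    -- Hg is the Hilbert transform (principal value) of g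
    (hHg : ∀ x : ℝ,
      Filter.Tendsto (fun δ : ℝ =>
          ((1 / Real.pi : ℝ) : ℂ) *
            ∫ t in {t : ℝ | δ < |t - x|}, g t / ((t - x : ℝ) : ℂ))
        (nhdsWithin 0 (Set.Ioi 0)) (nhds (Hg x)))
    -- g ∈ H¹(ℝ) : Hg is Lebesgue integrable on ℝ
    (hint : MeasureTheory.Integrable Hg) :
    ∫ t : ℝ, g t = 0 := by
  have hHg' : ∀ x : ℝ, Tendsto (fun δ : ℝ =>
      ∫ t in {t : ℝ | δ < |t - x|}, g t / ((t - x : ℝ) : ℂ)) (𝓝[>] 0) (𝓝 (π * Hg x)) := by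
    intro x
    refine ((hHg x).const_mul (π : ℂ)).congr fun δ => ?_
    have hπ : (π : ℂ) ≠ 0 := Complex.ofReal_ne_zero.2 pi_ne_zero
    rw [← mul_assoc, Complex.ofReal_div, Complex.ofReal_one, mul_one_div_cancel hπ, one_mul]
  have hre : ∫ t, (g t).re = 0 := by
    refine integral_eq_zero_of_integrable_hilbertTransform hg.re (fun x => ?_)
      (hint.const_mul (π : ℂ)).re
    refine ((Complex.continuous_re.tendsto _).comp (hHg' x)).congr' ?_
    filter_upwards [self_mem_nhdsWithin] with δ hδ
    have h := integral_re (integrableOn_div_ofReal_sub hg x hδ)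
    simp only [RCLike.re_to_complex, Complex.div_ofReal_re] at h
    exact h.symm
  have him : ∫ t, (g t).im = 0 := by
    refine integral_eq_zero_of_integrable_hilbertTransform hg.im (fun x => ?_)
      (hint.const_mul (π : ℂ)).im
    refine ((Complex.continuous_im.tendsto _).comp (hHg' x)).congr' ?_
    filter_upwards [self_mem_nhdsWithin] with δ hδ
    have h := integral_im (integrableOn_div_ofReal_sub hg x hδ)
    simp only [RCLike.im_to_complex, Complex.div_ofReal_im] at h
    exact h.symm
  have h1 := integral_re hg
  have h2 := integral_im hg
  simp only [RCLike.re_to_complex, RCLike.im_to_complex] at h1 h2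
  exact Complex.ext (h1.symm.trans hre) (h2.symm.trans him)
end
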